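/- Let ν be a probability measure on ℝ^d with finite second moment and let (X_t)_{t ≥ 0} be a stochastic process on a probability space such that X_t has law ν for every t ≥ 0. Assume that for every ε > 0 there exist ξ, M > 0 such that for all t ∈ [ε, ε^{-1}], E[exp((1+ξ)‖X_t − X_0‖²/(e^{2t} − 1))] ≤ M. Then for every s > 0, W_2(ν, γ) ≤ ∫_0^∞ e^{-t} E[S(t)]^{1/2} dt, where S(t) = ‖E[(X_t − X_0)/s + X_0 | X_0]‖² + (e^{2t} − 1)^{-1} ‖E[(X_t − X_0)^{⊗2}/(2s) − I_d | X_0]‖² + Σ_{k ≥ 3} (s² k · k! (e^{2t} − 1)^{k−1})^{-1} ‖E[(X_t − X_0)^{⊗k} | X_0]‖². -/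

import Mathlib

open MeasureTheory ProbabilityTheory Real
open scoped ENNReal NNReal BigOperators Topology Classical

noncomputable section

/-- `ℝ^d` with the Euclidean norm. -/
abbrev Euc (d : ℕ) := EuclideanSpace ℝ (Fin d)

/-- The standard Gaussian measure on `ℝ^d`. -/
def stdGaussian (d : ℕ) : Measure (Euc d) :=
  volume.withDensity fun x =>
    ENNReal.ofReal ((2 * Real.pi) ^ (-(d : ℝ) / 2) * Real.exp (-‖x‖ ^ 2 / 2))

/-- The Wasserstein distance of order `p` between two measures, valued in `ℝ≥0∞`. -/
def wassersteinDist {E : Type*} [NormedAddCommGroup E] [MeasurableSpace E]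
    (p : ℝ) (μ ν : Measure E) : ℝ≥0∞ :=
  ⨅ (cpl : Measure (E × E)) (_ : IsProbabilityMeasure cpl)
    (_ : cpl.map Prod.fst = μ) (_ : cpl.map Prod.snd = ν),
    (∫⁻ q, ENNReal.ofReal (‖q.1 - q.2‖ ^ p) ∂cpl) ^ (1 / p)

/-- Degree `|α|` of a multi-index. -/
def mdeg {d : ℕ} (α : Fin d → ℕ) : ℕ := ∑ i, α i

/-- Factorial `α!` of a multi-index. -/
def mfact {d : ℕ} (α : Fin d → ℕ) : ℕ := ∏ i, (α i).factorial

/-- Monomial `x^α`. -/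
def monoE {d : ℕ} (α : Fin d → ℕ) (x : Euc d) : ℝ := ∏ i, x i ^ α i

/-- The family indexed by multi-indices of degree 2 associated with the identity matrix. -/
def idFam {d : ℕ} (α : Fin d → ℕ) : ℝ := if ∃ i : Fin d, α = Pi.single i 2 then 1 else 0

/-- Partial derivative in the `i`-th coordinate direction. -/
def pderivE {d : ℕ} (i : Fin d) (f : Euc d → ℝ) : Euc d → ℝ :=
  fun x => fderiv ℝ f x (EuclideanSpace.single i 1)

/-- Iterated partial derivative `∂^α`. -/
def mderivE {d : ℕ} (α : Fin d → ℕ) (f : Euc d → ℝ) : Euc d → ℝ :=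
  ((List.ofFn fun i : Fin d => (pderivE i)^[α i]).foldr (· ∘ ·) id) f

/-- `∂^α` applied componentwise to a vector field. -/
def mderivVec {d : ℕ} (α : Fin d → ℕ) (g : Euc d → Euc d) (x : Euc d) : Euc d :=
  (EuclideanSpace.equiv (Fin d) ℝ).symm fun i => mderivE α (fun y => g y i) x

/-- The Ornstein-Uhlenbeck semigroup `P_t`. -/
def OU {d : ℕ} (t : ℝ) (φ : Euc d → ℝ) (x : Euc d) : ℝ :=
  ∫ y, φ (Real.exp (-t) • x + Real.sqrt (1 - Real.exp (-2 * t)) • y) ∂(stdGaussian d)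

/-- The Ornstein-Uhlenbeck semigroup acting componentwise on a vector field. -/
def OUvec {d : ℕ} (t : ℝ) (g : Euc d → Euc d) (x : Euc d) : Euc d :=
  ∫ y, g (Real.exp (-t) • x + Real.sqrt (1 - Real.exp (-2 * t)) • y) ∂(stdGaussian d)

/-- The `k`-th probabilists' Hermite polynomial, as a function `ℝ → ℝ`. -/
def hermiteR (k : ℕ) (x : ℝ) : ℝ := Polynomial.aeval x (Polynomial.hermite k)

/-- The multivariate Hermite polynomial `H_α`. -/
def hermiteM {d : ℕ} (α : Fin d → ℕ) (x : Euc d) : ℝ := ∏ i, hermiteR (α i) (x i)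

/-- The Hilbert–Schmidt norm of the matrix `E[Y Yᵀ]`. -/
def covHS {Ω : Type*} [MeasurableSpace Ω] {d : ℕ} (P : Measure Ω) (Y : Ω → Euc d) : ℝ :=
  Real.sqrt (∑ k, ∑ l, (∫ ω, Y ω k * Y ω l ∂P) ^ 2)

/-- The Hilbert–Schmidt norm of the matrix `E[Y Yᵀ ‖Y‖^l]`. -/
def covHSw {Ω : Type*} [MeasurableSpace Ω] {d : ℕ} (P : Measure Ω) (Y : Ω → Euc d) (l : ℝ) : ℝ :=
  Real.sqrt (∑ k, ∑ k', (∫ ω, Y ω k * Y ω k' * ‖Y ω‖ ^ l ∂P) ^ 2)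

theorem stdGaussian_eq_map_pi (d : ℕ) : _root_.stdGaussian d =
    (Measure.pi fun _ : Fin d => gaussianReal 0 1).map (WithLp.toLp 2) := by
  have hpi : (Measure.pi fun _ : Fin d => gaussianReal 0 1) =
      (volume : Measure (Fin d → ℝ)).withDensity
        fun x => ENNReal.ofReal (∏ i, gaussianPDFReal 0 1 (x i)) := by
    refine Measure.pi_eq (μ := fun _ : Fin d => gaussianReal 0 1) fun s hs => ?_
    rw [withDensity_apply _ (MeasurableSet.univ_pi hs)]
    have hint : ∀ i, Integrable ((s i).indicator (gaussianPDFReal 0 1)) volume := fun i =>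
      (integrable_gaussianPDFReal 0 1).indicator (hs i)
    have hnn : ∀ i x, 0 ≤ (s i).indicator (gaussianPDFReal 0 1) x := fun i x =>
      Set.indicator_nonneg (fun y _ => gaussianPDFReal_nonneg 0 1 y) x
    have h1 : ∀ i, gaussianReal 0 1 (s i) =
        ENNReal.ofReal (∫ x, (s i).indicator (gaussianPDFReal 0 1) x) := by
      intro i
      rw [gaussianReal_apply _ one_ne_zero, integral_indicator (hs i),
        ofReal_integral_eq_lintegral_ofReal (integrable_gaussianPDFReal 0 1).integrableOn
          (Filter.Eventually.of_forall fun y => gaussianPDFReal_nonneg 0 1 y)]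
      rfl
    simp_rw [h1]
    rw [← ENNReal.ofReal_prod_of_nonneg (fun i _ => integral_nonneg (hnn i)),
      ← integral_fintype_prod_volume_eq_prod, volume_pi,
      ofReal_integral_eq_lintegral_ofReal (Integrable.fintype_prod hint)
        (Filter.Eventually.of_forall fun x => Finset.prod_nonneg fun i _ => hnn i _),
      ← lintegral_indicator (MeasurableSet.univ_pi hs)]
    refine lintegral_congr fun x => ?_
    by_cases hx : x ∈ Set.univ.pi s
    · rw [Set.indicator_of_mem hx]
      congr 1
      refine Finset.prod_congr rfl fun i _ => ?_
      rw [Set.indicator_of_mem (hx i (Set.mem_univ i))]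
    · rw [Set.indicator_of_notMem hx]
      simp only [Set.mem_pi, Set.mem_univ, true_implies, not_forall] at hx
      obtain ⟨i, hi⟩ := hx
      rw [Finset.prod_eq_zero (Finset.mem_univ i) (Set.indicator_of_notMem hi _)]
      simp
  have hvol : (volume : Measure (Euc d)) =
      (volume : Measure (Fin d → ℝ)).map (WithLp.toLp 2) :=
    (PiLp.volume_preserving_toLp (Fin d)).map_eq.symm
  ext s hs
  have hm : Measurable (WithLp.toLp 2 : (Fin d → ℝ) → Euc d) := by fun_prop
  rw [Measure.map_apply hm hs, hpi, withDensity_apply _ (hm hs), _root_.stdGaussian,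
    withDensity_apply _ hs, hvol, setLIntegral_map hs (by fun_prop) hm]
  refine lintegral_congr fun x => ?_
  congr 1
  simp only [gaussianPDFReal]
  rw [Finset.prod_mul_distrib, ← Real.exp_sum]
  congr 1
  · simp only [NNReal.coe_one, mul_one, Finset.prod_const, Finset.card_univ, Fintype.card_fin,
      Real.sqrt_eq_rpow]
    rw [← Real.rpow_neg (by positivity), ← Real.rpow_natCast, ← Real.rpow_mul (by positivity)]
    congr 1
    ring
  · congr 1
    rw [EuclideanSpace.norm_sq_eq]
    simp [Finset.sum_neg_distrib, Finset.sum_div, neg_div]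

instance isProbabilityMeasure_stdGaussian (d : ℕ) :
    IsProbabilityMeasure (_root_.stdGaussian d) := by
  rw [stdGaussian_eq_map_pi]
  exact Measure.isProbabilityMeasure_map (by fun_prop)

theorem integrable_prod_stdGaussian {d : ℕ} {f : Fin d → ℝ → ℝ}
    (hf : ∀ i, Integrable (f i) (gaussianReal 0 1)) :
    Integrable (fun z : Euc d => ∏ i, f i (z i)) (_root_.stdGaussian d) := by
  rw [stdGaussian_eq_map_pi]
  exact ((MeasurableEquiv.toLp 2 (Fin d → ℝ)).measurableEmbedding.integrable_map_iff).2
    (Integrable.fintype_prod hf)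

theorem integral_prod_stdGaussian {d : ℕ} (f : Fin d → ℝ → ℝ) :
    ∫ z : Euc d, ∏ i, f i (z i) ∂(_root_.stdGaussian d) =
      ∏ i, ∫ x, f i x ∂(gaussianReal 0 1) := by
  rw [stdGaussian_eq_map_pi, ← integral_fintype_prod_eq_prod]
  exact (MeasurableEquiv.toLp 2 (Fin d → ℝ)).measurableEmbedding.integral_map _

theorem integrable_aeval_gaussianReal (p : Polynomial ℤ) :
    Integrable (fun x : ℝ => Polynomial.aeval x p) (gaussianReal 0 1) := by
  have hpow : ∀ n : ℕ, Integrable (fun x : ℝ => x ^ n) (gaussianReal 0 1) := by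
    intro n
    have := (memLp_id_gaussianReal (μ := 0) (v := 1) (n : ℝ≥0))
    have h2 : MemLp id (n : ℝ≥0∞) (gaussianReal 0 1) := by simpa using this
    by_cases hn : n = 0
    · subst hn; simp
    refine (integrable_norm_iff (by fun_prop)).1 ?_
    simpa using h2.integrable_norm_pow hn
  simp_rw [Polynomial.aeval_eq_sum_range, zsmul_eq_mul]
  refine integrable_finsetSum _ fun i _ => ?_
  exact (hpow i).const_mul _

theorem integral_mul_gaussianReal_aeval (p : Polynomial ℤ) :
    ∫ x : ℝ, x * Polynomial.aeval x p ∂(gaussianReal 0 1) =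
      ∫ x : ℝ, Polynomial.aeval x (Polynomial.derivative p) ∂(gaussianReal 0 1) := by
  have key : ∀ q : Polynomial ℤ, Integrable
      (fun x : ℝ => gaussianPDFReal 0 1 x * Polynomial.aeval x q) volume := by
    intro q
    have h := integrable_aeval_gaussianReal q
    rw [gaussianReal_of_var_ne_zero _ one_ne_zero] at h
    have h2 := (integrable_withDensity_iff_integrable_smul' (measurable_gaussianPDF 0 1)
      (Filter.Eventually.of_forall fun x => gaussianPDF_lt_top)).1 h
    refine h2.congr (Filter.Eventually.of_forall fun x => ?_)
    simp
  have hder : ∀ x : ℝ, HasDerivAt (fun x : ℝ => gaussianPDFReal 0 1 x * Polynomial.aeval x p)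
      (gaussianPDFReal 0 1 x * Polynomial.aeval x (Polynomial.derivative p - Polynomial.X * p))
      x := by
    intro x
    have h1 : HasDerivAt (gaussianPDFReal 0 1) (gaussianPDFReal 0 1 x * (-x)) x := by
      unfold gaussianPDFReal
      have h0 : HasDerivAt (fun x : ℝ => -(x - 0) ^ 2 / (2 * ((1 : ℝ≥0) : ℝ))) (-x) x := by
        have := (((hasDerivAt_id x).sub_const 0).pow 2).neg.div_const (2 * ((1 : ℝ≥0) : ℝ))
        convert! this using 1
        simp
        ring
      have := (h0.exp).const_mul (√(2 * π * ((1 : ℝ≥0) : ℝ)))⁻¹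
      convert! this using 1
      ring
    have h2 := h1.mul (p.hasDerivAt_aeval x)
    convert! h2 using 1
    simp
    ring
  have h0 := integral_eq_zero_of_hasDerivAt_of_integrable hder (key _) (key _)
  rw [integral_gaussianReal_eq_integral_smul one_ne_zero,
    integral_gaussianReal_eq_integral_smul one_ne_zero]
  have h1 := integral_sub (key (Polynomial.derivative p)) (key (Polynomial.X * p))
  simp only [smul_eq_mul]
  simp only [map_sub, map_mul, Polynomial.aeval_X, mul_sub] at h0 h1
  rw [h1] at h0
  linarith

theorem integral_hermite_succ_mul (n : ℕ) (p : Polynomial ℤ) :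
    ∫ x : ℝ, Polynomial.aeval x (Polynomial.hermite (n + 1) * p) ∂(gaussianReal 0 1) =
      ∫ x : ℝ, Polynomial.aeval x (Polynomial.hermite n * Polynomial.derivative p)
        ∂(gaussianReal 0 1) := by
  have h1 := integral_mul_gaussianReal_aeval (Polynomial.hermite n * p)
  have h2 : ∀ x : ℝ, Polynomial.aeval x (Polynomial.hermite (n + 1) * p) =
      x * Polynomial.aeval x (Polynomial.hermite n * p) -
        Polynomial.aeval x (Polynomial.derivative (Polynomial.hermite n) * p) := by
    intro x
    rw [Polynomial.hermite_succ]
    simp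
    ring
  simp_rw [h2]
  rw [integral_sub, h1, ← integral_sub]
  · simp
  · exact integrable_aeval_gaussianReal _
  · exact integrable_aeval_gaussianReal _
  · refine (integrable_aeval_gaussianReal (Polynomial.X * (Polynomial.hermite n * p))).congr
      (Filter.Eventually.of_forall fun x => ?_)
    simp
  · exact integrable_aeval_gaussianReal _

theorem integral_hermite_mul_hermite_le (m n : ℕ) (h : n ≤ m) :
    ∫ x : ℝ, Polynomial.aeval x (Polynomial.hermite m * Polynomial.hermite n)
      ∂(gaussianReal 0 1) = if m = n then (m.factorial : ℝ) else 0 := by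
  have key : ∀ (m : ℕ) (p : Polynomial ℤ),
      ∫ x : ℝ, Polynomial.aeval x (Polynomial.hermite m * p) ∂(gaussianReal 0 1) =
      ∫ x : ℝ, Polynomial.aeval x (Polynomial.derivative^[m] p) ∂(gaussianReal 0 1) := by
    intro m
    induction m with
    | zero => intro p; simp
    | succ m ih => intro p; rw [integral_hermite_succ_mul, ih]; rfl
  rw [key]
  split_ifs with hmn
  · subst hmn
    have := Polynomial.iterate_derivative_eq_factorial_smul_sum (Polynomial.hermite m) m
    have h2 : Polynomial.derivative^[m] (Polynomial.hermite m) = Polynomial.C (m.factorial : ℤ) := by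
      ext k
      rw [Polynomial.coeff_iterate_derivative, Polynomial.coeff_C]
      split_ifs with hk
      · subst hk
        simp [Polynomial.coeff_hermite_self, Nat.descFactorial_self]
      · rw [Polynomial.coeff_hermite_of_lt (by omega)]
        simp
    rw [h2]
    simp
  · rw [Polynomial.iterate_derivative_eq_zero]
    · simp
    · rw [Polynomial.natDegree_hermite]
      omega

theorem integral_hermiteR_mul (m n : ℕ) :
    ∫ x, hermiteR m x * hermiteR n x ∂(gaussianReal 0 1) =
      if m = n then (m.factorial : ℝ) else 0 := by
  simp only [hermiteR, ← map_mul]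
  rcases le_total n m with h | h
  · exact integral_hermite_mul_hermite_le m n h
  · rw [mul_comm, integral_hermite_mul_hermite_le n m h]
    simp only [eq_comm]
    split_ifs with h
    · rw [h]
    · rfl

theorem integrable_hermiteR_mul (m n : ℕ) :
    Integrable (fun x => hermiteR m x * hermiteR n x) (gaussianReal 0 1) := by
  simp only [hermiteR, ← map_mul]
  exact integrable_aeval_gaussianReal _

theorem integrable_hermiteM_mul {d : ℕ} (α β : Fin d → ℕ) :
    Integrable (fun z => hermiteM α z * hermiteM β z) (_root_.stdGaussian d) := by
  simp only [hermiteM, ← Finset.prod_mul_distrib]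
  exact integrable_prod_stdGaussian (f := fun i x => hermiteR (α i) x * hermiteR (β i) x)
    fun i => integrable_hermiteR_mul _ _

theorem integral_hermiteM_mul {d : ℕ} (α β : Fin d → ℕ) :
    ∫ z, hermiteM α z * hermiteM β z ∂(_root_.stdGaussian d) =
      if α = β then (mfact α : ℝ) else 0 := by
  simp only [hermiteM, ← Finset.prod_mul_distrib]
  rw [integral_prod_stdGaussian (fun i x => hermiteR (α i) x * hermiteR (β i) x)]
  simp only [integral_hermiteR_mul]
  split_ifs with h
  · subst h; simp [mfact]
  · obtain ⟨i, hi⟩ := Function.ne_iff.1 h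
    exact Finset.prod_eq_zero (Finset.mem_univ i) (by simp [hi])

theorem continuous_hermiteR (n : ℕ) : Continuous (hermiteR n) := by
  unfold hermiteR
  exact (Polynomial.hermite n).continuous_aeval

@[fun_prop]
theorem continuous_hermiteM {d : ℕ} (α : Fin d → ℕ) : Continuous (hermiteM α) := by
  unfold hermiteM
  exact continuous_finsetProd _ fun i _ => (continuous_hermiteR _).comp (by fun_prop)

theorem hermiteM_zero {d : ℕ} (z : Euc d) : hermiteM (0 : Fin d → ℕ) z = 1 := by
  simp [hermiteM, hermiteR]

theorem hermiteM_single {d : ℕ} (i : Fin d) (z : Euc d) :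
    hermiteM (Pi.single i 1 : Fin d → ℕ) z = z i := by
  unfold hermiteM
  rw [Finset.prod_eq_single i]
  · simp [hermiteR]
  · intro j _ hj; simp [Pi.single_eq_of_ne hj, hermiteR]
  · simp

theorem memLp_hermiteM {d : ℕ} (α : Fin d → ℕ) : MemLp (hermiteM α) 2 (_root_.stdGaussian d) := by
  rw [memLp_two_iff_integrable_sq (by fun_prop)]
  simpa [sq] using integrable_hermiteM_mul α α

/-- The density of the standard Gaussian measure. -/
def gaussDensity (d : ℕ) (z : Euc d) : ℝ :=
  (2 * Real.pi) ^ (-(d : ℝ) / 2) * Real.exp (-‖z‖ ^ 2 / 2)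

theorem gaussDensity_pos {d : ℕ} (z : Euc d) : 0 < gaussDensity d z := by
  unfold gaussDensity; positivity

@[fun_prop]
theorem continuous_gaussDensity (d : ℕ) : Continuous (gaussDensity d) := by
  unfold gaussDensity; fun_prop

theorem integral_stdGaussian {d : ℕ} (f : Euc d → ℝ) :
    ∫ z, f z ∂(_root_.stdGaussian d) = ∫ z, gaussDensity d z * f z := by
  rw [_root_.stdGaussian, integral_withDensity_eq_integral_toReal_smul (by fun_prop)
    (Filter.Eventually.of_forall fun _ => ENNReal.ofReal_lt_top)]
  refine integral_congr_ae (Filter.Eventually.of_forall fun z => ?_)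
  change (ENNReal.ofReal (gaussDensity d z)).toReal * f z = _
  rw [ENNReal.toReal_ofReal (gaussDensity_pos z).le]

theorem integrable_stdGaussian_iff {d : ℕ} (f : Euc d → ℝ) :
    Integrable f (_root_.stdGaussian d) ↔ Integrable (fun z => gaussDensity d z * f z) := by
  rw [_root_.stdGaussian, integrable_withDensity_iff_integrable_smul' (by fun_prop)
    (Filter.Eventually.of_forall fun _ => ENNReal.ofReal_lt_top)]
  refine integrable_congr (Filter.Eventually.of_forall fun z => ?_)
  change (ENNReal.ofReal (gaussDensity d z)).toReal * f z = _
  rw [ENNReal.toReal_ofReal (gaussDensity_pos z).le]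

theorem gaussDensity_sub {d : ℕ} (z δ : Euc d) :
    gaussDensity d (z - δ) = gaussDensity d z * ∏ i, Real.exp (δ i * z i - δ i ^ 2 / 2) := by
  unfold gaussDensity
  rw [← Real.exp_sum, mul_assoc, ← Real.exp_add, EuclideanSpace.norm_sq_eq,
    EuclideanSpace.norm_sq_eq]
  congr 2
  rw [neg_div, neg_div, Finset.sum_div, Finset.sum_div, ← Finset.sum_neg_distrib,
    ← Finset.sum_neg_distrib, ← Finset.sum_add_distrib]
  refine Finset.sum_congr rfl fun i _ => ?_
  simp
  ring

/-- The Cameron-Martin formula. -/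
theorem integral_add_stdGaussian {d : ℕ} (f : Euc d → ℝ) (δ : Euc d) :
    ∫ z, f (z + δ) ∂(_root_.stdGaussian d) =
      ∫ z, (∏ i, Real.exp (δ i * z i - δ i ^ 2 / 2)) * f z ∂(_root_.stdGaussian d) := by
  rw [integral_stdGaussian, integral_stdGaussian,
    ← integral_sub_right_eq_self _ δ]
  refine integral_congr_ae (Filter.Eventually.of_forall fun z => ?_)
  simp only [gaussDensity_sub, sub_add_cancel]
  ring

theorem hasSum_mul_real {ι κ : Type*} {f : ι → ℝ} {g : κ → ℝ} {a b : ℝ} (hf : HasSum f a)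
    (hg : HasSum g b) : HasSum (fun x : ι × κ => f x.1 * g x.2) (a * b) := by
  have h1 : Summable fun x => ‖f x‖ := hf.summable.norm
  have h2 : Summable fun x => ‖g x‖ := hg.summable.norm
  exact hf.mul hg (summable_mul_of_summable_norm h1 h2)

theorem hasSum_pi_prod {d : ℕ} {f : Fin d → ℕ → ℝ} {a : Fin d → ℝ}
    (h : ∀ i, HasSum (f i) (a i)) :
    HasSum (fun β : Fin d → ℕ => ∏ i, f i (β i)) (∏ i, a i) := by
  induction d with
  | zero =>
    simp
  | succ d ih =>
    have h1 : HasSum (fun β : Fin d → ℕ => ∏ i : Fin d, f i.succ (β i)) (∏ i : Fin d, a i.succ) :=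
      ih (fun i => h i.succ)
    generalize hb : ∏ i : Fin d, a i.succ = b at h1
    have h2 := hasSum_mul_real (h 0) h1
    have h3 : (fun x : ℕ × (Fin d → ℕ) => f 0 x.1 * ∏ i : Fin d, f i.succ (x.2 i)) =
        (fun β : Fin (d + 1) → ℕ => ∏ i, f i (β i)) ∘ (Fin.consEquiv fun _ => ℕ) := by
      ext ⟨n, β⟩
      simp [Fin.prod_univ_succ, Fin.consEquiv]
    rw [h3, Equiv.hasSum_iff] at h2
    rw [Fin.prod_univ_succ, hb]
    exact h2

theorem hermiteR_hasDerivAt (n : ℕ) (x : ℝ) :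
    HasDerivAt (fun x => hermiteR n x * Real.exp (-x ^ 2 / 2))
      (-(hermiteR (n + 1) x * Real.exp (-x ^ 2 / 2))) x := by
  have h0 : HasDerivAt (fun x : ℝ => -x ^ 2 / 2) (-x) x := by
    have := ((hasDerivAt_id x).pow 2).neg.div_const 2
    convert! this using 1
    simp
    ring
  have h1 := ((Polynomial.hermite n).hasDerivAt_aeval x).mul h0.exp
  convert! h1 using 1
  simp only [hermiteR, Polynomial.hermite_succ]
  simp
  ring

theorem hasSum_hermiteR (x y : ℝ) :
    HasSum (fun n : ℕ => x ^ n / n.factorial * hermiteR n y) (Real.exp (x * y - x ^ 2 / 2)) := by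
  have hd : Differentiable ℂ fun w : ℂ => Complex.exp (w * y - w ^ 2 / 2) := by fun_prop
  have hiter : ∀ n : ℕ, iteratedDeriv n (fun w : ℂ => Complex.exp (w * y - w ^ 2 / 2)) =
      fun w => Polynomial.aeval ((y : ℂ) - w) (Polynomial.hermite n) *
        Complex.exp (w * y - w ^ 2 / 2) := by
    intro n
    induction n with
    | zero => ext w; simp
    | succ n ih =>
      rw [iteratedDeriv_succ, ih]
      ext w
      have h1 : HasDerivAt (fun w : ℂ => (y : ℂ) - w) (-1) w := by
        simpa using (hasDerivAt_id w).const_sub (y : ℂ)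
      have h2 : HasDerivAt (fun w : ℂ => w * y - w ^ 2 / 2) (y - w) w := by
        have := ((hasDerivAt_id w).mul_const (y : ℂ)).sub (((hasDerivAt_id w).pow 2).div_const 2)
        convert! this using 1
        simp
      have h3 := (((Polynomial.hermite n).hasDerivAt_aeval ((y : ℂ) - w)).comp w h1).mul h2.cexp
      refine HasDerivAt.deriv (h3.congr_deriv ?_)
      rw [Polynomial.hermite_succ]
      simp
      ring
  have h := Complex.hasSum_taylorSeries_of_entire hd 0 x
  have h2 : (Complex.exp ((x : ℂ) * y - (x : ℂ) ^ 2 / 2)) =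
      ((Real.exp (x * y - x ^ 2 / 2) : ℝ) : ℂ) := by push_cast; rfl
  simp only [h2] at h
  rw [← Complex.hasSum_ofReal]
  convert! h using 1
  ext n
  rw [hiter]
  simp only [hermiteR, sub_zero, smul_eq_mul, zero_mul]
  have h3 : ((Polynomial.aeval y (Polynomial.hermite n) : ℝ) : ℂ) =
      Polynomial.aeval (y : ℂ) (Polynomial.hermite n) := by
    have := Polynomial.aeval_algebraMap_apply (B := ℂ) y (Polynomial.hermite n)
    exact this.symm
  push_cast
  rw [h3]
  simp
  ring

/-- The generating function of the multivariate Hermite polynomials. -/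
theorem hasSum_hermiteM {d : ℕ} (δ z : Euc d) :
    HasSum (fun β : Fin d → ℕ => monoE β δ / mfact β * hermiteM β z)
      (∏ i, Real.exp (δ i * z i - δ i ^ 2 / 2)) := by
  convert! hasSum_pi_prod (fun i => hasSum_hermiteR (δ i) (z i)) using 2 with β
  simp [monoE, mfact, hermiteM, Finset.prod_mul_distrib, Finset.prod_div_distrib]

theorem gaussDensity_mul_hermiteM {d : ℕ} (α : Fin d → ℕ) (z : Euc d) :
    gaussDensity d z * hermiteM α z = (2 * Real.pi) ^ (-(d : ℝ) / 2) *
      ∏ i, (hermiteR (α i) (z i) * Real.exp (-z i ^ 2 / 2)) := by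
  unfold gaussDensity hermiteM
  rw [Finset.prod_mul_distrib, ← Real.exp_sum, EuclideanSpace.norm_sq_eq]
  simp only [neg_div, Finset.sum_div, Finset.sum_neg_distrib, Real.norm_eq_abs, sq_abs]
  ring

theorem hasLineDerivAt_gaussDensity_mul_hermiteM {d : ℕ} (α : Fin d → ℕ) (i : Fin d) (z : Euc d) :
    HasLineDerivAt ℝ (fun z => gaussDensity d z * hermiteM α z)
      (-(gaussDensity d z * hermiteM (α + Pi.single i 1) z)) z (EuclideanSpace.single i 1) := by
  simp only [gaussDensity_mul_hermiteM]
  unfold HasLineDerivAt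
  have h1 : ∀ t : ℝ, ∏ j, (hermiteR (α j) ((z + t • EuclideanSpace.single i (1 : ℝ)) j) *
      Real.exp (-((z + t • EuclideanSpace.single i (1 : ℝ)) j) ^ 2 / 2)) =
      (hermiteR (α i) (z i + t) * Real.exp (-(z i + t) ^ 2 / 2)) *
        ∏ j ∈ Finset.univ.erase i, (hermiteR (α j) (z j) * Real.exp (-z j ^ 2 / 2)) := by
    intro t
    rw [← Finset.mul_prod_erase _ _ (Finset.mem_univ i)]
    congr 1
    · simp
    · refine Finset.prod_congr rfl fun j hj => ?_
      have : j ≠ i := Finset.ne_of_mem_erase hj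
      simp [this]
  have h2 : ∏ j, (hermiteR ((α + Pi.single i 1 : Fin d → ℕ) j) (z j) * Real.exp (-z j ^ 2 / 2)) =
      (hermiteR (α i + 1) (z i) * Real.exp (-z i ^ 2 / 2)) *
        ∏ j ∈ Finset.univ.erase i, (hermiteR (α j) (z j) * Real.exp (-z j ^ 2 / 2)) := by
    rw [← Finset.mul_prod_erase _ _ (Finset.mem_univ i)]
    congr 1
    · simp
    · refine Finset.prod_congr rfl fun j hj => ?_
      have : j ≠ i := Finset.ne_of_mem_erase hj
      simp [this]
  simp only [h1, h2]
  have h3 : HasDerivAt (fun t : ℝ => z i + t) 1 0 := (hasDerivAt_id 0).const_add (z i)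
  have h4 : HasDerivAt (fun x => hermiteR (α i) x * Real.exp (-x ^ 2 / 2))
      (-(hermiteR (α i + 1) (z i) * Real.exp (-z i ^ 2 / 2))) (z i + 0) := by
    simpa using hermiteR_hasDerivAt (α i) (z i)
  have h5 := ((h4.comp 0 h3).mul_const (∏ j ∈ Finset.univ.erase i,
    (hermiteR (α j) (z j) * Real.exp (-z j ^ 2 / 2)))).const_mul ((2 * Real.pi) ^ (-(d : ℝ) / 2))
  refine h5.congr_deriv ?_
  ring

/-- Gaussian integration by parts against Hermite polynomials. -/
theorem integral_lineDeriv_mul_hermiteM {d : ℕ} (α : Fin d → ℕ) (i : Fin d) {ψ ψ' : Euc d → ℝ}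
    (hψ : ∀ z, HasLineDerivAt ℝ ψ (ψ' z) z (EuclideanSpace.single i 1))
    (h0 : Integrable (fun z => ψ z * hermiteM α z) (_root_.stdGaussian d))
    (h1 : Integrable (fun z => ψ z * hermiteM (α + Pi.single i 1) z) (_root_.stdGaussian d))
    (h2 : Integrable (fun z => ψ' z * hermiteM α z) (_root_.stdGaussian d)) :
    ∫ z, ψ' z * hermiteM α z ∂(_root_.stdGaussian d) =
      ∫ z, ψ z * hermiteM (α + Pi.single i 1) z ∂(_root_.stdGaussian d) := by
  rw [integrable_stdGaussian_iff] at h0 h1 h2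
  rw [integral_stdGaussian, integral_stdGaussian]
  have := integral_bilinear_hasLineDerivAt_right_eq_neg_left_of_integrable
    (μ := (volume : Measure (Euc d))) (f := ψ) (f' := ψ')
    (g := fun z => gaussDensity d z * hermiteM α z)
    (g' := fun z => -(gaussDensity d z * hermiteM (α + Pi.single i 1) z))
    (v := EuclideanSpace.single i 1) (B := ContinuousLinearMap.mul ℝ ℝ)
    (by simpa [mul_left_comm] using h2) (by simpa [mul_left_comm] using h1.neg)
    (by simpa [mul_left_comm] using h0) (fun z _ => hψ z)
    (fun z _ => hasLineDerivAt_gaussDensity_mul_hermiteM α i z)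
  simp only [ContinuousLinearMap.mul_apply', mul_neg, integral_neg, neg_inj,
    mul_left_comm (ψ _), mul_left_comm (ψ' _)] at this
  exact this.symm

theorem mfact_pos {d : ℕ} (α : Fin d → ℕ) : (0 : ℝ) < mfact α := by
  unfold mfact
  exact_mod_cast Finset.prod_pos fun i _ => Nat.factorial_pos _

theorem abs_hermiteM_le {d : ℕ} (α : Fin d → ℕ) (z : Euc d) :
    |hermiteM α z| ≤ Real.sqrt (mfact α) * ((1 + hermiteM α z * hermiteM α z / mfact α) / 2) := by
  have h := Real.sqrt_pos.2 (mfact_pos α)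
  have h2 := Real.mul_self_sqrt (mfact_pos α).le
  set a := Real.sqrt (mfact α)
  rw [← h2, ← abs_mul_abs_self (hermiteM α z)]
  have h3 : a * ((1 + |hermiteM α z| * |hermiteM α z| / (a * a)) / 2) - |hermiteM α z| =
      (a - |hermiteM α z|) ^ 2 / (2 * a) := by
    field_simp
    ring
  have : 0 ≤ (a - |hermiteM α z|) ^ 2 / (2 * a) := by positivity
  linarith

theorem integral_abs_hermiteM_le {d : ℕ} (α : Fin d → ℕ) :
    ∫ z, |hermiteM α z| ∂(_root_.stdGaussian d) ≤ Real.sqrt (mfact α) := by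
  have hi := (integrable_hermiteM_mul α α).div_const (mfact α : ℝ)
  have hi2 := (((integrable_const (1 : ℝ)).add hi).div_const 2).const_mul (Real.sqrt (mfact α))
  refine (integral_mono_of_nonneg (Filter.Eventually.of_forall fun z => abs_nonneg _) hi2
    (Filter.Eventually.of_forall fun z => abs_hermiteM_le α z)).trans ?_
  simp only [Pi.add_apply]
  rw [integral_const_mul, integral_div, integral_add (integrable_const _) hi, integral_div,
    integral_hermiteM_mul, if_pos rfl, div_self (mfact_pos α).ne']
  simp

theorem integrable_hermiteM {d : ℕ} (α : Fin d → ℕ) :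
    Integrable (hermiteM α) (_root_.stdGaussian d) :=
  (memLp_hermiteM α).integrable (by norm_num)

theorem integrable_mul_hermiteM_of_bdd {d : ℕ} {f : Euc d → ℝ} (hf : Measurable f) {B : ℝ}
    (hB : ∀ z, |f z| ≤ B) (α : Fin d → ℕ) :
    Integrable (fun z => f z * hermiteM α z) (_root_.stdGaussian d) :=
  (integrable_hermiteM α).bdd_mul hf.aestronglyMeasurable (Filter.Eventually.of_forall hB)

theorem integral_abs_mul_hermiteM_le {d : ℕ} {f : Euc d → ℝ} {B : ℝ}
    (hB : ∀ z, |f z| ≤ B) (α : Fin d → ℕ) :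
    ∫ z, |f z * hermiteM α z| ∂(_root_.stdGaussian d) ≤ B * Real.sqrt (mfact α) := by
  have hB0 : 0 ≤ B := (abs_nonneg _).trans (hB 0)
  calc ∫ z, |f z * hermiteM α z| ∂(_root_.stdGaussian d)
      ≤ ∫ z, B * |hermiteM α z| ∂(_root_.stdGaussian d) := by
        refine integral_mono_of_nonneg (Filter.Eventually.of_forall fun z => abs_nonneg _)
          ((integrable_hermiteM α).abs.const_mul B) (Filter.Eventually.of_forall fun z => ?_)
        simp only [abs_mul]
        exact mul_le_mul_of_nonneg_right (hB z) (abs_nonneg _)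
    _ ≤ _ := by
        rw [integral_const_mul]
        exact mul_le_mul_of_nonneg_left (integral_abs_hermiteM_le α) hB0

/-- A summable majorant of `|δ^β| / √β!`. -/
def monoMajorant {d : ℕ} (r : ℝ) (δ : Euc d) (β : Fin d → ℕ) : ℝ :=
  (∏ i, r ^ β i + ∏ i, (δ i ^ 2 / r) ^ β i / (β i).factorial) / 2

theorem hasSum_monoMajorant {d : ℕ} {r : ℝ} (hr : 0 < r) (hr1 : r < 1) (δ : Euc d) :
    HasSum (monoMajorant r δ) (((1 - r)⁻¹ ^ d + Real.exp (‖δ‖ ^ 2 / r)) / 2) := by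
  have h1 := hasSum_pi_prod (fun _ : Fin d => hasSum_geometric_of_lt_one hr.le hr1)
  have h2 := hasSum_pi_prod (fun i : Fin d => by
    have := NormedSpace.expSeries_div_hasSum_exp (δ i ^ 2 / r)
    rw [← Real.exp_eq_exp_ℝ] at this
    exact this)
  have h3 := (h1.add h2).div_const 2
  rw [← Real.exp_sum, ← Finset.sum_div] at h3
  convert! h3 using 3
  · simp
  · rw [EuclideanSpace.norm_sq_eq]
    simp

theorem abs_monoE_div_le {d : ℕ} {r : ℝ} (hr : 0 < r) (δ : Euc d) (β : Fin d → ℕ) :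
    |monoE β δ / mfact β| * Real.sqrt (mfact β) ≤ monoMajorant r δ β := by
  have hm := mfact_pos β
  have h := Real.sqrt_pos.2 hm
  have h2 := Real.mul_self_sqrt hm.le
  have hA : 0 < ∏ i, r ^ β i := Finset.prod_pos fun i _ => by positivity
  have e : ∏ i, (δ i ^ 2 / r) ^ β i / ((β i).factorial : ℝ) =
      monoE β δ ^ 2 / ((∏ i, r ^ β i) * mfact β) := by
    simp only [monoE, mfact, Finset.prod_div_distrib, div_pow, ← Finset.prod_pow]
    push_cast
    rw [div_div]
    congr 1
    exact Finset.prod_congr rfl fun i _ => by ring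
  unfold monoMajorant
  rw [e, abs_div, abs_of_pos hm, ← sq_abs (monoE β δ)]
  set A := ∏ i, r ^ β i
  set a := Real.sqrt (mfact β)
  rw [← h2]
  have h3 : (A + |monoE β δ| ^ 2 / (A * (a * a))) / 2 - |monoE β δ| / (a * a) * a =
      (A * a - |monoE β δ|) ^ 2 / (2 * A * a ^ 2) := by
    field_simp
    ring
  have : 0 ≤ (A * a - |monoE β δ|) ^ 2 / (2 * A * a ^ 2) := by positivity
  linarith

/-- The `β`-th Hermite coefficient of `z ↦ φ (c x + σ z)`. -/
def hermiteCoeff {d : ℕ} (c σ : ℝ) (φ : Euc d → ℝ) (β : Fin d → ℕ) (x : Euc d) : ℝ :=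
  ∫ z, φ (c • x + σ • z) * hermiteM β z ∂(_root_.stdGaussian d)

theorem measurable_hermiteCoeff {d : ℕ} (c σ : ℝ) {φ : Euc d → ℝ} (hφ : Measurable φ)
    (β : Fin d → ℕ) : Measurable (hermiteCoeff c σ φ β) := by
  have h : StronglyMeasurable (Function.uncurry fun x z : Euc d =>
      φ (c • x + σ • z) * hermiteM β z) := by
    refine Measurable.stronglyMeasurable ?_
    have := (continuous_hermiteM β).measurable
    simp only [Function.uncurry_def]
    fun_prop
  exact h.integral_prod_right.measurable

theorem abs_hermiteCoeff_le {d : ℕ} (c σ : ℝ) {φ : Euc d → ℝ} {B : ℝ} (hB : ∀ z, |φ z| ≤ B)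
    (β : Fin d → ℕ) (x : Euc d) : |hermiteCoeff c σ φ β x| ≤ B * Real.sqrt (mfact β) :=
  (abs_integral_le_integral_abs).trans (integral_abs_mul_hermiteM_le (fun _ => hB _) β)

theorem hasSum_hermiteCoeff {d : ℕ} (c σ : ℝ) {φ : Euc d → ℝ} (hφ : Measurable φ) {B : ℝ}
    (hB : ∀ z, |φ z| ≤ B) {x x' δ : Euc d} (h : c • x' = c • x + σ • δ) :
    HasSum (fun β => monoE β δ / mfact β * hermiteCoeff c σ φ β x) (hermiteCoeff c σ φ 0 x') := by
  have hB0 : 0 ≤ B := (abs_nonneg _).trans (hB 0)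
  have hf : Measurable fun z : Euc d => φ (c • x + σ • z) := by fun_prop
  have e : hermiteCoeff c σ φ 0 x' = ∫ z, ∑' β : Fin d → ℕ,
      monoE β δ / mfact β * (φ (c • x + σ • z) * hermiteM β z) ∂(_root_.stdGaussian d) := by
    have := integral_add_stdGaussian (fun z => φ (c • x + σ • z)) δ
    simp only [hermiteCoeff, hermiteM_zero, mul_one, h]
    simp only [smul_add, ← add_assoc] at this
    simp only [add_right_comm _ (σ • δ), this]
    refine integral_congr_ae (Filter.Eventually.of_forall fun z => ?_)
    have h3 := (hasSum_hermiteM δ z).mul_right (φ (c • x + σ • z))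
    refine h3.tsum_eq.symm.trans ?_
    exact tsum_congr fun β => by ring
  rw [e]
  unfold hermiteCoeff
  simp only [← integral_const_mul]
  refine hasSum_integral_of_summable_integral_norm
    (fun β => (integrable_mul_hermiteM_of_bdd hf (fun _ => hB _) β).const_mul _) ?_
  refine Summable.of_nonneg_of_le (fun β => integral_nonneg fun z => norm_nonneg _) (fun β => ?_)
    ((hasSum_monoMajorant (r := 1 / 2) (by norm_num) (by norm_num) δ).summable.mul_left B)
  simp only [norm_mul, Real.norm_eq_abs, ← abs_mul (φ _)]
  rw [integral_const_mul]
  calc _ ≤ |monoE β δ / mfact β| * (B * Real.sqrt (mfact β)) :=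
        mul_le_mul_of_nonneg_left (by simpa only [abs_mul] using integral_abs_mul_hermiteM_le (fun _ => hB _) β)
          (abs_nonneg _)
    _ = B * (|monoE β δ / mfact β| * Real.sqrt (mfact β)) := by ring
    _ ≤ _ := mul_le_mul_of_nonneg_left (abs_monoE_div_le (by norm_num) δ β) hB0

/-- If `X` and `X'` have the same law, all nontrivial terms of the Hermite expansion of
`E φ(c X' + σ Z)` around `X` add up to zero. -/
theorem hasSum_integral_hermiteCoeff {d : ℕ} {Ω : Type*} [MeasurableSpace Ω] {P : Measure Ω}
    [IsProbabilityMeasure P] {X X' δ : Ω → Euc d} (hX : Measurable X) (hX' : Measurable X')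
    (hδ : Measurable δ) (hlaw : P.map X' = P.map X) (c σ : ℝ)
    (h : ∀ ω, c • X' ω = c • X ω + σ • δ ω) {r : ℝ} (hr : 0 < r) (hr1 : r < 1)
    (hint : Integrable (fun ω => Real.exp (‖δ ω‖ ^ 2 / r)) P) {φ : Euc d → ℝ} (hφ : Measurable φ)
    {B : ℝ} (hB : ∀ z, |φ z| ≤ B) :
    HasSum (fun β => ∫ ω, monoE β (δ ω) / mfact β * hermiteCoeff c σ φ β (X ω) ∂P)
      (∫ ω, hermiteCoeff c σ φ 0 (X ω) ∂P) := by
  have hB0 : 0 ≤ B := (abs_nonneg _).trans (hB 0)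
  have e : ∫ ω, hermiteCoeff c σ φ 0 (X ω) ∂P = ∫ ω, hermiteCoeff c σ φ 0 (X' ω) ∂P := by
    have hm := (measurable_hermiteCoeff c σ hφ 0).stronglyMeasurable
    rw [← integral_map hX.aemeasurable hm.aestronglyMeasurable, ← hlaw,
      integral_map hX'.aemeasurable hm.aestronglyMeasurable]
  rw [e]
  have hs := fun ω => (hasSum_monoMajorant hr hr1 (δ ω)).mul_left B
  refine hasSum_integral_of_dominated_convergence (fun β ω => B * monoMajorant r (δ ω) β)
    (fun β => ?_) (fun β => Filter.Eventually.of_forall fun ω => ?_)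
    (Filter.Eventually.of_forall fun ω => (hs ω).summable) ?_
    (Filter.Eventually.of_forall fun ω => hasSum_hermiteCoeff c σ hφ hB (h ω))
  · have := (measurable_hermiteCoeff c σ hφ β).comp hX
    have h2 : Measurable fun ω => monoE β (δ ω) := by unfold monoE; fun_prop
    exact ((h2.div_const _).mul this).aestronglyMeasurable
  · rw [norm_mul, Real.norm_eq_abs, Real.norm_eq_abs]
    calc _ ≤ |monoE β (δ ω) / mfact β| * (B * Real.sqrt (mfact β)) :=
          mul_le_mul_of_nonneg_left (abs_hermiteCoeff_le c σ hB β _) (abs_nonneg _)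
      _ = B * (|monoE β (δ ω) / mfact β| * Real.sqrt (mfact β)) := by ring
      _ ≤ _ := mul_le_mul_of_nonneg_left (abs_monoE_div_le hr (δ ω) β) hB0
  · simp only [(hs _).tsum_eq]
    exact (((integrable_const _).add hint).div_const 2).const_mul B

theorem measurable_monoE {d : ℕ} (β : Fin d → ℕ) : Measurable (monoE β) := by
  unfold monoE; fun_prop

theorem monoE_sq_le {d : ℕ} {r : ℝ} (hr : 0 < r) (δ : Euc d) (β : Fin d → ℕ) :
    monoE β δ ^ 2 ≤ (∏ i, r ^ β i) * mfact β * Real.exp (‖δ‖ ^ 2 / r) := by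
  have hm := mfact_pos β
  have hA : 0 < ∏ i, r ^ β i := Finset.prod_pos fun i _ => by positivity
  have h2 := hasSum_pi_prod (fun i : Fin d => by
    have := NormedSpace.expSeries_div_hasSum_exp (δ i ^ 2 / r)
    rw [← Real.exp_eq_exp_ℝ] at this
    exact this)
  rw [← Real.exp_sum, ← Finset.sum_div] at h2
  have h3 := le_hasSum h2 β fun j _ => Finset.prod_nonneg fun i _ => by positivity
  have e : ∏ i, (δ i ^ 2 / r) ^ β i / ((β i).factorial : ℝ) =
      monoE β δ ^ 2 / ((∏ i, r ^ β i) * mfact β) := by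
    simp only [monoE, mfact, Finset.prod_div_distrib, div_pow, ← Finset.prod_pow]
    push_cast
    rw [div_div]
    congr 1
    exact Finset.prod_congr rfl fun i _ => by ring
  rw [e, div_le_iff₀ (by positivity)] at h3
  rw [EuclideanSpace.norm_sq_eq]
  simp only [Real.norm_eq_abs, sq_abs]
  linarith

theorem memLp_monoE {d : ℕ} {Ω : Type*} [MeasurableSpace Ω] {P : Measure Ω} {δ : Ω → Euc d}
    (hδ : Measurable δ) {r : ℝ} (hr : 0 < r)
    (hint : Integrable (fun ω => Real.exp (‖δ ω‖ ^ 2 / r)) P) (β : Fin d → ℕ) :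
    MemLp (fun ω => monoE β (δ ω)) 2 P := by
  have hm : Measurable fun ω => monoE β (δ ω) := (measurable_monoE β).comp hδ
  rw [memLp_two_iff_integrable_sq hm.aestronglyMeasurable]
  refine (hint.const_mul ((∏ i, r ^ β i) * mfact β)).mono' (hm.pow_const 2).aestronglyMeasurable
    (Filter.Eventually.of_forall fun ω => ?_)
  rw [Real.norm_eq_abs, abs_of_nonneg (sq_nonneg _)]
  exact monoE_sq_le hr _ β

theorem sq_hermiteCoeff_le {d : ℕ} (c σ : ℝ) {f : Euc d → ℝ} {x : Euc d}
    (hf : MemLp (fun z => f (c • x + σ • z)) 2 (_root_.stdGaussian d)) (α : Fin d → ℕ) :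
    hermiteCoeff c σ f α x ^ 2 ≤
      mfact α * ∫ z, f (c • x + σ • z) ^ 2 ∂(_root_.stdGaussian d) := by
  have hm := mfact_pos α
  set Γ := hermiteCoeff c σ f α x with hΓ
  have h0 : 0 ≤ ∫ z, (f (c • x + σ • z) - Γ / mfact α * hermiteM α z) ^ 2
      ∂(_root_.stdGaussian d) := integral_nonneg fun z => sq_nonneg _
  have hi1 := hf.integrable_sq
  have hi2 : Integrable (fun z => f (c • x + σ • z) * hermiteM α z) (_root_.stdGaussian d) :=
    hf.integrable_mul (memLp_hermiteM α)
  have hi3 := integrable_hermiteM_mul α α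
  have e : ∀ z, (f (c • x + σ • z) - Γ / mfact α * hermiteM α z) ^ 2 =
      f (c • x + σ • z) ^ 2 - 2 * (Γ / mfact α) * (f (c • x + σ • z) * hermiteM α z) +
        (Γ / mfact α) ^ 2 * (hermiteM α z * hermiteM α z) := fun z => by ring
  simp only [e] at h0
  have hi4 := hi2.const_mul (2 * (Γ / mfact α))
  rw [integral_add (by exact hi1.sub hi4) (hi3.const_mul _), integral_sub hi1 hi4,
    integral_const_mul, integral_const_mul, integral_hermiteM_mul, if_pos rfl]
    at h0
  change 0 ≤ _ - 2 * (Γ / mfact α) * Γ + _ at h0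
  have e2 : 2 * (Γ / mfact α) * Γ - (Γ / mfact α) ^ 2 * mfact α = Γ ^ 2 / mfact α := by
    field_simp
    ring
  have h1 : Γ ^ 2 / mfact α ≤ ∫ z, f (c • x + σ • z) ^ 2 ∂(_root_.stdGaussian d) := by linarith
  rw [div_le_iff₀ hm] at h1
  linarith

theorem hermiteCoeff_add_single {d : ℕ} {c σ : ℝ} {φ : Euc d → ℝ} (hφ : Measurable φ) {B : ℝ}
    (hB : ∀ y, |φ y| ≤ B) {f : Euc d → ℝ} (i : Fin d)
    (hd : ∀ y, HasLineDerivAt ℝ φ (c * f y) y (EuclideanSpace.single i 1)) {x : Euc d}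
    (hf : MemLp (fun z => f (c • x + σ • z)) 2 (_root_.stdGaussian d)) (α : Fin d → ℕ) :
    hermiteCoeff c σ φ (α + Pi.single i 1) x = σ * c * hermiteCoeff c σ f α x := by
  have hφ' : Measurable fun z : Euc d => φ (c • x + σ • z) := by fun_prop
  have h1 : ∀ z, HasLineDerivAt ℝ (fun z => φ (c • x + σ • z)) (σ * c * f (c • x + σ • z)) z
      (EuclideanSpace.single i 1) := by
    intro z
    have h2 : HasDerivAt (fun t : ℝ => σ * t) σ 0 := by
      simpa using (hasDerivAt_id (0 : ℝ)).const_mul σ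
    have h3 := hd (c • x + σ • z)
    unfold HasLineDerivAt at h3 ⊢
    rw [← mul_zero σ] at h3
    have h4 := h3.comp 0 h2
    refine (h4.congr_deriv (by ring)).congr_of_eventuallyEq (Filter.Eventually.of_forall fun t => ?_)
    simp only [Function.comp]
    congr 1
    rw [smul_add, smul_smul, add_assoc]
  unfold hermiteCoeff
  rw [← integral_lineDeriv_mul_hermiteM α i h1
    (integrable_mul_hermiteM_of_bdd hφ' (fun _ => hB _) α)
    (integrable_mul_hermiteM_of_bdd hφ' (fun _ => hB _) _)
    (by
      have : Integrable (fun z => f (c • x + σ • z) * hermiteM α z) (_root_.stdGaussian d) :=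
        hf.integrable_mul (memLp_hermiteM α)
      simpa only [mul_assoc] using (this.const_mul c).const_mul σ), ← integral_const_mul]
  simp only [mul_assoc]

/-- The weight `β i / (|β| β!)`. -/
def hermiteWeight {d : ℕ} (i : Fin d) (β : Fin d → ℕ) : ℝ := β i / (mdeg β * mfact β)

theorem hermiteWeight_eq_zero {d : ℕ} {i : Fin d} {β : Fin d → ℕ} (h : β i = 0) :
    hermiteWeight i β = 0 := by simp [hermiteWeight, h]

theorem sub_single_add_single {d : ℕ} {i : Fin d} {β : Fin d → ℕ} (h : β i ≠ 0) :
    β - Pi.single i 1 + Pi.single i 1 = β := by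
  ext j
  by_cases hj : j = i
  · subst hj; simp; omega
  · simp [hj]

theorem mul_mfact_sub_single {d : ℕ} {i : Fin d} {β : Fin d → ℕ} (h : β i ≠ 0) :
    (β i : ℝ) * mfact (β - Pi.single i 1) = mfact β := by
  unfold mfact
  rw [← Finset.mul_prod_erase _ _ (Finset.mem_univ i),
    ← Finset.mul_prod_erase _ (fun j => (β j).factorial) (Finset.mem_univ i)]
  have e : ∏ j ∈ Finset.univ.erase i, ((β - Pi.single i 1 : Fin d → ℕ) j).factorial =
      ∏ j ∈ Finset.univ.erase i, (β j).factorial := by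
    refine Finset.prod_congr rfl fun j hj => ?_
    simp [Finset.ne_of_mem_erase hj]
  rw [e]
  have h2 : ((β - Pi.single i 1 : Fin d → ℕ) i) = β i - 1 := by simp
  rw [h2, ← Nat.mul_factorial_pred h]
  push_cast
  ring

theorem sum_hermiteWeight {d : ℕ} {β : Fin d → ℕ} (h : β ≠ 0) :
    ∑ i, hermiteWeight i β = 1 / mfact β := by
  have h1 : (mdeg β : ℝ) ≠ 0 := by
    intro h0
    apply h
    have : mdeg β = 0 := by exact_mod_cast h0
    ext i
    exact (Finset.sum_eq_zero_iff.1 this) i (Finset.mem_univ i)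
  have := (mfact_pos β).ne'
  unfold hermiteWeight
  rw [← Finset.sum_div, ← Nat.cast_sum]
  change (mdeg β : ℝ) / _ = _
  field_simp

theorem integral_sq_sum_hermiteM {d : ℕ} (i : Fin d) (s : Finset (Fin d → ℕ))
    (C : (Fin d → ℕ) → ℝ) :
    ∫ z, (∑ β ∈ s, hermiteWeight i β * C β * hermiteM (β - Pi.single i 1) z) ^ 2
      ∂(_root_.stdGaussian d) = ∑ β ∈ s, hermiteWeight i β / mdeg β * C β ^ 2 := by
  have e : ∀ z, (∑ β ∈ s, hermiteWeight i β * C β * hermiteM (β - Pi.single i 1) z) ^ 2 =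
      ∑ β ∈ s, ∑ β' ∈ s, (hermiteWeight i β * C β * (hermiteWeight i β' * C β')) *
        (hermiteM (β - Pi.single i 1) z * hermiteM (β' - Pi.single i 1) z) := by
    intro z
    rw [sq, Finset.sum_mul_sum]
    exact Finset.sum_congr rfl fun β _ => Finset.sum_congr rfl fun β' _ => by ring
  simp only [e]
  rw [integral_finsetSum _ fun β _ => integrable_finsetSum _ fun β' _ =>
    (integrable_hermiteM_mul _ _).const_mul _]
  refine Finset.sum_congr rfl fun β hβ => ?_
  rw [integral_finsetSum _ fun β' _ => (integrable_hermiteM_mul _ _).const_mul _]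
  simp only [integral_const_mul, integral_hermiteM_mul]
  by_cases h0 : β i = 0
  · simp [hermiteWeight_eq_zero h0]
  rw [Finset.sum_eq_single β]
  · rw [if_pos rfl]
    have h1 : (mfact (β - Pi.single i 1) : ℝ) = mfact β / β i := by
      rw [← mul_mfact_sub_single h0]
      field_simp
    rw [h1]
    have := (mfact_pos β).ne'
    have h3 : (β i : ℝ) ≠ 0 := by exact_mod_cast h0
    have h4 : (mdeg β : ℝ) ≠ 0 := by
      have : β i ≤ mdeg β := Finset.single_le_sum (f := β) (fun _ _ => Nat.zero_le _)
        (Finset.mem_univ i)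
      exact_mod_cast (by omega : mdeg β ≠ 0)
    unfold hermiteWeight
    field_simp
  · intro β' _ hne
    by_cases h1 : β' i = 0
    · simp [hermiteWeight_eq_zero h1]
    rw [if_neg, mul_zero]
    intro h
    apply hne
    rw [← sub_single_add_single h0, h, sub_single_add_single h1]
  · intro h
    exact absurd hβ h

theorem sum_hermiteWeight_mul_hermiteCoeff_le {d : ℕ} (c σ : ℝ) {g : Euc d → Euc d} {x : Euc d}
    (hg : ∀ i, MemLp (fun z => g (c • x + σ • z) i) 2 (_root_.stdGaussian d))
    (s : Finset (Fin d → ℕ)) (C : (Fin d → ℕ) → ℝ) :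
    ∑ β ∈ s, ∑ i, hermiteWeight i β * C β *
        hermiteCoeff c σ (fun y => g y i) (β - Pi.single i 1) x ≤
      1 / 2 * ∫ z, ‖g (c • x + σ • z)‖ ^ 2 ∂(_root_.stdGaussian d) +
        1 / 2 * ∑ β ∈ s, C β ^ 2 / (mdeg β * mfact β) := by
  have key : ∀ i, ∑ β ∈ s, hermiteWeight i β * C β *
        hermiteCoeff c σ (fun y => g y i) (β - Pi.single i 1) x ≤
      1 / 2 * ∫ z, g (c • x + σ • z) i ^ 2 ∂(_root_.stdGaussian d) +
        1 / 2 * ∑ β ∈ s, hermiteWeight i β / mdeg β * C β ^ 2 := by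
    intro i
    have hT : MemLp (fun z => ∑ β ∈ s, hermiteWeight i β * C β * hermiteM (β - Pi.single i 1) z)
        2 (_root_.stdGaussian d) :=
      memLp_finsetSum _ fun β _ => (memLp_hermiteM _).const_mul _
    rw [← integral_sq_sum_hermiteM, ← mul_add, ← integral_add (hg i).integrable_sq hT.integrable_sq,
      ← integral_const_mul]
    have e : ∑ β ∈ s, hermiteWeight i β * C β *
        hermiteCoeff c σ (fun y => g y i) (β - Pi.single i 1) x =
        ∫ z, g (c • x + σ • z) i *
          ∑ β ∈ s, hermiteWeight i β * C β * hermiteM (β - Pi.single i 1) z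
          ∂(_root_.stdGaussian d) := by
      simp only [hermiteCoeff, ← integral_const_mul]
      rw [← integral_finsetSum _ fun β _ => by
        exact ((hg i).integrable_mul (memLp_hermiteM (β - Pi.single i 1))).const_mul
          (hermiteWeight i β * C β)]
      refine integral_congr_ae (Filter.Eventually.of_forall fun z => ?_)
      simp only [Finset.mul_sum]
      exact Finset.sum_congr rfl fun β _ => by ring
    rw [e]
    refine integral_mono ((hg i).integrable_mul hT)
      (((hg i).integrable_sq.add hT.integrable_sq).const_mul _) fun z => ?_
    change g (c • x + σ • z) i * _ ≤ 1 / 2 * (_ + _)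
    nlinarith [sq_nonneg (g (c • x + σ • z) i -
      ∑ β ∈ s, hermiteWeight i β * C β * hermiteM (β - Pi.single i 1) z)]
  rw [Finset.sum_comm]
  refine (Finset.sum_le_sum fun i _ => key i).trans (le_of_eq ?_)
  rw [Finset.sum_add_distrib, ← Finset.mul_sum, ← Finset.mul_sum,
    ← integral_finsetSum _ fun i _ => (hg i).integrable_sq, Finset.sum_comm]
  congr 2
  · simp [EuclideanSpace.norm_sq_eq]
  · refine Finset.sum_congr rfl fun β _ => ?_
    rw [← Finset.sum_mul, ← Finset.sum_div]
    by_cases h : β = 0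
    · subst h; simp [hermiteWeight, mdeg]
    · rw [sum_hermiteWeight h, div_div]
      ring

theorem monoE_smul {d : ℕ} (a : ℝ) (β : Fin d → ℕ) (x : Euc d) :
    monoE β (a • x) = a ^ mdeg β * monoE β x := by
  simp [monoE, mdeg, mul_pow, Finset.prod_mul_distrib, Finset.prod_pow_eq_pow_sum]

theorem mdeg_ne_zero {d : ℕ} {β : Fin d → ℕ} (h : β ≠ 0) : mdeg β ≠ 0 := by
  intro h0
  apply h
  ext i
  exact (Finset.sum_eq_zero_iff.1 h0) i (Finset.mem_univ i)

/-- The families whose conditional expectations given `x` bound the score. -/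
def scoreFam {d : ℕ} (s q : ℝ) (x y : Euc d) (β : Fin d → ℕ) : ℝ :=
  (∑ j, if β = Pi.single j 1 then x j else 0) - (∑ j, if β = Pi.single j 2 then 2 / q else 0) +
    monoE β y / (s * q ^ (mdeg β - 1))

theorem integral_condExp_mul {Ω : Type*} {m m0 : MeasurableSpace Ω} (hm : m ≤ m0) {P : Measure Ω}
    [IsProbabilityMeasure P] {A G : Ω → ℝ} (hA : MemLp A 2 P) (hG : MemLp G 2 P)
    (hGm : StronglyMeasurable[m] G) :
    ∫ ω, A ω * G ω ∂P = ∫ ω, P[A | m] ω * G ω ∂P := by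
  have h := condExp_mul_of_stronglyMeasurable_right (μ := P) hGm (hA.integrable_mul hG)
    (hA.integrable (by norm_num))
  rw [← integral_condExp hm]
  exact integral_congr_ae h

section
variable {d : ℕ} {Ω : Type*} [MeasurableSpace Ω] {P : Measure Ω} [IsProbabilityMeasure P]
  {X D : Ω → Euc d} {c σ : ℝ} {g : Euc d → Euc d}

theorem ae_memLp_slice (hg : Measurable g)
    (hG : Integrable (fun p : Ω × Euc d => ‖g (c • X p.1 + σ • p.2)‖ ^ 2)
      (P.prod (_root_.stdGaussian d))) :
    ∀ᵐ ω ∂P, ∀ i, MemLp (fun z => g (c • X ω + σ • z) i) 2 (_root_.stdGaussian d) := by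
  filter_upwards [hG.prod_right_ae] with ω hω i
  have hm : Measurable fun z => g (c • X ω + σ • z) i := by fun_prop
  rw [memLp_two_iff_integrable_sq hm.aestronglyMeasurable]
  refine hω.mono' (hm.pow_const 2).aestronglyMeasurable (Filter.Eventually.of_forall fun z => ?_)
  rw [Real.norm_eq_abs, abs_of_nonneg (sq_nonneg _), EuclideanSpace.norm_sq_eq]
  simp only [Real.norm_eq_abs, sq_abs]
  exact Finset.single_le_sum (f := fun i => g (c • X ω + σ • z) i ^ 2) (fun _ _ => sq_nonneg _)
    (Finset.mem_univ i)

theorem memLp_hermiteCoeff_comp (hX : Measurable X) (hg : Measurable g)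
    (hG : Integrable (fun p : Ω × Euc d => ‖g (c • X p.1 + σ • p.2)‖ ^ 2)
      (P.prod (_root_.stdGaussian d))) (i : Fin d) (α : Fin d → ℕ) :
    MemLp (fun ω => hermiteCoeff c σ (fun y => g y i) α (X ω)) 2 P := by
  have hgi : Measurable fun y => g y i := by fun_prop
  have hm := (measurable_hermiteCoeff c σ hgi α).comp hX
  refine (memLp_two_iff_integrable_sq hm.aestronglyMeasurable).2 ?_
  refine (hG.integral_prod_left.const_mul (mfact α : ℝ)).mono' (hm.pow_const 2).aestronglyMeasurable
    ?_
  filter_upwards [ae_memLp_slice hg hG, hG.prod_right_ae] with ω hω hω2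
  rw [Real.norm_eq_abs, abs_of_nonneg (sq_nonneg _)]
  refine (sq_hermiteCoeff_le c σ (f := fun y => g y i) (hω i) α).trans
    (mul_le_mul_of_nonneg_left ?_ (mfact_pos α).le)
  refine integral_mono (hω i).integrable_sq hω2 fun z => ?_
  simp only [EuclideanSpace.norm_sq_eq, Real.norm_eq_abs, sq_abs]
  exact Finset.single_le_sum (f := fun i => g (c • X ω + σ • z) i ^ 2) (fun _ _ => sq_nonneg _)
    (Finset.mem_univ i)

theorem memLp_scoreFam (hX2 : ∀ i, MemLp (fun ω => X ω i) 2 P)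
    (hD2 : ∀ β, MemLp (fun ω => monoE β (D ω)) 2 P) (s q : ℝ) (β : Fin d → ℕ) :
    MemLp (fun ω => scoreFam s q (X ω) (D ω) β) 2 P := by
  have h1 : MemLp (fun ω => ∑ j, if β = Pi.single j 1 then X ω j else 0) 2 P := by
    refine memLp_finsetSum (f := fun j ω => if β = Pi.single j 1 then X ω j else 0) _
      fun j _ => ?_
    by_cases h : β = Pi.single j 1
    · simpa [h] using hX2 j
    · simp [h]
  have h2 : MemLp (fun _ : Ω => ∑ j, if β = Pi.single j 2 then 2 / q else 0) 2 P := memLp_const _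
  have h3 : MemLp (fun ω => monoE β (D ω) / (s * q ^ (mdeg β - 1))) 2 P := by
    simpa only [div_eq_inv_mul] using (hD2 β).const_mul (s * q ^ (mdeg β - 1))⁻¹
  exact (h1.sub h2).add h3

theorem integral_inner_eq (hX : Measurable X) (hX2 : ∀ i, MemLp (fun ω => X ω i) 2 P)
    (hg : Measurable g)
    (hG : Integrable (fun p : Ω × Euc d => ‖g (c • X p.1 + σ • p.2)‖ ^ 2)
      (P.prod (_root_.stdGaussian d))) (q : ℝ) :
    ∫ p, inner ℝ (X p.1 - q⁻¹ • p.2) (g (c • X p.1 + σ • p.2)) ∂(P.prod (_root_.stdGaussian d)) =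
      ∑ i, ((∫ ω, X ω i * hermiteCoeff c σ (fun y => g y i) 0 (X ω) ∂P) -
        q⁻¹ * ∫ ω, hermiteCoeff c σ (fun y => g y i) (Pi.single i 1) (X ω) ∂P) := by
  have hgm : ∀ i, MemLp (fun p : Ω × Euc d => g (c • X p.1 + σ • p.2) i) 2
      (P.prod (_root_.stdGaussian d)) := by
    intro i
    have hm : Measurable fun p : Ω × Euc d => g (c • X p.1 + σ • p.2) i := by fun_prop
    rw [memLp_two_iff_integrable_sq hm.aestronglyMeasurable]
    refine hG.mono' (hm.pow_const 2).aestronglyMeasurable (Filter.Eventually.of_forall fun p => ?_)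
    rw [Real.norm_eq_abs, abs_of_nonneg (sq_nonneg _), EuclideanSpace.norm_sq_eq]
    simp only [Real.norm_eq_abs, sq_abs]
    exact Finset.single_le_sum (f := fun i => g (c • X p.1 + σ • p.2) i ^ 2)
      (fun _ _ => sq_nonneg _) (Finset.mem_univ i)
  have h1 : ∀ i, Integrable (fun p : Ω × Euc d => X p.1 i * g (c • X p.1 + σ • p.2) i)
      (P.prod (_root_.stdGaussian d)) := fun i =>
    ((hX2 i).comp_fst (_root_.stdGaussian d)).integrable_mul (hgm i)
  have h2 : ∀ i, Integrable (fun p : Ω × Euc d => g (c • X p.1 + σ • p.2) i *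
      hermiteM (Pi.single i 1) p.2) (P.prod (_root_.stdGaussian d)) := fun i =>
    (hgm i).integrable_mul ((memLp_hermiteM (Pi.single i 1)).comp_snd P)
  have e : ∀ p : Ω × Euc d, inner ℝ (X p.1 - q⁻¹ • p.2) (g (c • X p.1 + σ • p.2)) =
      ∑ i, (X p.1 i * g (c • X p.1 + σ • p.2) i - q⁻¹ * (g (c • X p.1 + σ • p.2) i *
        hermiteM (Pi.single i 1) p.2)) := by
    intro p
    rw [PiLp.inner_apply]
    refine Finset.sum_congr rfl fun i _ => ?_
    simp [hermiteM_single]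
    ring
  simp only [e]
  rw [integral_finsetSum _ fun i _ => by exact (h1 i).sub ((h2 i).const_mul _)]
  refine Finset.sum_congr rfl fun i _ => ?_
  rw [integral_sub (h1 i) ((h2 i).const_mul _), integral_const_mul, integral_prod _ (h1 i),
    integral_prod _ (h2 i)]
  simp only [hermiteCoeff, hermiteM_zero, mul_one, integral_const_mul]

end

theorem sum_hermiteWeight_single {d : ℕ} {n : ℕ} {t : Finset (Fin d → ℕ)}
    (ht : ∀ j, Pi.single j n ∈ t) (f : Fin d → Fin d → (Fin d → ℕ) → ℝ) :
    ∑ β ∈ t, ∑ i, hermiteWeight i β * ∑ j, (if β = Pi.single j n then f i j β else 0) =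
      ∑ j, hermiteWeight j (Pi.single j n) * f j j (Pi.single j n) := by
  have e : ∑ β ∈ t, ∑ i, hermiteWeight i β * ∑ j, (if β = Pi.single j n then f i j β else 0) =
      ∑ j, ∑ i, ∑ β ∈ t, (if β = Pi.single j n then hermiteWeight i β * f i j β else 0) := by
    rw [Finset.sum_comm' (t' := Finset.univ) (s' := fun _ => t) (by simp), Finset.sum_comm]
    simp only [Finset.mul_sum, mul_ite, mul_zero]
    rw [Finset.sum_congr rfl fun β _ => Finset.sum_comm, Finset.sum_comm]
    exact Finset.sum_congr rfl fun j _ => Finset.sum_comm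
  rw [e]
  refine Finset.sum_congr rfl fun j _ => ?_
  rw [Finset.sum_eq_single j]
  · simp [ht j]
  · intro i _ hi
    simp only [Finset.sum_ite_eq', ht j, if_true]
    rw [hermiteWeight_eq_zero (by simp [hi]), zero_mul]
  · simp

theorem hermiteWeight_single_one {d : ℕ} (j : Fin d) :
    hermiteWeight j (Pi.single j 1) = 1 := by
  have h : mfact (Pi.single j 1 : Fin d → ℕ) = 1 := by
    unfold mfact
    refine Finset.prod_eq_one fun i _ => ?_
    by_cases h : i = j
    · subst h; simp
    · simp [h]
  simp [hermiteWeight, h, mdeg]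

theorem hermiteWeight_single_two {d : ℕ} (j : Fin d) :
    hermiteWeight j (Pi.single j 2) = 1 / 2 := by
  have h : mfact (Pi.single j 2 : Fin d → ℕ) = 2 := by
    unfold mfact
    rw [Finset.prod_eq_single j]
    · simp
    · intro i _ h
      simp [h]
    · simp
  simp [hermiteWeight, h, mdeg]

section
variable {d : ℕ} {Ω : Type*} [MeasurableSpace Ω] {P : Measure Ω} [IsProbabilityMeasure P]
  {X D : Ω → Euc d} {c σ : ℝ} {g : Euc d → Euc d}

theorem integral_scoreFam_mul {G : Ω → ℝ} (hX2 : ∀ i, MemLp (fun ω => X ω i) 2 P)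
    (hD2 : ∀ β, MemLp (fun ω => monoE β (D ω)) 2 P) (hG : MemLp G 2 P) (s q : ℝ)
    (β : Fin d → ℕ) :
    ∫ ω, scoreFam s q (X ω) (D ω) β * G ω ∂P =
      (∑ j, if β = Pi.single j 1 then ∫ ω, X ω j * G ω ∂P else 0) -
        (∑ j, if β = Pi.single j 2 then 2 / q * ∫ ω, G ω ∂P else 0) +
        ∫ ω, monoE β (D ω) / (s * q ^ (mdeg β - 1)) * G ω ∂P := by
  have hG1 : Integrable G P := hG.integrable (by norm_num)
  have h1 : ∀ j, Integrable (fun ω => if β = Pi.single j 1 then X ω j * G ω else 0) P := by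
    intro j
    by_cases h : β = Pi.single j 1
    · simp only [h, if_true]
      exact (hX2 j).integrable_mul hG
    · simp [h]
  have h1' := integrable_finsetSum Finset.univ fun j _ => h1 j
  have h2 : Integrable (fun ω => (∑ j, if β = Pi.single j 2 then 2 / q else 0) * G ω) P :=
    hG1.const_mul _
  have h3 : Integrable (fun ω => monoE β (D ω) / (s * q ^ (mdeg β - 1)) * G ω) P := by
    have := ((hD2 β).integrable_mul hG).const_mul (s * q ^ (mdeg β - 1))⁻¹
    refine this.congr (Filter.Eventually.of_forall fun ω => ?_)
    simp only [Pi.mul_apply]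
    ring
  have e : ∀ ω, scoreFam s q (X ω) (D ω) β * G ω =
      (∑ j, if β = Pi.single j 1 then X ω j * G ω else 0) -
        (∑ j, if β = Pi.single j 2 then 2 / q else 0) * G ω +
        monoE β (D ω) / (s * q ^ (mdeg β - 1)) * G ω := by
    intro ω
    simp only [scoreFam, add_mul, sub_mul]
    congr 2
    rw [Finset.sum_mul]
    exact Finset.sum_congr rfl fun j _ => by split_ifs <;> simp
  simp only [e]
  rw [integral_add (by exact h1'.sub h2) h3, integral_sub h1' h2, integral_finsetSum _ fun j _ => h1 j,
    integral_const_mul]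
  congr 2
  · exact Finset.sum_congr rfl fun j _ => by split_ifs <;> simp
  · rw [Finset.sum_mul]
    exact Finset.sum_congr rfl fun j _ => by split_ifs <;> simp

theorem sum_hermiteWeight_mul_integral {q s : ℝ} (hq : 0 < q) (hc : 0 < c)
    (hσ : σ = q * c) (hs : 0 < s) {φ : Euc d → ℝ} (hφ : Measurable φ) {B : ℝ}
    (hB : ∀ y, |φ y| ≤ B) (hX : Measurable X)
    (hd : ∀ i y, HasLineDerivAt ℝ φ (c * g y i) y (EuclideanSpace.single i 1))
    (hD2 : ∀ β, MemLp (fun ω => monoE β (D ω)) 2 P) (hg : Measurable g)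
    (hG : Integrable (fun p : Ω × Euc d => ‖g (c • X p.1 + σ • p.2)‖ ^ 2)
      (P.prod (_root_.stdGaussian d))) (β : Fin d → ℕ) :
    ∑ i, hermiteWeight i β * ∫ ω, monoE β (D ω) / (s * q ^ (mdeg β - 1)) *
        hermiteCoeff c σ (fun y => g y i) (β - Pi.single i 1) (X ω) ∂P =
      q / (s * (σ * c)) * (if β = 0 then 0 else
        ∫ ω, monoE β (q⁻¹ • D ω) / mfact β * hermiteCoeff c σ φ β (X ω) ∂P) := by
  by_cases h0 : β = 0
  · subst h0
    simp [hermiteWeight]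
  rw [if_neg h0]
  simp only [← integral_const_mul]
  have hσ0 : 0 < σ := hσ ▸ mul_pos hq hc
  rw [← integral_finsetSum]
  · refine integral_congr_ae ?_
    filter_upwards [ae_memLp_slice hg hG] with ω hω
    have e : ∀ i, hermiteWeight i β * (monoE β (D ω) / (s * q ^ (mdeg β - 1)) *
        hermiteCoeff c σ (fun y => g y i) (β - Pi.single i 1) (X ω)) =
        hermiteWeight i β * (monoE β (D ω) / (s * q ^ (mdeg β - 1)) *
          hermiteCoeff c σ φ β (X ω) / (σ * c)) := by
      intro i
      by_cases hi : β i = 0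
      · simp [hermiteWeight_eq_zero hi]
      · have := hermiteCoeff_add_single hφ hB (f := fun y => g y i) i (hd i) (hω i)
          (β - Pi.single i 1)
        rw [sub_single_add_single hi] at this
        rw [this]
        field_simp
    simp only [e]
    rw [← Finset.sum_mul, sum_hermiteWeight h0, monoE_smul]
    obtain ⟨n, hn⟩ := Nat.exists_eq_succ_of_ne_zero (mdeg_ne_zero h0)
    rw [hn]
    have := (mfact_pos β).ne'
    simp only [Nat.succ_eq_add_one, Nat.add_sub_cancel, inv_pow]
    field_simp
    ring
  · intro i _
    refine Integrable.const_mul ?_ _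
    have := ((hD2 β).integrable_mul (memLp_hermiteCoeff_comp hX hg hG i
      (β - Pi.single i 1))).const_mul (s * q ^ (mdeg β - 1))⁻¹
    refine this.congr (Filter.Eventually.of_forall fun ω => ?_)
    simp only [Pi.mul_apply]
    ring

theorem integral_inner_le (hX : Measurable X) (hD : Measurable D)
    (hlaw : P.map (fun ω => X ω + D ω) = P.map X) (hX2 : ∀ i, MemLp (fun ω => X ω i) 2 P)
    {q s r : ℝ} (hq : 0 < q) (hc : 0 < c) (hσ : σ = q * c) (hs : 0 < s) (hr : 0 < r)
    (hr1 : r < 1) (hint : Integrable (fun ω => Real.exp (‖D ω‖ ^ 2 / (q ^ 2 * r))) P)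
    {φ : Euc d → ℝ} (hφ : Measurable φ) {B : ℝ} (hB : ∀ y, |φ y| ≤ B)
    (hd : ∀ i y, HasLineDerivAt ℝ φ (c * g y i) y (EuclideanSpace.single i 1))
    (hg : Measurable g)
    (hG : Integrable (fun p : Ω × Euc d => ‖g (c • X p.1 + σ • p.2)‖ ^ 2)
      (P.prod (_root_.stdGaussian d))) {S : ℝ}
    (hS : ∀ t : Finset (Fin d → ℕ), ∑ β ∈ t,
      (∫ ω, (P[fun ω' => scoreFam s q (X ω') (D ω') β |
        MeasurableSpace.comap X inferInstance]) ω ^ 2 ∂P) / (mdeg β * mfact β) ≤ S) :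
    ∫ p, inner ℝ (X p.1 - q⁻¹ • p.2) (g (c • X p.1 + σ • p.2)) ∂(P.prod (_root_.stdGaussian d)) ≤
      1 / 2 * ∫ p, ‖g (c • X p.1 + σ • p.2)‖ ^ 2 ∂(P.prod (_root_.stdGaussian d)) +
        1 / 2 * S := by
  have hm : MeasurableSpace.comap X inferInstance ≤ ‹MeasurableSpace Ω› := hX.comap_le
  have hD2 : ∀ β, MemLp (fun ω => monoE β (D ω)) 2 P :=
    memLp_monoE hD (by positivity) hint
  have hΓ2 := fun i α => memLp_hermiteCoeff_comp hX hg hG i α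
  have hA := fun β => memLp_scoreFam hX2 hD2 s q β
  have hC := fun β => (hA β).condExp (m := MeasurableSpace.comap X inferInstance)
    (by norm_num)
  have hint' : Integrable (fun ω => Real.exp (‖q⁻¹ • D ω‖ ^ 2 / r)) P := by
    refine hint.congr (Filter.Eventually.of_forall fun ω => ?_)
    simp only [norm_smul, norm_inv, Real.norm_eq_abs, abs_of_pos hq]
    congr 1
    field_simp
  have H := hasSum_integral_hermiteCoeff hX (hX.add hD) (hD.const_smul q⁻¹) hlaw c σ
    (fun ω => by
      simp only [Pi.add_apply, Pi.smul_apply, smul_add, smul_smul, hσ]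
      congr 2
      field_simp) hr hr1 hint' hφ hB
  have H0 := hasSum_ite_sub_hasSum H 0
  have hF0 : ∫ ω, monoE 0 ((q⁻¹ • D) ω) / mfact (0 : Fin d → ℕ) *
      hermiteCoeff c σ φ 0 (X ω) ∂P = ∫ ω, hermiteCoeff c σ φ 0 (X ω) ∂P := by
    simp [monoE, mfact]
  rw [hF0, sub_self] at H0
  have hlim := (H0.mul_left (q / (s * (σ * c)))).const_add
    (∫ p, inner ℝ (X p.1 - q⁻¹ • p.2) (g (c • X p.1 + σ • p.2)) ∂(P.prod (_root_.stdGaussian d)))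
  rw [mul_zero, add_zero] at hlim
  refine le_of_tendsto hlim ?_
  set t0 : Finset (Fin d → ℕ) := Finset.univ.image (fun j => Pi.single j 1) ∪
    Finset.univ.image (fun j => Pi.single j 2) with ht0
  filter_upwards [Filter.eventually_ge_atTop t0] with t ht
  have ht1 : ∀ j, Pi.single j 1 ∈ t := fun j => ht (by simp [ht0])
  have ht2 : ∀ j, Pi.single j 2 ∈ t := fun j => ht (by simp [ht0])
  have key : (∫ p, inner ℝ (X p.1 - q⁻¹ • p.2) (g (c • X p.1 + σ • p.2))
        ∂(P.prod (_root_.stdGaussian d))) +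
      ∑ β ∈ t, q / (s * (σ * c)) * (if β = 0 then 0 else
        ∫ ω, monoE β (q⁻¹ • D ω) / mfact β * hermiteCoeff c σ φ β (X ω) ∂P) =
      ∑ β ∈ t, ∑ i, hermiteWeight i β * ∫ ω, scoreFam s q (X ω) (D ω) β *
        hermiteCoeff c σ (fun y => g y i) (β - Pi.single i 1) (X ω) ∂P := by
    rw [Finset.sum_congr rfl fun β _ => Finset.sum_congr rfl fun i _ => by
      rw [integral_scoreFam_mul hX2 hD2 (hΓ2 i _)]]
    simp only [mul_add, mul_sub, Finset.sum_add_distrib, Finset.sum_sub_distrib]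
    rw [sum_hermiteWeight_single ht1, sum_hermiteWeight_single ht2, integral_inner_eq hX hX2 hg hG]
    simp only [hermiteWeight_single_one, hermiteWeight_single_two]
    congr 1
    · rw [← Finset.sum_sub_distrib]
      refine Finset.sum_congr rfl fun i _ => ?_
      have e1 : (Pi.single i 1 - Pi.single i 1 : Fin d → ℕ) = 0 := by simp
      have e2 : (Pi.single i 2 - Pi.single i 1 : Fin d → ℕ) = Pi.single i 1 := by
        ext j
        by_cases hj : j = i
        · subst hj; simp
        · simp [hj]
      rw [e1, e2]
      ring
    · exact Finset.sum_congr rfl fun β _ =>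
        (sum_hermiteWeight_mul_integral hq hc hσ hs hφ hB hX hd hD2 hg hG β).symm
  have hi : ∀ β i, Integrable (fun ω => hermiteWeight i β *
      (P[fun ω' => scoreFam s q (X ω') (D ω') β |
        MeasurableSpace.comap X inferInstance]) ω *
      hermiteCoeff c σ (fun y => g y i) (β - Pi.single i 1) (X ω)) P := by
    intro β i
    simp only [mul_assoc]
    exact ((hC β).integrable_mul (hΓ2 i _)).const_mul _
  have key2 : ∑ β ∈ t, ∑ i, hermiteWeight i β * ∫ ω, scoreFam s q (X ω) (D ω) β *
        hermiteCoeff c σ (fun y => g y i) (β - Pi.single i 1) (X ω) ∂P =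
      ∫ ω, ∑ β ∈ t, ∑ i, hermiteWeight i β * (P[fun ω' => scoreFam s q (X ω') (D ω') β |
        MeasurableSpace.comap X inferInstance]) ω *
        hermiteCoeff c σ (fun y => g y i) (β - Pi.single i 1) (X ω) ∂P := by
    rw [integral_finsetSum _ fun β _ => integrable_finsetSum _ fun i _ => hi β i]
    refine Finset.sum_congr rfl fun β _ => ?_
    rw [integral_finsetSum _ fun i _ => hi β i]
    refine Finset.sum_congr rfl fun i _ => ?_
    simp only [mul_assoc, integral_const_mul]
    congr 1
    refine integral_condExp_mul hm (hA β) (hΓ2 i _) ?_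
    have hgi : Measurable fun y => g y i := by fun_prop
    exact (measurable_hermiteCoeff c σ hgi _).stronglyMeasurable.comp_measurable
      (comap_measurable X)
  refine (key.trans key2).le.trans ?_
  have hCi := fun β => ((hC β).integrable_sq).div_const ((mdeg β : ℝ) * mfact β)
  have hCs := integrable_finsetSum t fun β _ => hCi β
  have hGl := hG.integral_prod_left
  have hle : ∀ᵐ ω ∂P, ∑ β ∈ t, ∑ i, hermiteWeight i β *
      (P[fun ω' => scoreFam s q (X ω') (D ω') β | MeasurableSpace.comap X inferInstance]) ω *
        hermiteCoeff c σ (fun y => g y i) (β - Pi.single i 1) (X ω) ≤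
      1 / 2 * (∫ z, ‖g (c • X ω + σ • z)‖ ^ 2 ∂(_root_.stdGaussian d)) +
        1 / 2 * ∑ β ∈ t, (P[fun ω' => scoreFam s q (X ω') (D ω') β |
          MeasurableSpace.comap X inferInstance]) ω ^ 2 / (mdeg β * mfact β) := by
    filter_upwards [ae_memLp_slice hg hG] with ω hω
    exact sum_hermiteWeight_mul_hermiteCoeff_le c σ hω t _
  refine (integral_mono_ae (integrable_finsetSum _ fun β _ => integrable_finsetSum _
    fun i _ => hi β i) ((hGl.const_mul _).add (hCs.const_mul _)) hle).trans ?_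
  simp only [Pi.add_apply]
  rw [integral_add (hGl.const_mul _) (hCs.const_mul _), integral_const_mul, integral_const_mul,
    integral_finsetSum _ fun β _ => hCi β, integral_prod _ hG]
  simp only [integral_div]
  have := hS t
  linarith

end

/-- The transition kernel `x ↦ c x + σ Z`, up to a normalizing constant. -/
def noiseKer {d : ℕ} (c σ : ℝ) (x y : Euc d) : ℝ := gaussDensity d (σ⁻¹ • (y - c • x))

theorem noiseKer_pos {d : ℕ} (c σ : ℝ) (x y : Euc d) : 0 < noiseKer c σ x y := gaussDensity_pos _

theorem lintegral_add_smul_stdGaussian {d : ℕ} {σ : ℝ} (hσ : 0 < σ) {h : Euc d → ℝ≥0∞}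
    (hh : Measurable h) (a : Euc d) :
    ∫⁻ z, h (a + σ • z) ∂(_root_.stdGaussian d) = ENNReal.ofReal (σ ^ d)⁻¹ *
      ∫⁻ y, ENNReal.ofReal (gaussDensity d (σ⁻¹ • (y - a))) * h y := by
  have h1 : ∫⁻ z, h (a + σ • z) ∂(_root_.stdGaussian d) =
      ∫⁻ z, ENNReal.ofReal (gaussDensity d z) * h (a + σ • z) := by
    rw [_root_.stdGaussian, lintegral_withDensity_eq_lintegral_mul _ (by fun_prop) (by fun_prop)]
    rfl
  have h2 := Measure.map_addHaar_smul (volume : Measure (Euc d)) hσ.ne'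
  have h3 : ∫⁻ y, ENNReal.ofReal (gaussDensity d (σ⁻¹ • (y - a))) * h y =
      ∫⁻ y, ENNReal.ofReal (gaussDensity d (σ⁻¹ • y)) * h (a + y) := by
    rw [← lintegral_add_left_eq_self _ a]
    simp
  have h4 : Measurable fun y : Euc d => ENNReal.ofReal (gaussDensity d (σ⁻¹ • y)) * h (a + y) := by
    fun_prop
  rw [h1, h3]
  have h5 := lintegral_map (μ := volume) h4 (measurable_const_smul σ)
  rw [h2, lintegral_smul_measure] at h5
  simp only [smul_smul, inv_mul_cancel₀ hσ.ne', one_smul, finrank_euclideanSpace, Fintype.card_fin,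
    smul_eq_mul] at h5
  rw [← h5, abs_of_pos (by positivity)]

section
variable {d : ℕ} {Ω : Type*} [MeasurableSpace Ω] {P : Measure Ω}
  {X : Ω → Euc d} {c σ : ℝ}

theorem measurable_noiseKer_comp (hX : Measurable X) :
    Measurable fun p : Ω × Euc d => noiseKer c σ (X p.1) p.2 := by
  have := (continuous_gaussDensity d).measurable
  unfold noiseKer
  fun_prop

theorem map_noise (hX : Measurable X) (c : ℝ) (hσ : 0 < σ) :
    (P.prod (_root_.stdGaussian d)).map (fun p => (p.1, c • X p.1 + σ • p.2)) =
      ENNReal.ofReal (σ ^ d)⁻¹ • (P.prod (volume : Measure (Euc d))).withDensity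
        fun p => ENNReal.ofReal (noiseKer c σ (X p.1) p.2) := by
  have hK : Measurable fun p : Ω × Euc d => ENNReal.ofReal (noiseKer c σ (X p.1) p.2) :=
    (measurable_noiseKer_comp hX).ennreal_ofReal
  refine Measure.ext_of_lintegral _ fun f hf => ?_
  have hKf : Measurable fun p : Ω × Euc d => ENNReal.ofReal (noiseKer c σ (X p.1) p.2) * f p :=
    hK.mul hf
  have h1 := lintegral_withDensity_eq_lintegral_mul (P.prod (volume : Measure (Euc d))) hK hf
  rw [lintegral_map hf (by fun_prop), lintegral_smul_measure, h1, lintegral_prod _ (by fun_prop),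
    smul_eq_mul]
  change _ = _ * ∫⁻ p, ENNReal.ofReal (noiseKer c σ (X p.1) p.2) * f p ∂_
  rw [lintegral_prod _ hKf.aemeasurable, ← lintegral_const_mul _ hKf.lintegral_prod_right']
  refine lintegral_congr fun ω => ?_
  have := lintegral_add_smul_stdGaussian hσ (h := fun y => f (ω, y)) (by fun_prop) (c • X ω)
  exact this

theorem integrable_noise_iff (hX : Measurable X) (c : ℝ) (hσ : 0 < σ) {f : Ω × Euc d → ℝ}
    (hf : Measurable f) :
    Integrable (fun p => f (p.1, c • X p.1 + σ • p.2)) (P.prod (_root_.stdGaussian d)) ↔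
      Integrable (fun p => noiseKer c σ (X p.1) p.2 * f p) (P.prod volume) := by
  have hK : Measurable fun p : Ω × Euc d => noiseKer c σ (X p.1) p.2 :=
    measurable_noiseKer_comp hX
  have h1 := integrable_map_measure (μ := P.prod (_root_.stdGaussian d))
    (f := fun p => (p.1, c • X p.1 + σ • p.2)) (g := f) hf.aestronglyMeasurable
    (by fun_prop)
  rw [map_noise hX c hσ, integrable_smul_measure (by simp; positivity) (by simp),
    integrable_withDensity_iff_integrable_smul' hK.ennreal_ofReal
      (Filter.Eventually.of_forall fun _ => ENNReal.ofReal_lt_top)] at h1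
  simp only [ENNReal.toReal_ofReal (noiseKer_pos _ _ _ _).le, smul_eq_mul] at h1
  exact h1.symm

theorem integral_noise (hX : Measurable X) (c : ℝ) (hσ : 0 < σ) {f : Ω × Euc d → ℝ}
    (hf : Measurable f) :
    ∫ p, f (p.1, c • X p.1 + σ • p.2) ∂(P.prod (_root_.stdGaussian d)) =
      (σ ^ d)⁻¹ * ∫ p, noiseKer c σ (X p.1) p.2 * f p ∂(P.prod volume) := by
  have hK : Measurable fun p : Ω × Euc d => noiseKer c σ (X p.1) p.2 :=
    measurable_noiseKer_comp hX
  rw [← integral_map (φ := fun p : Ω × Euc d => (p.1, c • X p.1 + σ • p.2)) (f := f) (by fun_prop)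
    hf.aestronglyMeasurable, map_noise hX c hσ, integral_smul_measure,
    integral_withDensity_eq_integral_toReal_smul hK.ennreal_ofReal
      (Filter.Eventually.of_forall fun _ => ENNReal.ofReal_lt_top)]
  simp only [ENNReal.toReal_ofReal (noiseKer_pos _ _ _ _).le, smul_eq_mul]
  rw [ENNReal.toReal_ofReal (by positivity)]

end

theorem gaussDensity_le {d : ℕ} (z : Euc d) : gaussDensity d z ≤ (2 * Real.pi) ^ (-(d : ℝ) / 2) := by
  unfold gaussDensity
  refine mul_le_of_le_one_right (by positivity) (Real.exp_le_one_iff.2 ?_)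
  have := sq_nonneg ‖z‖
  linarith

theorem abs_coord_mul_gaussDensity_le {d : ℕ} (z : Euc d) (i : Fin d) :
    |z i * gaussDensity d z| ≤ (2 * Real.pi) ^ (-(d : ℝ) / 2) := by
  have h1 : |z i| ≤ ‖z‖ := by simpa using PiLp.norm_apply_le z i
  have h2 : ‖z‖ * Real.exp (-‖z‖ ^ 2 / 2) ≤ 1 := by
    have h3 := Real.add_one_le_exp (‖z‖ ^ 2 / 2)
    have h4 : ‖z‖ ≤ Real.exp (‖z‖ ^ 2 / 2) := by nlinarith [sq_nonneg (‖z‖ - 1)]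
    rw [neg_div, Real.exp_neg]
    exact mul_inv_le_one_of_le₀ h4 (by positivity)
  rw [abs_mul, abs_of_pos (gaussDensity_pos z)]
  unfold gaussDensity
  have h5 : 0 < (2 * Real.pi) ^ (-(d : ℝ) / 2) := by positivity
  calc |z i| * ((2 * Real.pi) ^ (-(d : ℝ) / 2) * Real.exp (-‖z‖ ^ 2 / 2))
      ≤ ‖z‖ * ((2 * Real.pi) ^ (-(d : ℝ) / 2) * Real.exp (-‖z‖ ^ 2 / 2)) := by gcongr
    _ = (2 * Real.pi) ^ (-(d : ℝ) / 2) * (‖z‖ * Real.exp (-‖z‖ ^ 2 / 2)) := by ring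
    _ ≤ _ := mul_le_of_le_one_right h5.le h2

theorem hasDerivAt_noiseKer {d : ℕ} (c σ : ℝ) (x y : Euc d) (i : Fin d) (t : ℝ) :
    HasDerivAt (fun t => noiseKer c σ x (y + t • EuclideanSpace.single i (1 : ℝ)))
      (-σ⁻¹ * ((σ⁻¹ • (y + t • EuclideanSpace.single i (1 : ℝ) - c • x) : Euc d) i *
        noiseKer c σ x (y + t • EuclideanSpace.single i (1 : ℝ)))) t := by
  have h1 : HasDerivAt (fun t : ℝ => σ⁻¹ • (y + t • EuclideanSpace.single i (1 : ℝ) - c • x))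
      (σ⁻¹ • EuclideanSpace.single i (1 : ℝ)) t := by
    have := ((((hasDerivAt_id t).smul_const (EuclideanSpace.single i (1 : ℝ))).const_add y).sub_const
      (c • x)).const_smul σ⁻¹
    rw [one_smul] at this
    exact this
  have h2 := ((h1.norm_sq.neg.div_const 2).exp).const_mul ((2 * Real.pi) ^ (-(d : ℝ) / 2))
  refine h2.congr_deriv ?_
  simp only [noiseKer, gaussDensity, real_inner_smul_right, EuclideanSpace.inner_single_right]
  simp
  ring

section
variable {d : ℕ} {Ω : Type*} [MeasurableSpace Ω]

/-- The density, up to a constant, of `c X + σ Z`. -/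
def noiseDens (P : Measure Ω) (X : Ω → Euc d) (c σ : ℝ) (y : Euc d) : ℝ :=
  ∫ ω, noiseKer c σ (X ω) y ∂P

/-- The conditional mean of `X - (c / σ) Z` given `c X + σ Z = y`, when `c ^ 2 + σ ^ 2 = 1`. -/
def noiseScore (P : Measure Ω) (X : Ω → Euc d) (c σ : ℝ) (y : Euc d) : Euc d :=
  WithLp.toLp 2 fun i =>
    (∫ ω, noiseKer c σ (X ω) y * ((σ ^ 2)⁻¹ * (X ω i - c * y i)) ∂P) / noiseDens P X c σ y

variable {P : Measure Ω} [IsProbabilityMeasure P] {X : Ω → Euc d} {c σ : ℝ}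

theorem measurable_noiseKer_left (hX : Measurable X) (y : Euc d) :
    Measurable fun ω => noiseKer c σ (X ω) y := by
  have := (continuous_gaussDensity d).measurable
  unfold noiseKer
  fun_prop

theorem integrable_noiseKer (hX : Measurable X) (y : Euc d) :
    Integrable (fun ω => noiseKer c σ (X ω) y) P := by
  refine Integrable.of_bound (measurable_noiseKer_left hX y).aestronglyMeasurable
    ((2 * Real.pi) ^ (-(d : ℝ) / 2)) (Filter.Eventually.of_forall fun ω => ?_)
  rw [Real.norm_eq_abs, abs_of_pos (noiseKer_pos _ _ _ _)]
  exact gaussDensity_le _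

theorem noiseDens_pos (hX : Measurable X) (y : Euc d) : 0 < noiseDens P X c σ y := by
  unfold noiseDens
  rw [integral_pos_iff_support_of_nonneg (fun ω => (noiseKer_pos _ _ _ _).le)
    (integrable_noiseKer hX y)]
  have : Function.support (fun ω => noiseKer c σ (X ω) y) = Set.univ :=
    Set.eq_univ_of_forall fun ω => (noiseKer_pos _ _ _ _).ne'
  simp [this]

theorem measurable_noiseDens (hX : Measurable X) : Measurable (noiseDens P X c σ) := by
  have := (measurable_noiseKer_comp (c := c) (σ := σ) hX).stronglyMeasurable
  exact (this.integral_prod_left' (μ := P)).measurable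

theorem measurable_noiseScore_apply (hX : Measurable X) (i : Fin d) :
    Measurable fun y => noiseScore P X c σ y i := by
  have h1 : Measurable fun p : Ω × Euc d =>
      noiseKer c σ (X p.1) p.2 * ((σ ^ 2)⁻¹ * (X p.1 i - c * p.2 i)) :=
    (measurable_noiseKer_comp hX).mul (by fun_prop)
  exact ((h1.stronglyMeasurable.integral_prod_left' (μ := P)).measurable).div
    (measurable_noiseDens hX)

theorem measurable_noiseScore (hX : Measurable X) : Measurable (noiseScore P X c σ) := by
  have : Measurable fun y => WithLp.ofLp (noiseScore P X c σ y) :=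
    measurable_pi_iff.2 fun i => measurable_noiseScore_apply hX i
  exact (WithLp.measurable_toLp 2 _).comp this

theorem hasDerivAt_noiseDens (hX : Measurable X) (y : Euc d) (i : Fin d) :
    HasDerivAt (fun t : ℝ => noiseDens P X c σ (y + t • EuclideanSpace.single i (1 : ℝ)))
      (∫ ω, -σ⁻¹ * ((σ⁻¹ • (y - c • X ω)) i * noiseKer c σ (X ω) y) ∂P) 0 := by
  have h := hasDerivAt_integral_of_dominated_loc_of_deriv_le (μ := P) (x₀ := (0 : ℝ))
    (s := Set.univ)
    (F := fun t ω => noiseKer c σ (X ω) (y + t • EuclideanSpace.single i (1 : ℝ)))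
    (F' := fun t ω => -σ⁻¹ * ((σ⁻¹ • (y + t • EuclideanSpace.single i (1 : ℝ) - c • X ω) : Euc d) i *
        noiseKer c σ (X ω) (y + t • EuclideanSpace.single i (1 : ℝ))))
    (bound := fun _ => |σ⁻¹| * (2 * Real.pi) ^ (-(d : ℝ) / 2)) Filter.univ_mem
    (Filter.Eventually.of_forall fun t => (measurable_noiseKer_left hX _).aestronglyMeasurable)
    (integrable_noiseKer hX _) ?_ (Filter.Eventually.of_forall fun ω t _ => ?_)
    (integrable_const _)
    (Filter.Eventually.of_forall fun ω t _ => hasDerivAt_noiseKer _ _ _ _ _ _)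
  · have h2 := h.2
    simp only [zero_smul, add_zero] at h2
    exact h2
  · have := measurable_noiseKer_left (c := c) (σ := σ) hX
      (y + (0 : ℝ) • EuclideanSpace.single i (1 : ℝ))
    refine Measurable.aestronglyMeasurable ?_
    fun_prop
  · rw [norm_mul, norm_neg, Real.norm_eq_abs]
    exact mul_le_mul_of_nonneg_left (abs_coord_mul_gaussDensity_le _ i) (abs_nonneg _)

theorem hasLineDerivAt_log_noiseDens (hX : Measurable X) (hσ : 0 < σ) (hcσ : c ^ 2 + σ ^ 2 = 1)
    (y : Euc d) (i : Fin d) :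
    HasLineDerivAt ℝ (fun y => ‖y‖ ^ 2 / 2 + Real.log (noiseDens P X c σ y))
      (c * noiseScore P X c σ y i) y (EuclideanSpace.single i (1 : ℝ)) := by
  have h1 := hasDerivAt_noiseDens (P := P) (c := c) (σ := σ) hX y i
  have hp := noiseDens_pos (P := P) (c := c) (σ := σ) hX y
  have h2 := h1.log (by simpa using hp.ne')
  have h3 : HasDerivAt (fun t : ℝ => y + t • EuclideanSpace.single i (1 : ℝ))
      (EuclideanSpace.single i (1 : ℝ)) 0 := by
    simpa using ((hasDerivAt_id (0 : ℝ)).smul_const (EuclideanSpace.single i (1 : ℝ))).const_add y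
  have h4 := (h3.norm_sq.div_const 2).add h2
  refine h4.congr_deriv ?_
  have hi := (hasDerivAt_noiseDens (P := P) (c := c) (σ := σ) hX y i)
  have hF : Integrable (fun ω => (σ⁻¹ • (y - c • X ω)) i * noiseKer c σ (X ω) y) P := by
    refine Integrable.of_bound ?_ ((2 * Real.pi) ^ (-(d : ℝ) / 2))
      (Filter.Eventually.of_forall fun ω => abs_coord_mul_gaussDensity_le _ i)
    have := measurable_noiseKer_left (c := c) (σ := σ) hX y
    refine Measurable.aestronglyMeasurable ?_
    fun_prop
  have hK := integrable_noiseKer (P := P) (c := c) (σ := σ) hX y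
  have h5 : c * ∫ ω, noiseKer c σ (X ω) y * ((σ ^ 2)⁻¹ * (X ω i - c * y i)) ∂P =
      (∫ ω, -σ⁻¹ * ((σ⁻¹ • (y - c • X ω)) i * noiseKer c σ (X ω) y) ∂P) +
        y i * noiseDens P X c σ y := by
    unfold noiseDens
    rw [← integral_const_mul, ← integral_const_mul (y i), ← integral_add (hF.const_mul _)
      (hK.const_mul _)]
    refine integral_congr_ae (Filter.Eventually.of_forall fun ω => ?_)
    simp only [PiLp.smul_apply, PiLp.sub_apply, smul_eq_mul]
    field_simp
    rw [show σ ^ 2 = 1 - c ^ 2 by linarith]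
    ring
  simp only [noiseScore, zero_smul, add_zero, EuclideanSpace.inner_single_right]
  rw [mul_div_assoc', h5, add_div, mul_div_cancel_right₀ _ hp.ne']
  simp
  ring

end

section
variable {d : ℕ} {Ω : Type*} [MeasurableSpace Ω] {P : Measure Ω} [IsProbabilityMeasure P]
  {X : Ω → Euc d} {c σ q : ℝ}

theorem noise_residual_eq (hc : 0 < c) (hq : 0 < q) (hσ : σ = q * c) (hcσ : c ^ 2 + σ ^ 2 = 1)
    (x z : Euc d) (i : Fin d) :
    (x - q⁻¹ • z) i = (σ ^ 2)⁻¹ * (x i - c * (c • x + σ • z) i) := by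
  have hσ0 : 0 < σ := hσ ▸ mul_pos hq hc
  have h1 : q⁻¹ = c / σ := by rw [hσ]; field_simp
  simp only [PiLp.sub_apply, PiLp.smul_apply, PiLp.add_apply, smul_eq_mul]
  rw [h1]
  field_simp
  linear_combination x i * hcσ

theorem memLp_noise_residual (hX2 : ∀ i, MemLp (fun ω => X ω i) 2 P)
    (q : ℝ) (i : Fin d) :
    MemLp (fun p : Ω × Euc d => (X p.1 - q⁻¹ • p.2) i) 2 (P.prod (_root_.stdGaussian d)) := by
  have h1 : MemLp (fun p : Ω × Euc d => X p.1 i) 2 (P.prod (_root_.stdGaussian d)) :=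
    (hX2 i).comp_measurePreserving measurePreserving_fst
  have h2 : MemLp (fun z : Euc d => z i) 2 (_root_.stdGaussian d) := by
    have := memLp_hermiteM (Pi.single i 1 : Fin d → ℕ)
    rwa [funext (hermiteM_single i)] at this
  have h3 : MemLp (fun p : Ω × Euc d => p.2 i) 2 (P.prod (_root_.stdGaussian d)) :=
    h2.comp_measurePreserving measurePreserving_snd
  exact h1.sub (h3.const_mul q⁻¹)

theorem integrable_noiseKer_mul_residual (hX : Measurable X)
    (hX2 : ∀ i, MemLp (fun ω => X ω i) 2 P) (hc : 0 < c) (hq : 0 < q) (hσ : σ = q * c)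
    (hcσ : c ^ 2 + σ ^ 2 = 1) (i : Fin d) :
    Integrable (fun p : Ω × Euc d => noiseKer c σ (X p.1) p.2 *
      ((σ ^ 2)⁻¹ * (X p.1 i - c * p.2 i))) (P.prod volume) := by
  have hσ0 : 0 < σ := hσ ▸ mul_pos hq hc
  rw [← integrable_noise_iff hX c hσ0 (f := fun p => (σ ^ 2)⁻¹ * (X p.1 i - c * p.2 i))
    (by fun_prop)]
  simp only [← noise_residual_eq hc hq hσ hcσ]
  exact (memLp_noise_residual hX2 q i).integrable (by norm_num)

theorem integrable_noiseKer_mul_noiseScore (hX : Measurable X)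
    (hX2 : ∀ i, MemLp (fun ω => X ω i) 2 P) (hc : 0 < c) (hq : 0 < q) (hσ : σ = q * c)
    (hcσ : c ^ 2 + σ ^ 2 = 1) (i : Fin d) :
    Integrable (fun p : Ω × Euc d => noiseKer c σ (X p.1) p.2 * noiseScore P X c σ p.2 i)
      (P.prod volume) := by
  have hm : Measurable fun p : Ω × Euc d =>
      noiseKer c σ (X p.1) p.2 * noiseScore P X c σ p.2 i :=
    (measurable_noiseKer_comp hX).mul ((measurable_noiseScore_apply hX i).comp measurable_snd)
  rw [integrable_prod_iff' hm.aestronglyMeasurable]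
  refine ⟨Filter.Eventually.of_forall fun y => by
    have := (integrable_noiseKer (P := P) (c := c) (σ := σ) hX y).mul_const
      (noiseScore P X c σ y i)
    exact this, ?_⟩
  have hI := (integrable_noiseKer_mul_residual hX hX2 hc hq hσ hcσ i).integral_norm_prod_right
  refine hI.mono' (hm.norm.stronglyMeasurable.integral_prod_left').aestronglyMeasurable
    (Filter.Eventually.of_forall fun y => ?_)
  have hp := noiseDens_pos (P := P) (c := c) (σ := σ) hX y
  have h1 : ∫ ω, ‖noiseKer c σ (X ω) y * noiseScore P X c σ y i‖ ∂P =
      ‖∫ ω, noiseKer c σ (X ω) y * ((σ ^ 2)⁻¹ * (X ω i - c * y i)) ∂P‖ := by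
    simp only [norm_mul, Real.norm_eq_abs, abs_of_pos (noiseKer_pos _ _ _ _)]
    rw [integral_mul_const]
    change noiseDens P X c σ y * |_ / noiseDens P X c σ y| = _
    rw [abs_div, abs_of_pos hp, mul_div_cancel₀ _ hp.ne']
  change ‖∫ ω, ‖noiseKer c σ (X ω) y * noiseScore P X c σ y i‖ ∂P‖ ≤ _
  rw [h1, norm_norm]
  exact norm_integral_le_integral_norm _

theorem noiseScore_ae_eq_condExp (hX : Measurable X)
    (hX2 : ∀ i, MemLp (fun ω => X ω i) 2 P) (hc : 0 < c) (hq : 0 < q) (hσ : σ = q * c)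
    (hcσ : c ^ 2 + σ ^ 2 = 1) (i : Fin d) :
    (fun p : Ω × Euc d => noiseScore P X c σ (c • X p.1 + σ • p.2) i)
      =ᵐ[P.prod (_root_.stdGaussian d)]
      (P.prod (_root_.stdGaussian d))[fun p => (X p.1 - q⁻¹ • p.2) i |
        MeasurableSpace.comap (fun p => c • X p.1 + σ • p.2) inferInstance] := by
  have hσ0 : 0 < σ := hσ ▸ mul_pos hq hc
  have hF : Measurable fun p : Ω × Euc d => c • X p.1 + σ • p.2 := by fun_prop
  have hS := measurable_noiseScore_apply (P := P) (c := c) (σ := σ) hX i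
  have hW := (memLp_noise_residual (P := P) hX2 q i).integrable (by norm_num)
  have hI : Integrable (fun p : Ω × Euc d => noiseScore P X c σ (c • X p.1 + σ • p.2) i)
      (P.prod (_root_.stdGaussian d)) := by
    rw [integrable_noise_iff hX c hσ0 (f := fun p => noiseScore P X c σ p.2 i)
      (hS.comp measurable_snd)]
    exact integrable_noiseKer_mul_noiseScore hX hX2 hc hq hσ hcσ i
  refine ae_eq_condExp_of_forall_setIntegral_eq hF.comap_le hW (fun s _ _ => hI.integrableOn) ?_ ?_
  · rintro s ⟨B, hB, rfl⟩ -
    have e1 : ∀ f : Ω × Euc d → ℝ, ∫ p in (fun p : Ω × Euc d => c • X p.1 + σ • p.2) ⁻¹' B, f p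
        ∂(P.prod (_root_.stdGaussian d)) =
        ∫ p, B.indicator (fun _ => (1 : ℝ)) (c • X p.1 + σ • p.2) * f p
        ∂(P.prod (_root_.stdGaussian d)) := by
      intro f
      rw [← integral_indicator (hF hB)]
      refine integral_congr_ae (Filter.Eventually.of_forall fun p => ?_)
      by_cases h : c • X p.1 + σ • p.2 ∈ B <;> simp [Set.indicator, h]
    have hBm : Measurable (B.indicator fun _ => (1 : ℝ)) := measurable_const.indicator hB
    have hBb : ∀ y, ‖B.indicator (fun _ => (1 : ℝ)) y‖ ≤ 1 := fun y => by
      by_cases h : y ∈ B <;> simp [Set.indicator, h]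
    rw [e1, e1]
    simp only [noise_residual_eq hc hq hσ hcσ]
    have hBm2 : Measurable fun p : Ω × Euc d => B.indicator (fun _ => (1 : ℝ)) p.2 :=
      hBm.comp measurable_snd
    have hS2 : Measurable fun p : Ω × Euc d => noiseScore P X c σ p.2 i := hS.comp measurable_snd
    rw [integral_noise hX c hσ0
      (f := fun p => B.indicator (fun _ => (1 : ℝ)) p.2 * noiseScore P X c σ p.2 i)
      (hBm2.mul hS2), integral_noise hX c hσ0
      (f := fun p => B.indicator (fun _ => (1 : ℝ)) p.2 * ((σ ^ 2)⁻¹ * (X p.1 i - c * p.2 i)))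
      (hBm2.mul (by fun_prop))]
    congr 1
    have hb2 := Filter.Eventually.of_forall (f := ae (P.prod (volume : Measure (Euc d))))
      fun p : Ω × Euc d => hBb p.2
    have g1 := (integrable_noiseKer_mul_noiseScore (P := P) hX hX2 hc hq hσ hcσ i).bdd_mul
      hBm2.aestronglyMeasurable hb2
    have g2 := (integrable_noiseKer_mul_residual (P := P) hX hX2 hc hq hσ hcσ i).bdd_mul
      hBm2.aestronglyMeasurable hb2
    simp only [mul_left_comm (noiseKer c σ _ _) (B.indicator _ _)]
    rw [integral_prod_symm _ g1, integral_prod_symm _ g2]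
    refine integral_congr_ae (Filter.Eventually.of_forall fun y => ?_)
    have hp := noiseDens_pos (P := P) (c := c) (σ := σ) hX y
    simp only [integral_const_mul, integral_mul_const]
    congr 1
    change noiseDens P X c σ y * (_ / noiseDens P X c σ y) = _
    rw [mul_div_cancel₀ _ hp.ne']
  · exact (hS.comp (comap_measurable _)).aestronglyMeasurable

end

section
variable {d : ℕ} {Ω : Type*} [MeasurableSpace Ω] {P : Measure Ω} [IsProbabilityMeasure P]
  {X D : Ω → Euc d} {c σ q : ℝ}

theorem memLp_noiseScore (hX : Measurable X)
    (hX2 : ∀ i, MemLp (fun ω => X ω i) 2 P) (hc : 0 < c) (hq : 0 < q) (hσ : σ = q * c)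
    (hcσ : c ^ 2 + σ ^ 2 = 1) (i : Fin d) :
    MemLp (fun p : Ω × Euc d => noiseScore P X c σ (c • X p.1 + σ • p.2) i) 2
      (P.prod (_root_.stdGaussian d)) :=
  (memLp_congr_ae (noiseScore_ae_eq_condExp hX hX2 hc hq hσ hcσ i)).2
    ((memLp_noise_residual hX2 q i).condExp (by norm_num))

theorem integral_noise_residual_mul (hX : Measurable X)
    (hX2 : ∀ i, MemLp (fun ω => X ω i) 2 P) (hc : 0 < c) (hq : 0 < q) (hσ : σ = q * c)
    (hcσ : c ^ 2 + σ ^ 2 = 1) (i : Fin d) {h : Euc d → ℝ} (hh : Measurable h)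
    (hL : MemLp (fun p : Ω × Euc d => h (c • X p.1 + σ • p.2)) 2 (P.prod (_root_.stdGaussian d))) :
    ∫ p, (X p.1 - q⁻¹ • p.2) i * h (c • X p.1 + σ • p.2) ∂(P.prod (_root_.stdGaussian d)) =
      ∫ p, noiseScore P X c σ (c • X p.1 + σ • p.2) i * h (c • X p.1 + σ • p.2)
        ∂(P.prod (_root_.stdGaussian d)) := by
  have hF : Measurable fun p : Ω × Euc d => c • X p.1 + σ • p.2 := by fun_prop
  rw [integral_condExp_mul hF.comap_le (memLp_noise_residual hX2 q i) hL
    (hh.comp (comap_measurable _)).stronglyMeasurable]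
  refine integral_congr_ae ?_
  filter_upwards [noiseScore_ae_eq_condExp (P := P) hX hX2 hc hq hσ hcσ i] with p hp
  rw [hp]

theorem integral_norm_noiseScore_le (hX : Measurable X) (hD : Measurable D)
    (hlaw : P.map (fun ω => X ω + D ω) = P.map X) (hX2 : ∀ i, MemLp (fun ω => X ω i) 2 P)
    {s r : ℝ} (hq : 0 < q) (hc : 0 < c) (hσ : σ = q * c) (hcσ : c ^ 2 + σ ^ 2 = 1)
    (hs : 0 < s) (hr : 0 < r)
    (hr1 : r < 1) (hint : Integrable (fun ω => Real.exp (‖D ω‖ ^ 2 / (q ^ 2 * r))) P)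
    {S : ℝ} (hS : ∀ t : Finset (Fin d → ℕ), ∑ β ∈ t,
      (∫ ω, (P[fun ω' => scoreFam s q (X ω') (D ω') β |
        MeasurableSpace.comap X inferInstance]) ω ^ 2 ∂P) / (mdeg β * mfact β) ≤ S) :
    ∫ p, ‖noiseScore P X c σ (c • X p.1 + σ • p.2)‖ ^ 2 ∂(P.prod (_root_.stdGaussian d)) ≤ S := by
  have hσ0 : 0 < σ := hσ ▸ mul_pos hq hc
  have hF : Measurable fun p : Ω × Euc d => c • X p.1 + σ • p.2 := by fun_prop
  set ρ := noiseScore P X c σ with hρ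
  have hρm : Measurable ρ := measurable_noiseScore hX
  set φ₀ : Euc d → ℝ := fun y => ‖y‖ ^ 2 / 2 + Real.log (noiseDens P X c σ y) with hφ₀
  have hφm : Measurable φ₀ :=
    Measurable.add (by fun_prop) (Real.measurable_log.comp (measurable_noiseDens hX))
  set χ : ℕ → Euc d → ℝ := fun n y => (1 + (φ₀ y / (n + 1)) ^ 2)⁻¹ with hχ
  have hχm : ∀ n, Measurable (χ n) := fun n => by fun_prop
  have hχ0 : ∀ n y, 0 < χ n y := fun n y => by positivity
  have hχ1 : ∀ n y, χ n y ≤ 1 := fun n y => inv_le_one_of_one_le₀ (by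
    have := sq_nonneg (φ₀ y / (n + 1)); linarith)
  have hL : ∀ i, MemLp (fun p : Ω × Euc d => ρ (c • X p.1 + σ • p.2) i) 2
      (P.prod (_root_.stdGaussian d)) := memLp_noiseScore hX hX2 hc hq hσ hcσ
  have hI : Integrable (fun p : Ω × Euc d => ‖ρ (c • X p.1 + σ • p.2)‖ ^ 2)
      (P.prod (_root_.stdGaussian d)) := by
    simp only [EuclideanSpace.norm_sq_eq, Real.norm_eq_abs, sq_abs]
    exact integrable_finsetSum _ fun i _ => (hL i).integrable_sq
  have hχI : ∀ n, Integrable (fun p : Ω × Euc d =>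
      χ n (c • X p.1 + σ • p.2) * ‖ρ (c • X p.1 + σ • p.2)‖ ^ 2)
      (P.prod (_root_.stdGaussian d)) := fun n =>
    hI.bdd_mul (c := 1) ((hχm n).comp hF).aestronglyMeasurable
      (Filter.Eventually.of_forall fun p => by
        rw [Real.norm_eq_abs, abs_of_pos (hχ0 _ _)]; exact hχ1 _ _)
  have key : ∀ n, ∫ p, χ n (c • X p.1 + σ • p.2) * ‖ρ (c • X p.1 + σ • p.2)‖ ^ 2
      ∂(P.prod (_root_.stdGaussian d)) ≤ S := by
    intro n
    have hgn : ∀ y, ‖χ n y • ρ y‖ ^ 2 ≤ χ n y * ‖ρ y‖ ^ 2 := fun y => by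
      rw [norm_smul, mul_pow, Real.norm_eq_abs, sq_abs]
      have := hχ0 n y
      have := hχ1 n y
      gcongr
      nlinarith
    have hgm : Measurable fun y => χ n y • ρ y := (hχm n).smul hρm
    have hG : Integrable (fun p : Ω × Euc d =>
        ‖χ n (c • X p.1 + σ • p.2) • ρ (c • X p.1 + σ • p.2)‖ ^ 2)
        (P.prod (_root_.stdGaussian d)) := by
      refine (hχI n).mono' (((hgm.comp hF).norm.pow_const 2)).aestronglyMeasurable
        (Filter.Eventually.of_forall fun p => ?_)
      rw [Real.norm_eq_abs, abs_of_nonneg (by positivity)]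
      exact hgn _
    have hn : (0 : ℝ) < n + 1 := by positivity
    have h1 := integral_inner_le (φ := fun y => (n + 1 : ℝ) * Real.arctan (φ₀ y / (n + 1)))
      (B := (n + 1 : ℝ) * (Real.pi / 2)) (g := fun y => χ n y • ρ y)
      hX hD hlaw hX2 hq hc hσ hs hr hr1 hint (by fun_prop) ?_ ?_ hgm hG hS
    · have h2 : ∫ p, inner ℝ (X p.1 - q⁻¹ • p.2)
          (χ n (c • X p.1 + σ • p.2) • ρ (c • X p.1 + σ • p.2)) ∂(P.prod (_root_.stdGaussian d)) =
          ∫ p, χ n (c • X p.1 + σ • p.2) * ‖ρ (c • X p.1 + σ • p.2)‖ ^ 2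
            ∂(P.prod (_root_.stdGaussian d)) := by
        have hgi : ∀ i, Measurable fun y => χ n y * ρ y i := fun i => by fun_prop
        have hgL : ∀ i, MemLp (fun p : Ω × Euc d => χ n (c • X p.1 + σ • p.2) *
            ρ (c • X p.1 + σ • p.2) i) 2 (P.prod (_root_.stdGaussian d)) := fun i => by
          refine (hL i).mono ((hgi i).comp hF).aestronglyMeasurable
            (Filter.Eventually.of_forall fun p => ?_)
          rw [norm_mul, Real.norm_eq_abs, abs_of_pos (hχ0 _ _)]
          exact mul_le_of_le_one_left (norm_nonneg _) (hχ1 _ _)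
        have e1 := fun i => integral_noise_residual_mul hX hX2 hc hq hσ hcσ i (hgi i) (hgL i)
        have e2 : ∀ i, Integrable (fun p : Ω × Euc d => (X p.1 - q⁻¹ • p.2) i *
            (χ n (c • X p.1 + σ • p.2) * ρ (c • X p.1 + σ • p.2) i))
            (P.prod (_root_.stdGaussian d)) := fun i =>
          (memLp_noise_residual hX2 q i).integrable_mul (hgL i)
        have e3 : ∀ i, Integrable (fun p : Ω × Euc d => ρ (c • X p.1 + σ • p.2) i *
            (χ n (c • X p.1 + σ • p.2) * ρ (c • X p.1 + σ • p.2) i))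
            (P.prod (_root_.stdGaussian d)) := fun i => (hL i).integrable_mul (hgL i)
        have e4 : ∀ p : Ω × Euc d, inner ℝ (X p.1 - q⁻¹ • p.2)
            (χ n (c • X p.1 + σ • p.2) • ρ (c • X p.1 + σ • p.2)) =
            ∑ i, (X p.1 - q⁻¹ • p.2) i *
              (χ n (c • X p.1 + σ • p.2) * ρ (c • X p.1 + σ • p.2) i) := fun p => by
          rw [PiLp.inner_apply]
          refine Finset.sum_congr rfl fun i _ => ?_
          simp [mul_comm]
        have e5 : ∀ p : Ω × Euc d, χ n (c • X p.1 + σ • p.2) * ‖ρ (c • X p.1 + σ • p.2)‖ ^ 2 =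
            ∑ i, ρ (c • X p.1 + σ • p.2) i *
              (χ n (c • X p.1 + σ • p.2) * ρ (c • X p.1 + σ • p.2) i) := fun p => by
          rw [EuclideanSpace.norm_sq_eq, Finset.mul_sum]
          refine Finset.sum_congr rfl fun i _ => ?_
          rw [Real.norm_eq_abs, sq_abs]; ring
        simp only [e4, e5]
        rw [integral_finsetSum _ fun i _ => e2 i, integral_finsetSum _ fun i _ => e3 i]
        exact Finset.sum_congr rfl fun i _ => e1 i
      rw [h2] at h1
      have h3 := integral_mono hG (hχI n) fun p => hgn _
      linarith
    · intro y
      rw [abs_mul, abs_of_pos hn]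
      gcongr
      exact abs_le.2 ⟨(Real.neg_pi_div_two_lt_arctan _).le, (Real.arctan_lt_pi_div_two _).le⟩
    · intro i y
      have h2 : HasDerivAt (fun t : ℝ => φ₀ (y + t • EuclideanSpace.single i (1 : ℝ)))
          (c * ρ y i) 0 := hasLineDerivAt_log_noiseDens (P := P) hX hσ0 hcσ y i
      have h3 := ((h2.div_const (n + 1 : ℝ)).arctan).const_mul (n + 1 : ℝ)
      refine h3.congr_deriv ?_
      simp only [hχ, PiLp.smul_apply, smul_eq_mul, zero_smul, add_zero]
      field_simp
  refine le_of_tendsto' (x := Filter.atTop) (f := fun n : ℕ => ∫ p, χ n (c • X p.1 + σ • p.2) *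
    ‖ρ (c • X p.1 + σ • p.2)‖ ^ 2 ∂(P.prod (_root_.stdGaussian d))) ?_ key
  refine tendsto_integral_of_dominated_convergence _ (fun n => (hχI n).aestronglyMeasurable) hI
    (fun n => Filter.Eventually.of_forall fun p => ?_) (Filter.Eventually.of_forall fun p => ?_)
  · rw [norm_mul, Real.norm_eq_abs, abs_of_pos (hχ0 _ _), Real.norm_eq_abs,
      abs_of_nonneg (by positivity)]
    exact mul_le_of_le_one_left (by positivity) (hχ1 _ _)
  · have h1 : Filter.Tendsto (fun n : ℕ => φ₀ (c • X p.1 + σ • p.2) / ((n : ℝ) + 1))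
        Filter.atTop (𝓝 0) := by
      have := (tendsto_one_div_add_atTop_nhds_zero_nat (𝕜 := ℝ)).const_mul
        (φ₀ (c • X p.1 + σ • p.2))
      simpa [div_eq_mul_inv] using this
    have h2 := (((h1.pow 2).const_add 1).inv₀ (by norm_num)).mul_const
      (‖ρ (c • X p.1 + σ • p.2)‖ ^ 2)
    simpa [hχ] using h2

end

theorem mdeg_single {d : ℕ} (i : Fin d) (n : ℕ) : mdeg (Pi.single i n : Fin d → ℕ) = n := by
  simp [mdeg]

theorem finite_mdeg_eq (d k : ℕ) : {β : Fin d → ℕ | mdeg β = k}.Finite := by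
  refine (Set.finite_Iic fun _ : Fin d => k).subset fun β hβ i => ?_
  rw [← show mdeg β = k from hβ]
  exact Finset.single_le_sum (f := β) (fun _ _ => Nat.zero_le _) (Finset.mem_univ i)

theorem exists_eq_single_of_mdeg {d : ℕ} {β : Fin d → ℕ} (h : mdeg β = 1) :
    ∃ i, β = Pi.single i 1 := by
  have h0 : ∃ i, β i ≠ 0 := by
    by_contra! h0
    simp [mdeg, h0] at h
  obtain ⟨i, hi⟩ := h0
  have h1 := Finset.add_sum_erase Finset.univ β (Finset.mem_univ i)
  have h2 : β i + ∑ j ∈ Finset.univ.erase i, β j = 1 := h1.trans h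
  have h3 : ∑ j ∈ Finset.univ.erase i, β j = 0 := by omega
  refine ⟨i, funext fun j => ?_⟩
  by_cases hj : j = i
  · subst hj; simp; omega
  · rw [Pi.single_eq_of_ne hj]
    exact Finset.sum_eq_zero_iff.1 h3 j (by simp [hj])

theorem scoreFam_single {d : ℕ} (s q : ℝ) (x y : Euc d) (i : Fin d) :
    scoreFam s q x y (Pi.single i 1) = y i / s + x i := by
  have h1 : ∀ j : Fin d, (Pi.single i 1 : Fin d → ℕ) ≠ Pi.single j 2 := fun j h => by
    have := congrArg mdeg h
    simp [mdeg_single] at this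
  have h2 : ∀ j : Fin d, (Pi.single i 1 : Fin d → ℕ) = Pi.single j 1 ↔ i = j := fun j => by
    constructor
    · intro h
      by_contra hij
      have := congrFun h i
      simp [Pi.single_eq_of_ne hij] at this
    · rintro rfl; rfl
  have h3 : monoE (Pi.single i 1 : Fin d → ℕ) y = y i := by
    unfold monoE
    rw [Finset.prod_eq_single i]
    · simp
    · intro j _ hj; simp [Pi.single_eq_of_ne hj]
    · simp
  unfold scoreFam
  simp only [h1, h2, h3, mdeg_single]
  simp
  ring

theorem scoreFam_of_mdeg_two {d : ℕ} (s q : ℝ) (x y : Euc d) {β : Fin d → ℕ} (h : mdeg β = 2) :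
    scoreFam s q x y β = 2 / q * (monoE β y / (2 * s) - idFam β) := by
  have h1 : ∀ j : Fin d, β ≠ Pi.single j 1 := fun j hj => by
    rw [hj, mdeg_single] at h; omega
  have h2 : (∑ j, if β = Pi.single j 2 then 2 / q else 0) = 2 / q * idFam β := by
    unfold idFam
    split_ifs with hi
    · obtain ⟨i, rfl⟩ := hi
      rw [Finset.sum_eq_single i, if_pos rfl, mul_one]
      · intro j _ hj
        rw [if_neg]
        intro hh
        have := congrFun hh j
        simp [Pi.single_eq_of_ne hj] at this
      · simp
    · rw [mul_zero]
      exact Finset.sum_eq_zero fun j _ => if_neg fun hj => hi ⟨j, hj⟩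
  unfold scoreFam
  rw [h2, h]
  simp only [h1]
  simp
  ring

theorem scoreFam_of_three_le {d : ℕ} (s q : ℝ) (x y : Euc d) {β : Fin d → ℕ} (h : 3 ≤ mdeg β) :
    scoreFam s q x y β = (s * q ^ (mdeg β - 1))⁻¹ * monoE β y := by
  have h1 : ∀ j : Fin d, β ≠ Pi.single j 1 := fun j hj => by
    rw [hj, mdeg_single] at h; omega
  have h2 : ∀ j : Fin d, β ≠ Pi.single j 2 := fun j hj => by
    rw [hj, mdeg_single] at h; omega
  unfold scoreFam
  simp only [h1, h2]
  simp
  ring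

theorem tsum_split_three {u : ℕ → ℝ≥0∞} (h0 : u 0 = 0) :
    ∑' k, u k = u 1 + u 2 + ∑' k, if 3 ≤ k then u k else 0 := by
  have h : ∀ k, u k = (if k = 1 then u 1 else 0) + (if k = 2 then u 2 else 0) +
      if 3 ≤ k then u k else 0 := fun k => by
    obtain rfl | rfl | rfl | hk : k = 0 ∨ k = 1 ∨ k = 2 ∨ 3 ≤ k := by omega
    · simp [h0]
    · simp
    · simp
    · rw [if_neg (by omega), if_neg (by omega), if_pos hk]; simp
  rw [tsum_congr h, ENNReal.tsum_add, ENNReal.tsum_add, tsum_ite_eq, tsum_ite_eq]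

theorem tsum_mdeg_eq {d : ℕ} {a : (Fin d → ℕ) → ℝ} (ha : ∀ β, 0 ≤ a β) (k : ℕ) :
    ∑' β, (if mdeg β = k then ENNReal.ofReal (a β) else 0) =
      ENNReal.ofReal (∑' β, if mdeg β = k then a β else 0) := by
  rw [ENNReal.ofReal_tsum_of_nonneg]
  · refine tsum_congr fun β => ?_
    split_ifs <;> simp
  · intro β; split_ifs <;> simp [ha]
  · refine summable_of_hasFiniteSupport ((finite_mdeg_eq d k).subset fun β hβ => ?_)
    by_contra h
    exact hβ (if_neg h)

theorem tsum_mdeg_le {d : ℕ} {a A : (Fin d → ℕ) → ℝ} (ha : ∀ β, 0 ≤ a β) {k : ℕ} {K : ℝ}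
    (h : ∀ β, mdeg β = k → a β ≤ K * A β) :
    ∑' β, (if mdeg β = k then ENNReal.ofReal (a β) else 0) ≤
      ENNReal.ofReal (K * ∑' β, if mdeg β = k then A β else 0) := by
  rw [tsum_mdeg_eq ha, ← tsum_mul_left]
  refine ENNReal.ofReal_le_ofReal (Summable.tsum_le_tsum (fun β => ?_) ?_ ?_)
  · split_ifs with hβ
    · exact h β hβ
    · simp
  all_goals
    refine summable_of_hasFiniteSupport ((finite_mdeg_eq d k).subset fun β hβ => ?_)
    by_contra h
    exact hβ (by simp [show mdeg β ≠ k from h])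

theorem tsum_mdeg_one_le {d : ℕ} (a : (Fin d → ℕ) → ℝ≥0∞) :
    ∑' β, (if mdeg β = 1 then a β else 0) ≤ ∑ i, a (Pi.single i 1) := by
  calc ∑' β, (if mdeg β = 1 then a β else 0)
      ≤ ∑' β, ∑ i, (if β = Pi.single i 1 then a β else 0) := by
        refine ENNReal.tsum_le_tsum fun β => ?_
        split_ifs with h
        · obtain ⟨i, hi⟩ := exists_eq_single_of_mdeg h
          refine le_trans ?_ (Finset.single_le_sum (fun _ _ => zero_le) (Finset.mem_univ i))
          rw [if_pos hi]
        · exact zero_le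
    _ = ∑ i, ∑' β, (if β = Pi.single i 1 then a β else 0) :=
        Summable.tsum_finsetSum fun i _ => ENNReal.summable
    _ = ∑ i, a (Pi.single i 1) := by
        refine Finset.sum_congr rfl fun i _ => ?_
        rw [tsum_congr (g := fun β => if β = Pi.single i 1 then a (Pi.single i 1) else 0)
          fun β => by split_ifs with h <;> simp [h]]
        exact tsum_ite_eq _ _

theorem tsum_mdeg_fiberwise {d : ℕ} (f : (Fin d → ℕ) → ℝ≥0∞) :
    ∑' β, f β = ∑' k, ∑' β, if mdeg β = k then f β else 0 := by
  rw [ENNReal.tsum_comm]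
  refine tsum_congr fun β => ?_
  rw [tsum_congr (g := fun k => if k = mdeg β then f β else 0) fun k => by simp [eq_comm]]
  exact (tsum_ite_eq (mdeg β) fun _ => f β).symm

section
variable {d : ℕ} {Ω : Type*} [MeasurableSpace Ω]

/-- The conditional discrepancy of the exchangeable-type pair `(X, Y)` at scale `s` and time `t`. -/
def steinDiscrepancy (P : Measure Ω) (X Y : Ω → Euc d) (s t : ℝ) (ω : Ω) : ℝ≥0∞ :=
  ENNReal.ofReal (∑ i, ((P[fun ω' => (Y ω' i - X ω' i) / s + X ω' i |
      MeasurableSpace.comap X inferInstance]) ω) ^ 2)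
  + ENNReal.ofReal ((Real.exp (2 * t) - 1)⁻¹ *
      ∑' α : Fin d → ℕ, if mdeg α = 2 then
        ((2 : ℝ) / (mfact α : ℝ)) *
          ((P[fun ω' => monoE α (Y ω' - X ω') / (2 * s) - idFam α |
            MeasurableSpace.comap X inferInstance]) ω) ^ 2
      else 0)
  + ∑' k : ℕ, if 3 ≤ k then
      ENNReal.ofReal ((s ^ 2 * k * k.factorial * (Real.exp (2 * t) - 1) ^ (k - 1))⁻¹ *
        ∑' α : Fin d → ℕ, if mdeg α = k then
          ((k.factorial : ℝ) / (mfact α : ℝ)) *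
            ((P[fun ω' => monoE α (Y ω' - X ω') |
              MeasurableSpace.comap X inferInstance]) ω) ^ 2
        else 0)
    else 0

variable {P : Measure Ω} {X Y : Ω → Euc d}

theorem tsum_sq_condExp_scoreFam_le {s q t : ℝ} (hs : 0 < s) (hq : 0 < q)
    (ht : 0 < Real.exp (2 * t) - 1) (hqt : Real.exp (2 * t) - 1 ≤ q ^ 2) :
    ∀ᵐ ω ∂P, ∑' β, ENNReal.ofReal ((P[fun ω' => scoreFam s q (X ω') (Y ω' - X ω') β |
        MeasurableSpace.comap X inferInstance]) ω ^ 2 / (mdeg β * mfact β)) ≤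
      steinDiscrepancy P X Y s t ω := by
  set m : MeasurableSpace Ω := MeasurableSpace.comap X inferInstance with hm
  set τ := Real.exp (2 * t) - 1 with hτ
  have h1 : ∀ i, (fun ω' => scoreFam s q (X ω') (Y ω' - X ω') (Pi.single i 1)) =
      fun ω' => (Y ω' i - X ω' i) / s + X ω' i := fun i => funext fun ω' => by
    rw [scoreFam_single]; rfl
  have h2 : ∀ β, mdeg β = 2 → P[fun ω' => scoreFam s q (X ω') (Y ω' - X ω') β | m] =ᵐ[P]
      (2 / q) • P[fun ω' => monoE β (Y ω' - X ω') / (2 * s) - idFam β | m] := fun β hβ => by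
    simp only [scoreFam_of_mdeg_two s q _ _ hβ]
    exact condExp_smul (2 / q) (fun ω' => monoE β (Y ω' - X ω') / (2 * s) - idFam β) m
  have h3 : ∀ β, 3 ≤ mdeg β → P[fun ω' => scoreFam s q (X ω') (Y ω' - X ω') β | m] =ᵐ[P]
      (s * q ^ (mdeg β - 1))⁻¹ • P[fun ω' => monoE β (Y ω' - X ω') | m] := fun β hβ => by
    simp only [scoreFam_of_three_le s q _ _ hβ]
    exact condExp_smul ((s * q ^ (mdeg β - 1))⁻¹ : ℝ) (fun ω' => monoE β (Y ω' - X ω')) m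
  have h2' : ∀ᵐ ω ∂P, ∀ β, mdeg β = 2 →
      (P[fun ω' => scoreFam s q (X ω') (Y ω' - X ω') β | m]) ω =
        2 / q * (P[fun ω' => monoE β (Y ω' - X ω') / (2 * s) - idFam β | m]) ω := by
    rw [ae_all_iff]
    intro β
    by_cases hβ : mdeg β = 2
    · filter_upwards [h2 β hβ] with ω hω _ using hω
    · simp [hβ]
  have h3' : ∀ᵐ ω ∂P, ∀ β, 3 ≤ mdeg β →
      (P[fun ω' => scoreFam s q (X ω') (Y ω' - X ω') β | m]) ω =
        (s * q ^ (mdeg β - 1))⁻¹ * (P[fun ω' => monoE β (Y ω' - X ω') | m]) ω := by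
    rw [ae_all_iff]
    intro β
    by_cases hβ : 3 ≤ mdeg β
    · filter_upwards [h3 β hβ] with ω hω _ using hω
    · simp [hβ]
  filter_upwards [h2', h3'] with ω hω2 hω3
  have hfpos : ∀ β : Fin d → ℕ, (0 : ℝ) < mfact β := fun β => by exact_mod_cast mfact_pos β
  set a : (Fin d → ℕ) → ℝ := fun β => (P[fun ω' => scoreFam s q (X ω') (Y ω' - X ω') β | m]) ω ^ 2 /
    (mdeg β * mfact β) with ha
  have ha0 : ∀ β, 0 ≤ a β := fun β => by
    have := hfpos β
    positivity
  change ∑' β, ENNReal.ofReal (a β) ≤ _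
  rw [tsum_mdeg_fiberwise, tsum_split_three]
  · unfold steinDiscrepancy
    refine add_le_add (add_le_add ?_ ?_) (ENNReal.tsum_le_tsum fun k => ?_)
    · refine (tsum_mdeg_one_le _).trans ?_
      rw [ENNReal.ofReal_sum_of_nonneg fun i _ => sq_nonneg _]
      refine Finset.sum_le_sum fun i _ => ENNReal.ofReal_le_ofReal ?_
      have : mfact (Pi.single i 1 : Fin d → ℕ) = 1 := by
        unfold mfact
        refine Finset.prod_eq_one fun j _ => ?_
        by_cases hj : j = i
        · subst hj; simp
        · simp [Pi.single_eq_of_ne hj]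
      simp only [ha, h1, mdeg_single, this, Nat.cast_one, mul_one, div_one]
      exact le_rfl
    · refine tsum_mdeg_le ha0 fun β hβ => ?_
      have hf := hfpos β
      simp only [ha, hω2 β hβ, hβ]
      rw [show ∀ z : ℝ, (2 / q * z) ^ 2 / ((2 : ℕ) * (mfact β : ℝ)) =
        (q ^ 2)⁻¹ * (2 / mfact β * z ^ 2) from fun z => by push_cast; field_simp]
      gcongr
    · split_ifs with hk
      · refine tsum_mdeg_le ha0 fun β hβ => ?_
        have hf := hfpos β
        have hk0 : (0 : ℝ) < k := by exact_mod_cast (by omega : 0 < k)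
        have hkf : (0 : ℝ) < k.factorial := by exact_mod_cast k.factorial_pos
        simp only [ha, hω3 β (hβ ▸ hk), hβ]
        rw [show ∀ z : ℝ, ((s * q ^ (k - 1))⁻¹ * z) ^ 2 / ((k : ℝ) * (mfact β : ℝ)) =
          (s ^ 2 * k * k.factorial * (q ^ 2) ^ (k - 1))⁻¹ * (k.factorial / mfact β * z ^ 2) from
          fun z => by rw [pow_right_comm]; field_simp]
        gcongr
      · exact le_rfl
  · rw [ENNReal.tsum_eq_zero]
    intro β
    split_ifs with hβ
    · simp [ha, hβ]
    · rfl

end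

section
variable {d : ℕ} {Ω : Type*} [MeasurableSpace Ω] {P : Measure Ω} [IsProbabilityMeasure P]
  {X Y : Ω → Euc d} {c σ : ℝ}

theorem sum_integral_sq_condExp_scoreFam_le (hX2 : ∀ i, MemLp (fun ω => X ω i) 2 P)
    {s q t : ℝ} (hD2 : ∀ β, MemLp (fun ω => monoE β (Y ω - X ω)) 2 P)
    (hs : 0 < s) (hq : 0 < q) (ht : 0 < Real.exp (2 * t) - 1)
    (hqt : Real.exp (2 * t) - 1 ≤ q ^ 2)
    (htop : ∫⁻ ω, steinDiscrepancy P X Y s t ω ∂P ≠ ∞) (T : Finset (Fin d → ℕ)) :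
    ∑ β ∈ T, (∫ ω, (P[fun ω' => scoreFam s q (X ω') (Y ω' - X ω') β |
        MeasurableSpace.comap X inferInstance]) ω ^ 2 ∂P) / (mdeg β * mfact β) ≤
      (∫⁻ ω, steinDiscrepancy P X Y s t ω ∂P).toReal := by
  rw [← ENNReal.ofReal_le_iff_le_toReal htop]
  have hC := fun β => (memLp_scoreFam hX2 hD2 s q β).condExp
    (m := MeasurableSpace.comap X inferInstance) (by norm_num)
  have h1 : ∀ β : Fin d → ℕ, ENNReal.ofReal
      ((∫ ω, (P[fun ω' => scoreFam s q (X ω') (Y ω' - X ω') β |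
        MeasurableSpace.comap X inferInstance]) ω ^ 2 ∂P) / (mdeg β * mfact β)) =
      ∫⁻ ω, ENNReal.ofReal ((P[fun ω' => scoreFam s q (X ω') (Y ω' - X ω') β |
        MeasurableSpace.comap X inferInstance]) ω ^ 2 / (mdeg β * mfact β)) ∂P := fun β => by
    rw [← integral_div, ofReal_integral_eq_lintegral_ofReal ((hC β).integrable_sq.div_const _)
      (Filter.Eventually.of_forall fun ω => by positivity)]
  rw [ENNReal.ofReal_sum_of_nonneg fun β _ =>
    div_nonneg (integral_nonneg fun ω => sq_nonneg _) (by positivity)]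
  simp only [h1]
  rw [← lintegral_finsetSum' _ fun β _ =>
    ((hC β).integrable_sq.div_const _).aestronglyMeasurable.aemeasurable.ennreal_ofReal]
  refine lintegral_mono_ae ?_
  filter_upwards [tsum_sq_condExp_scoreFam_le (P := P) (X := X) (Y := Y) hs hq ht hqt] with ω hω
  exact (ENNReal.sum_le_tsum T).trans hω

theorem lintegral_norm_noiseScore_le (hX : Measurable X) (hY : Measurable Y)
    (hlaw : P.map Y = P.map X) (hX2 : ∀ i, MemLp (fun ω => X ω i) 2 P)
    {s t ξ : ℝ} (hs : 0 < s) (ht : 0 < t) (hξ : 0 < ξ)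
    (hint : ∫⁻ ω, ENNReal.ofReal (Real.exp ((1 + ξ) * ‖Y ω - X ω‖ ^ 2 /
      (Real.exp (2 * t) - 1))) ∂P ≠ ∞)
    (hc : 0 < c) (hσ : 0 < σ) (hcσ : c ^ 2 + σ ^ 2 = 1) (hct : c ≤ Real.exp (-t)) :
    ∫⁻ p, ENNReal.ofReal (‖noiseScore P X c σ (c • X p.1 + σ • p.2)‖ ^ 2)
        ∂(P.prod (_root_.stdGaussian d)) ≤ ∫⁻ ω, steinDiscrepancy P X Y s t ω ∂P := by
  by_cases htop : ∫⁻ ω, steinDiscrepancy P X Y s t ω ∂P = ∞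
  · rw [htop]; exact le_top
  have hq : 0 < σ / c := div_pos hσ hc
  have hσq : σ = σ / c * c := by field_simp
  have hτ : 0 < Real.exp (2 * t) - 1 := by
    have := Real.add_one_lt_exp (x := 2 * t) (by positivity)
    linarith
  have hqt : Real.exp (2 * t) - 1 ≤ (σ / c) ^ 2 := by
    rw [div_pow, le_div_iff₀ (by positivity)]
    have h1 : Real.exp (2 * t) * c ^ 2 ≤ 1 := by
      calc Real.exp (2 * t) * c ^ 2 ≤ Real.exp (2 * t) * Real.exp (-t) ^ 2 := by gcongr
        _ = 1 := by
          rw [← Real.exp_nat_mul, ← Real.exp_add, show 2 * t + (2 : ℕ) * -t = 0 by push_cast; ring,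
            Real.exp_zero]
    linarith
  have hint' : Integrable (fun ω => Real.exp (‖Y ω - X ω‖ ^ 2 / ((σ / c) ^ 2 * (1 + ξ)⁻¹))) P := by
    refine ⟨Measurable.aestronglyMeasurable (by fun_prop), ?_⟩
    rw [hasFiniteIntegral_iff_ofReal (Filter.Eventually.of_forall fun ω => by positivity)]
    refine lt_of_le_of_lt (lintegral_mono fun ω => ENNReal.ofReal_le_ofReal ?_) hint.lt_top
    rw [Real.exp_le_exp, div_mul_eq_div_div, div_inv_eq_mul, mul_comm, ← mul_div_assoc]
    gcongr
  have hD2 : ∀ β, MemLp (fun ω => monoE β (Y ω - X ω)) 2 P :=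
    memLp_monoE (hY.sub hX) (by positivity) hint'
  have h := integral_norm_noiseScore_le (D := fun ω => Y ω - X ω) hX (hY.sub hX)
    (by simpa using hlaw) hX2 hq hc hσq hcσ hs (inv_pos.2 (by positivity : 0 < 1 + ξ))
    (inv_lt_one_of_one_lt₀ (by linarith)) hint'
    (sum_integral_sq_condExp_scoreFam_le hX2 hD2 hs hq hτ hqt htop)
  have hI : Integrable (fun p : Ω × Euc d => ‖noiseScore P X c σ (c • X p.1 + σ • p.2)‖ ^ 2)
      (P.prod (_root_.stdGaussian d)) := by
    simp only [EuclideanSpace.norm_sq_eq, Real.norm_eq_abs, sq_abs]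
    exact integrable_finsetSum _ fun i _ =>
      (memLp_noiseScore hX hX2 hc hq hσq hcσ i).integrable_sq
  rw [← ofReal_integral_eq_lintegral_ofReal hI (Filter.Eventually.of_forall fun p => by positivity)]
  exact ENNReal.ofReal_le_of_le_toReal h

end

theorem eLpNorm_two_sq {Ω : Type*} [MeasurableSpace Ω] {P : Measure Ω} {d : ℕ} (f : Ω → Euc d) :
    eLpNorm f 2 P ^ 2 = ∫⁻ ω, ENNReal.ofReal (‖f ω‖ ^ 2) ∂P := by
  have h := eLpNorm_nnreal_pow_eq_lintegral (f := f) (μ := P) (p := 2) two_ne_zero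
  simp only [NNReal.coe_ofNat, ENNReal.rpow_two, ENNReal.coe_ofNat] at h
  rw [h]
  refine lintegral_congr fun ω => ?_
  rw [ENNReal.ofReal_pow (norm_nonneg _), ofReal_norm]

theorem eLpNorm_add_sq_of_orthogonal {Ω : Type*} [MeasurableSpace Ω] {P : Measure Ω} {d : ℕ}
    {f g : Ω → Euc d} (hf : MemLp f 2 P) (hg : MemLp g 2 P)
    (h : ∀ i, (∫ ω, f ω i * g ω i ∂P) = 0) :
    eLpNorm (fun ω => f ω + g ω) 2 P ^ 2 = eLpNorm f 2 P ^ 2 + eLpNorm g 2 P ^ 2 := by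
  have hI : ∀ {u : Ω → Euc d}, MemLp u 2 P → Integrable (fun ω => ‖u ω‖ ^ 2) P := fun hu =>
    hu.integrable_norm_pow (by norm_num)
  have hfg : ∀ i, Integrable (fun ω => f ω i * g ω i) P := fun i =>
    (hf.eval_piLp i).integrable_mul (hg.eval_piLp i)
  have e : ∀ {u : Ω → Euc d}, MemLp u 2 P →
      eLpNorm u 2 P ^ 2 = ENNReal.ofReal (∫ ω, ‖u ω‖ ^ 2 ∂P) := fun hu => by
    rw [eLpNorm_two_sq, ofReal_integral_eq_lintegral_ofReal (hI hu)
      (Filter.Eventually.of_forall fun ω => by positivity)]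
  have hadd : MemLp (fun ω => f ω + g ω) 2 P := hf.add hg
  rw [e hadd, e hf, e hg, ← ENNReal.ofReal_add (by positivity) (by positivity),
    ← integral_add (hI hf) (hI hg)]
  congr 1
  have h2 : ∀ ω, ‖f ω + g ω‖ ^ 2 = (‖f ω‖ ^ 2 + ‖g ω‖ ^ 2) + 2 * ∑ i, f ω i * g ω i := fun ω => by
    rw [norm_add_sq_real, PiLp.inner_apply]
    simp only [RCLike.inner_apply, conj_trivial, mul_comm (g ω _)]
    ring
  have h3 : Integrable (fun ω => 2 * ∑ i, f ω i * g ω i) P :=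
    (integrable_finsetSum _ fun i _ => hfg i).const_mul 2
  simp only [h2]
  rw [integral_add (by exact (hI hf).add (hI hg)) h3, integral_const_mul,
    integral_finsetSum _ fun i _ => hfg i]
  simp [h]

/-- A coupling `(y₀, y, m)` of `μ` and `ρ` with `‖y - y₀ - m‖₂ ≤ A` and `‖m‖₂ ^ 2 ≤ V`. -/
def HasCoupling {d : ℕ} (μ ρ : Measure (Euc d)) (A V : ℝ≥0∞) : Prop :=
  ∃ cpl : Measure (Euc d × Euc d × Euc d), IsProbabilityMeasure cpl ∧
    cpl.map (fun p => p.1) = μ ∧ cpl.map (fun p => p.2.1) = ρ ∧ MemLp (fun p => p.2.2) 2 cpl ∧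
    eLpNorm (fun p => p.2.1 - p.1 - p.2.2) 2 cpl ≤ A ∧ eLpNorm (fun p => p.2.2) 2 cpl ^ 2 ≤ V

theorem HasCoupling.mono {d : ℕ} {μ ρ : Measure (Euc d)} {A A' V V' : ℝ≥0∞}
    (h : HasCoupling μ ρ A V) (hA : A ≤ A') (hV : V ≤ V') : HasCoupling μ ρ A' V' := by
  obtain ⟨cpl, h0, h1, h2, h3, h4, h5⟩ := h
  exact ⟨cpl, h0, h1, h2, h3, h4.trans hA, h5.trans hV⟩

theorem hasCoupling_map {d : ℕ} {Ω : Type*} [MeasurableSpace Ω] {Q : Measure Ω}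
    [IsProbabilityMeasure Q] {F F' : Ω → Euc d} (hF : Measurable F) (hF' : Measurable F') :
    HasCoupling (Q.map F) (Q.map F') (eLpNorm (fun ω => F' ω - F ω) 2 Q) 0 := by
  have hm : Measurable fun ω => (F ω, F' ω, (0 : Euc d)) := by fun_prop
  refine ⟨Q.map fun ω => (F ω, F' ω, 0), Measure.isProbabilityMeasure_map hm.aemeasurable, ?_, ?_,
    ?_, ?_, ?_⟩
  · rw [Measure.map_map (by fun_prop) hm]; rfl
  · rw [Measure.map_map (by fun_prop) hm]; rfl
  · rw [memLp_map_measure_iff (Measurable.aestronglyMeasurable (by fun_prop)) hm.aemeasurable]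
    exact MemLp.zero
  · rw [eLpNorm_map_measure (Measurable.aestronglyMeasurable (by fun_prop)) hm.aemeasurable]
    simp [Function.comp_def]
  · rw [eLpNorm_map_measure (Measurable.aestronglyMeasurable (by fun_prop)) hm.aemeasurable]
    simp [Function.comp_def]

theorem HasCoupling.wassersteinDist_le {d : ℕ} {μ ρ : Measure (Euc d)} {A V : ℝ≥0∞}
    (h : HasCoupling μ ρ A V) : wassersteinDist 2 μ ρ ≤ A + V ^ (1 / 2 : ℝ) := by
  obtain ⟨cpl, hcpl, h1, h2, h3, hA, hV⟩ := h
  have hm : Measurable fun p : Euc d × Euc d × Euc d => (p.1, p.2.1) := by fun_prop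
  unfold wassersteinDist
  refine iInf_le_of_le (cpl.map fun p => (p.1, p.2.1)) (iInf_le_of_le
    (Measure.isProbabilityMeasure_map hm.aemeasurable) (iInf_le_of_le ?_ (iInf_le_of_le ?_ ?_)))
  · rw [Measure.map_map measurable_fst hm]; exact h1
  · rw [Measure.map_map measurable_snd hm]; exact h2
  · rw [lintegral_map (by fun_prop) hm]
    simp only [Real.rpow_two]
    have e : ∀ p : Euc d × Euc d × Euc d, ‖p.1 - p.2.1‖ =
        ‖(p.2.1 - p.1 - p.2.2) + p.2.2‖ := fun p => by
      rw [sub_add_cancel, norm_sub_rev]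
    simp only [e]
    rw [← eLpNorm_two_sq (fun p : Euc d × Euc d × Euc d => (p.2.1 - p.1 - p.2.2) + p.2.2)]
    have hsq : ∀ x : ℝ≥0∞, (x ^ 2) ^ (1 / 2 : ℝ) = x := fun x => by
      rw [← ENNReal.rpow_natCast, ← ENNReal.rpow_mul]; norm_num
    rw [hsq]
    refine (eLpNorm_add_le (Measurable.aestronglyMeasurable (by fun_prop)) h3.1
      (by norm_num)).trans (add_le_add hA ?_)
    rw [← hsq (eLpNorm _ 2 cpl)]
    exact ENNReal.rpow_le_rpow hV (by norm_num)

theorem HasCoupling.step {d : ℕ} {μ ρ : Measure (Euc d)} {A V : ℝ≥0∞} (h : HasCoupling μ ρ A V)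
    {Ω : Type*} [MeasurableSpace Ω] {Q : Measure Ω} [IsProbabilityMeasure Q] {F F' : Ω → Euc d}
    (hF : Measurable F) (hF' : Measurable F') (hρ : Q.map F = ρ)
    (hF'2 : MemLp F' 2 Q) {b : Euc d → Euc d} (hb : Measurable b)
    (hb2 : MemLp (fun ω => b (F ω)) 2 Q)
    (hbE : ∀ i, (fun ω => b (F ω) i) =ᵐ[Q]
      Q[fun ω => F' ω i | MeasurableSpace.comap F inferInstance])
    {A' v : ℝ≥0∞} (hA' : eLpNorm (fun ω => b (F ω) - F ω) 2 Q ≤ A')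
    (hv : eLpNorm (fun ω => F' ω - b (F ω)) 2 Q ≤ v) :
    HasCoupling μ (Q.map F') (A + A') (V + v ^ 2) := by
  obtain ⟨cpl, hcpl, h1, h2, h3, hA, hV⟩ := h
  set κ : Kernel (Euc d) (Euc d) := condDistrib F' F Q with hκ
  have hp : Measurable fun p : Euc d × Euc d × Euc d => p.2.1 := by fun_prop
  set cpl' := cpl ⊗ₘ (κ.comap (fun p : Euc d × Euc d × Euc d => p.2.1) hp) with hR
  have hR1 : cpl'.map Prod.fst = cpl := Measure.fst_compProd cpl _
  have hF'i : ∀ i, Integrable (fun ω => F' ω i) Q := fun i =>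
    (hF'2.eval_piLp i).integrable (by norm_num)
  have hpair : Measurable fun z : (Euc d × Euc d × Euc d) × Euc d => (z.1.2.1, z.2) := by fun_prop
  have hFF : Measurable fun ω => (F ω, F' ω) := by fun_prop
  have hR2 : cpl'.map (fun z => (z.1.2.1, z.2)) = Q.map (fun ω => (F ω, F' ω)) := by
    rw [← compProd_map_condDistrib hF'.aemeasurable, hρ, ← h2]
    refine Measure.ext_of_lintegral _ fun f hf => ?_
    rw [lintegral_map hf hpair, Measure.lintegral_compProd (by fun_prop),
      Measure.lintegral_compProd hf, lintegral_map (hf.lintegral_kernel_prod_right') hp]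
    rfl
  have hmean : ∀ i, ∀ᵐ p ∂cpl, Integrable (fun y : Euc d => y i) (κ p.2.1) ∧
      b p.2.1 i = ∫ y : Euc d, y i ∂(κ p.2.1) := by
    intro i
    have hi : StronglyMeasurable fun y : Euc d => y i :=
      (by fun_prop : Measurable fun y : Euc d => y i).stronglyMeasurable
    have hii : StronglyMeasurable fun z : Euc d × Euc d => z.2 i :=
      (by fun_prop : Measurable fun z : Euc d × Euc d => z.2 i).stronglyMeasurable
    have g1 : ∀ᵐ x ∂(Q.map F), Integrable (fun y : Euc d => y i) (κ x) := by
      refine Integrable.condDistrib_ae_map (f := fun z : Euc d × Euc d => z.2 i)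
        hF'.aemeasurable ?_
      rw [integrable_map_measure hii.aestronglyMeasurable hFF.aemeasurable]
      exact hF'i i
    have g2 : ∀ᵐ x ∂(Q.map F), b x i = ∫ y : Euc d, y i ∂(κ x) := by
      have hbi : Measurable fun x => b x i := by fun_prop
      rw [ae_map_iff hF.aemeasurable (measurableSet_eq_fun hbi
        (StronglyMeasurable.integral_condDistrib hii).measurable)]
      exact (hbE i).trans (condExp_ae_eq_integral_condDistrib hF hF'.aemeasurable hi (hF'i i))
    rw [hρ, ← h2] at g1 g2
    exact (ae_of_ae_map hp.aemeasurable g1).and (ae_of_ae_map hp.aemeasurable g2)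
  have hm2 : MemLp (fun z : (Euc d × Euc d × Euc d) × Euc d => z.1.2.2) 2 cpl' :=
    h3.comp_measurePreserving ⟨measurable_fst, hR1⟩
  have hlaw : ∀ {u : Euc d × Euc d → Euc d}, Measurable u →
      eLpNorm (fun z : (Euc d × Euc d × Euc d) × Euc d => u (z.1.2.1, z.2)) 2 cpl' =
        eLpNorm (fun ω => u (F ω, F' ω)) 2 Q := fun {u} hu => by
    have e1 := eLpNorm_map_measure (p := 2) (μ := cpl') (g := u) hu.aestronglyMeasurable
      hpair.aemeasurable
    have e2 := eLpNorm_map_measure (p := 2) (μ := Q) (g := u) hu.aestronglyMeasurable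
      hFF.aemeasurable
    exact e1.symm.trans ((congrArg (fun m => eLpNorm u 2 m) hR2).trans e2)
  have hn2 : MemLp (fun z : (Euc d × Euc d × Euc d) × Euc d => z.2 - b z.1.2.1) 2 cpl' := by
    refine ⟨Measurable.aestronglyMeasurable (by fun_prop), ?_⟩
    rw [hlaw (u := fun x => x.2 - b x.1) (by fun_prop)]
    exact (hF'2.sub hb2).2
  have horth : ∀ i, (∫ z : (Euc d × Euc d × Euc d) × Euc d,
      z.1.2.2 i * (z.2 - b z.1.2.1) i ∂cpl') = 0 := by
    intro i
    have hI : Integrable (fun z : (Euc d × Euc d × Euc d) × Euc d =>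
        z.1.2.2 i * (z.2 - b z.1.2.1) i) cpl' :=
      (hm2.eval_piLp i).integrable_mul (hn2.eval_piLp i)
    rw [Measure.integral_compProd hI]
    refine integral_eq_zero_of_ae ?_
    filter_upwards [hmean i] with p hpp
    have : IsProbabilityMeasure (κ p.2.1) := inferInstance
    simp only [Kernel.comap_apply, integral_const_mul, PiLp.sub_apply, Pi.zero_apply]
    rw [integral_sub hpp.1 (integrable_const _), integral_const, ← hpp.2]
    simp
  have hT : Measurable fun z : (Euc d × Euc d × Euc d) × Euc d =>
      (z.1.1, z.2, z.1.2.2 + (z.2 - b z.1.2.1)) := by fun_prop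
  refine ⟨cpl'.map fun z => (z.1.1, z.2, z.1.2.2 + (z.2 - b z.1.2.1)),
    Measure.isProbabilityMeasure_map hT.aemeasurable, ?_, ?_, ?_, ?_, ?_⟩
  · rw [Measure.map_map (by fun_prop) hT, ← h1]
    conv_rhs => rw [← hR1]
    rw [Measure.map_map (by fun_prop) (by fun_prop)]
    rfl
  · have e := congrArg (Measure.map Prod.snd) hR2
    rw [Measure.map_map (by fun_prop) hpair, Measure.map_map (by fun_prop) hFF] at e
    rw [Measure.map_map (by fun_prop) hT]
    exact e
  · rw [memLp_map_measure_iff (Measurable.aestronglyMeasurable (by fun_prop)) hT.aemeasurable]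
    exact hm2.add hn2
  · rw [eLpNorm_map_measure (Measurable.aestronglyMeasurable (by fun_prop)) hT.aemeasurable]
    have e : ((fun p : Euc d × Euc d × Euc d => p.2.1 - p.1 - p.2.2) ∘
        fun z : (Euc d × Euc d × Euc d) × Euc d => (z.1.1, z.2, z.1.2.2 + (z.2 - b z.1.2.1))) =
        (fun z => z.1.2.1 - z.1.1 - z.1.2.2) + fun z => b z.1.2.1 - z.1.2.1 := by
      funext z
      simp only [Function.comp_apply, Pi.add_apply]
      abel
    rw [e]
    refine (eLpNorm_add_le (Measurable.aestronglyMeasurable (by fun_prop))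
      (Measurable.aestronglyMeasurable (by fun_prop)) (by norm_num)).trans (add_le_add ?_ ?_)
    · refine le_trans (le_of_eq ?_) hA
      exact eLpNorm_comp_measurePreserving (f := Prod.fst)
        (g := fun p : Euc d × Euc d × Euc d => p.2.1 - p.1 - p.2.2)
        (Measurable.aestronglyMeasurable (by fun_prop)) ⟨measurable_fst, hR1⟩
    · rw [hlaw (u := fun x => b x.1 - x.1) (by fun_prop)]
      exact hA'
  · rw [eLpNorm_map_measure (Measurable.aestronglyMeasurable (by fun_prop)) hT.aemeasurable]
    change eLpNorm (fun z : (Euc d × Euc d × Euc d) × Euc d =>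
      z.1.2.2 + (z.2 - b z.1.2.1)) 2 cpl' ^ 2 ≤ _
    rw [eLpNorm_add_sq_of_orthogonal hm2 hn2 horth]
    refine add_le_add (le_trans (le_of_eq ?_) hV) ?_
    · congr 1
      exact eLpNorm_comp_measurePreserving (f := Prod.fst)
        (g := fun p : Euc d × Euc d × Euc d => p.2.2)
        (Measurable.aestronglyMeasurable (by fun_prop)) ⟨measurable_fst, hR1⟩
    · rw [hlaw (u := fun x => x.2 - b x.1) (by fun_prop)]
      gcongr

section
variable {d : ℕ} {Ω : Type*} {X : Ω → Euc d} {θ : ℝ}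

/-- The rotation `cos θ X + sin θ Z` between `X` and a Gaussian vector `Z`. -/
def gaussRotation (X : Ω → Euc d) (θ : ℝ) (p : Ω × Euc d) : Euc d :=
  Real.cos θ • X p.1 + Real.sin θ • p.2

theorem gaussRotation_add (hθ : 0 < θ) (hθ' : θ < Real.pi / 2) (h : ℝ) (p : Ω × Euc d) :
    gaussRotation X (θ + h) p = Real.cos h • gaussRotation X θ p -
      (Real.sin h * Real.sin θ) • (X p.1 - (Real.tan θ)⁻¹ • p.2) := by
  have hs : Real.sin θ ≠ 0 := (Real.sin_pos_of_pos_of_lt_pi hθ (by linarith [Real.pi_pos])).ne'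
  have hc : Real.cos θ ≠ 0 := (Real.cos_pos_of_mem_Ioo ⟨by linarith, hθ'⟩).ne'
  ext i
  simp only [gaussRotation, PiLp.sub_apply, PiLp.smul_apply, PiLp.add_apply, smul_eq_mul,
    Real.cos_add, Real.sin_add, Real.tan_eq_sin_div_cos]
  field_simp
  ring

variable [MeasurableSpace Ω] {P : Measure Ω}

theorem memLp_fst_prod_stdGaussian (hX2 : ∀ i, MemLp (fun ω => X ω i) 2 P) :
    MemLp (fun p : Ω × Euc d => X p.1) 2 (P.prod (_root_.stdGaussian d)) :=
  MemLp.of_eval_piLp fun i => (hX2 i).comp_measurePreserving measurePreserving_fst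

variable [IsProbabilityMeasure P]

theorem memLp_snd_prod_stdGaussian :
    MemLp (fun p : Ω × Euc d => p.2) 2 (P.prod (_root_.stdGaussian d)) := by
  refine MemLp.of_eval_piLp fun i => ?_
  have h2 : MemLp (fun z : Euc d => z i) 2 (_root_.stdGaussian d) := by
    have := memLp_hermiteM (Pi.single i 1 : Fin d → ℕ)
    rwa [funext (hermiteM_single i)] at this
  exact h2.comp_measurePreserving measurePreserving_snd

/-- The `L²` norm of the score of `gaussRotation X θ`. -/
def scoreNorm (P : Measure Ω) (X : Ω → Euc d) (θ : ℝ) : ℝ≥0∞ :=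
  eLpNorm (fun p => noiseScore P X (Real.cos θ) (Real.sin θ) (gaussRotation X θ p)) 2
    (P.prod (_root_.stdGaussian d))

/-- The sum of the `L²` norms of `X` and of a Gaussian vector. -/
def rotationBound (P : Measure Ω) (X : Ω → Euc d) : ℝ≥0∞ :=
  eLpNorm (fun p : Ω × Euc d => X p.1) 2 (P.prod (_root_.stdGaussian d)) +
    eLpNorm (fun p : Ω × Euc d => p.2) 2 (P.prod (_root_.stdGaussian d))

theorem rotationBound_ne_top (hX2 : ∀ i, MemLp (fun ω => X ω i) 2 P) : rotationBound P X ≠ ∞ :=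
  ENNReal.add_ne_top.2
    ⟨(memLp_fst_prod_stdGaussian hX2).2.ne, memLp_snd_prod_stdGaussian.2.ne⟩

theorem measurable_gaussRotation (hX : Measurable X) (θ : ℝ) : Measurable (gaussRotation X θ) := by
  unfold gaussRotation; fun_prop

theorem eLpNorm_smul_add_smul_le (hX2 : ∀ i, MemLp (fun ω => X ω i) 2 P) {a b e : ℝ}
    (ha : |a| ≤ e) (hb : |b| ≤ e) :
    eLpNorm (fun p : Ω × Euc d => a • X p.1 + b • p.2) 2 (P.prod (_root_.stdGaussian d)) ≤
      ENNReal.ofReal e * rotationBound P X := by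
  have h1 := memLp_fst_prod_stdGaussian hX2
  have h2 : MemLp (fun p : Ω × Euc d => p.2) 2 (P.prod (_root_.stdGaussian d)) :=
    memLp_snd_prod_stdGaussian
  unfold rotationBound
  rw [mul_add]
  have he : ∀ {x : ℝ}, |x| ≤ e → ‖x‖ₑ ≤ ENNReal.ofReal e := fun hx => by
    rw [Real.enorm_eq_ofReal_abs]; exact ENNReal.ofReal_le_ofReal hx
  refine (eLpNorm_add_le (f := a • fun p : Ω × Euc d => X p.1) (g := b • fun p : Ω × Euc d => p.2)
    (h1.1.const_smul a) (h2.1.const_smul b) (by norm_num)).trans ?_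
  rw [eLpNorm_const_smul, eLpNorm_const_smul]
  gcongr
  · exact he ha
  · exact he hb

theorem memLp_gaussRotation (hX2 : ∀ i, MemLp (fun ω => X ω i) 2 P) (θ : ℝ) :
    MemLp (gaussRotation X θ) 2 (P.prod (_root_.stdGaussian d)) :=
  ((memLp_fst_prod_stdGaussian hX2).const_smul (c := Real.cos θ)).add
    (memLp_snd_prod_stdGaussian.const_smul (c := Real.sin θ))

theorem memLp_rotation_residual (hX2 : ∀ i, MemLp (fun ω => X ω i) 2 P) (θ : ℝ) :
    MemLp (fun p : Ω × Euc d => X p.1 - (Real.tan θ)⁻¹ • p.2) 2 (P.prod (_root_.stdGaussian d)) :=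
  (memLp_fst_prod_stdGaussian hX2).sub
    (memLp_snd_prod_stdGaussian.const_smul (c := (Real.tan θ)⁻¹))

theorem memLp_score_rotation (hX : Measurable X) (hX2 : ∀ i, MemLp (fun ω => X ω i) 2 P)
    (hθ : 0 < θ) (hθ' : θ < Real.pi / 2) :
    MemLp (fun p => noiseScore P X (Real.cos θ) (Real.sin θ) (gaussRotation X θ p)) 2
      (P.prod (_root_.stdGaussian d)) := by
  have hc : 0 < Real.cos θ := Real.cos_pos_of_mem_Ioo ⟨by linarith, hθ'⟩
  exact MemLp.of_eval_piLp fun i => memLp_noiseScore hX hX2 hc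
    (Real.tan_pos_of_pos_of_lt_pi_div_two hθ hθ') (Real.tan_mul_cos hc.ne').symm
    (by rw [add_comm]; exact Real.sin_sq_add_cos_sq θ) i

theorem eLpNorm_rotation_residual_sq (hX : Measurable X) (hX2 : ∀ i, MemLp (fun ω => X ω i) 2 P)
    (hθ : 0 < θ) (hθ' : θ < Real.pi / 2) :
    eLpNorm (fun p : Ω × Euc d => X p.1 - (Real.tan θ)⁻¹ • p.2) 2
        (P.prod (_root_.stdGaussian d)) ^ 2 =
      scoreNorm P X θ ^ 2 + eLpNorm (fun p : Ω × Euc d => (X p.1 - (Real.tan θ)⁻¹ • p.2) -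
        noiseScore P X (Real.cos θ) (Real.sin θ) (gaussRotation X θ p)) 2
          (P.prod (_root_.stdGaussian d)) ^ 2 := by
  have hc : 0 < Real.cos θ := Real.cos_pos_of_mem_Ioo ⟨by linarith, hθ'⟩
  have hW := memLp_rotation_residual hX2 θ
  have hS := memLp_score_rotation hX hX2 hθ hθ'
  unfold scoreNorm
  have hWS : MemLp (fun p : Ω × Euc d => (X p.1 - (Real.tan θ)⁻¹ • p.2) -
      noiseScore P X (Real.cos θ) (Real.sin θ) (gaussRotation X θ p)) 2
      (P.prod (_root_.stdGaussian d)) := hW.sub hS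
  rw [← eLpNorm_add_sq_of_orthogonal hS hWS]
  · simp only [add_sub_cancel]
  · intro i
    have key := integral_noise_residual_mul hX hX2 hc
      (Real.tan_pos_of_pos_of_lt_pi_div_two hθ hθ') (Real.tan_mul_cos hc.ne').symm
      (by rw [add_comm]; exact Real.sin_sq_add_cos_sq θ) i
      (measurable_noiseScore_apply (P := P) hX i) (hS.eval_piLp i)
    have h1 : Integrable (fun p : Ω × Euc d => (X p.1 - (Real.tan θ)⁻¹ • p.2) i *
        noiseScore P X (Real.cos θ) (Real.sin θ) (gaussRotation X θ p) i)
        (P.prod (_root_.stdGaussian d)) := (hW.eval_piLp i).integrable_mul (hS.eval_piLp i)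
    have h2 : Integrable (fun p : Ω × Euc d =>
        noiseScore P X (Real.cos θ) (Real.sin θ) (gaussRotation X θ p) i *
        noiseScore P X (Real.cos θ) (Real.sin θ) (gaussRotation X θ p) i)
        (P.prod (_root_.stdGaussian d)) := (hS.eval_piLp i).integrable_mul (hS.eval_piLp i)
    have e := (integral_sub h1 h2).trans (sub_eq_zero.2 key)
    rw [← e]
    refine integral_congr_ae (Filter.Eventually.of_forall fun p => ?_)
    simp only [PiLp.sub_apply]
    ring

theorem sin_mul_eLpNorm_rotation_residual_le (hX2 : ∀ i, MemLp (fun ω => X ω i) 2 P)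
    (hθ : 0 < θ) (hθ' : θ < Real.pi / 2) :
    ENNReal.ofReal (Real.sin θ) * eLpNorm (fun p : Ω × Euc d => X p.1 - (Real.tan θ)⁻¹ • p.2) 2
        (P.prod (_root_.stdGaussian d)) ≤ rotationBound P X := by
  have hs : 0 < Real.sin θ := Real.sin_pos_of_pos_of_lt_pi hθ (by linarith [Real.pi_pos])
  rw [← Real.enorm_of_nonneg hs.le, ← eLpNorm_const_smul]
  have h := eLpNorm_smul_add_smul_le (a := Real.sin θ) (b := -Real.cos θ) (e := 1) hX2
    (Real.abs_sin_le_one θ) (by rw [abs_neg]; exact Real.abs_cos_le_one θ)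
  rw [ENNReal.ofReal_one, one_mul] at h
  refine le_trans (le_of_eq ?_) h
  congr 1
  funext p
  ext i
  simp only [PiLp.sub_apply, PiLp.smul_apply, PiLp.add_apply, smul_eq_mul, Pi.smul_apply,
    Real.tan_eq_sin_div_cos]
  field_simp
  ring

theorem sin_mul_scoreNorm_le (hX : Measurable X) (hX2 : ∀ i, MemLp (fun ω => X ω i) 2 P)
    (hθ : 0 < θ) (hθ' : θ < Real.pi / 2) :
    ENNReal.ofReal (Real.sin θ) * scoreNorm P X θ ≤ rotationBound P X := by
  refine le_trans ?_ (sin_mul_eLpNorm_rotation_residual_le hX2 hθ hθ')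
  gcongr
  rw [← ENNReal.pow_le_pow_left_iff two_ne_zero, eLpNorm_rotation_residual_sq hX hX2 hθ hθ']
  exact le_self_add

theorem HasCoupling.rotation_add {μ : Measure (Euc d)} {A V : ℝ≥0∞} (hX : Measurable X)
    (hX2 : ∀ i, MemLp (fun ω => X ω i) 2 P) (hθ : 0 < θ) (hθ' : θ < Real.pi / 2) {h : ℝ}
    (hh : 0 ≤ h) (hcpl : HasCoupling μ ((P.prod (_root_.stdGaussian d)).map (gaussRotation X θ)) A V) :
    HasCoupling μ ((P.prod (_root_.stdGaussian d)).map (gaussRotation X (θ + h)))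
      (A + (ENNReal.ofReal (h ^ 2) * rotationBound P X +
        ENNReal.ofReal (h * Real.sin θ) * scoreNorm P X θ))
      (V + (ENNReal.ofReal h * rotationBound P X) ^ 2) := by
  have hc : 0 < Real.cos θ := Real.cos_pos_of_mem_Ioo ⟨by linarith, hθ'⟩
  have hs : 0 < Real.sin θ := Real.sin_pos_of_pos_of_lt_pi hθ (by linarith [Real.pi_pos])
  have hW := memLp_rotation_residual hX2 θ
  have hS := memLp_score_rotation hX hX2 hθ hθ'
  have hF := memLp_gaussRotation hX2 θ
  have hmS := measurable_noiseScore (P := P) (c := Real.cos θ) (σ := Real.sin θ) hX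
  have habs : |Real.sin h| ≤ h := by
    simpa [abs_of_nonneg hh] using Real.abs_sin_le_abs (x := h)
  have hcos : |Real.cos h - 1| ≤ h ^ 2 := by
    rw [abs_of_nonpos (by linarith [Real.cos_le_one h])]
    nlinarith [Real.one_sub_sq_div_two_le_cos (x := h), sq_nonneg h]
  have hbF : MemLp (fun p => Real.cos h • gaussRotation X θ p - (Real.sin h * Real.sin θ) •
      noiseScore P X (Real.cos θ) (Real.sin θ) (gaussRotation X θ p)) 2
      (P.prod (_root_.stdGaussian d)) :=
    (hF.const_smul (c := Real.cos h)).sub (hS.const_smul (c := Real.sin h * Real.sin θ))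
  refine hcpl.step (b := fun y => Real.cos h • y - (Real.sin h * Real.sin θ) •
      noiseScore P X (Real.cos θ) (Real.sin θ) y) (measurable_gaussRotation hX θ)
    (measurable_gaussRotation hX (θ + h)) rfl (memLp_gaussRotation hX2 _) (by fun_prop) hbF ?_ ?_ ?_
  · intro i
    have key := noiseScore_ae_eq_condExp hX hX2 hc
      (Real.tan_pos_of_pos_of_lt_pi_div_two hθ hθ') (Real.tan_mul_cos hc.ne').symm
      (by rw [add_comm]; exact Real.sin_sq_add_cos_sq θ) i
    have hm : MeasurableSpace.comap (gaussRotation X θ) inferInstance ≤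
        (inferInstance : MeasurableSpace (Ω × Euc d)) := (measurable_gaussRotation hX θ).comap_le
    have hFi : Integrable (fun p => Real.cos h * gaussRotation X θ p i)
        (P.prod (_root_.stdGaussian d)) :=
      ((hF.eval_piLp i).integrable (by norm_num)).const_mul _
    have hWi : Integrable (fun p : Ω × Euc d => (X p.1 - (Real.tan θ)⁻¹ • p.2) i)
        (P.prod (_root_.stdGaussian d)) := (hW.eval_piLp i).integrable (by norm_num)
    have e : (fun p => gaussRotation X (θ + h) p i) = (fun p => Real.cos h * gaussRotation X θ p i) -
        (Real.sin h * Real.sin θ) • fun p : Ω × Euc d => (X p.1 - (Real.tan θ)⁻¹ • p.2) i := by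
      funext p
      rw [gaussRotation_add hθ hθ']
      rfl
    rw [e]
    have hFm : StronglyMeasurable[MeasurableSpace.comap (gaussRotation X θ) inferInstance]
        (fun p => Real.cos h * gaussRotation X θ p i) :=
      (by fun_prop : Measurable fun y : Euc d => Real.cos h * y i).stronglyMeasurable.comp_measurable
        (comap_measurable _)
    filter_upwards [condExp_sub hFi (hWi.smul (Real.sin h * Real.sin θ))
        (MeasurableSpace.comap (gaussRotation X θ) inferInstance),
      condExp_smul (μ := P.prod (_root_.stdGaussian d)) (Real.sin h * Real.sin θ)
        (fun p : Ω × Euc d => (X p.1 - (Real.tan θ)⁻¹ • p.2) i)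
        (MeasurableSpace.comap (gaussRotation X θ) inferInstance), key] with p h1 h2 h3
    rw [h1, Pi.sub_apply, condExp_of_stronglyMeasurable hm hFm hFi, h2]
    simp only [Pi.smul_apply, PiLp.sub_apply, PiLp.smul_apply, smul_eq_mul]
    congr 2
  · have e : (fun p => (Real.cos h • gaussRotation X θ p - (Real.sin h * Real.sin θ) •
        noiseScore P X (Real.cos θ) (Real.sin θ) (gaussRotation X θ p)) - gaussRotation X θ p) =
        (fun p => ((Real.cos h - 1) * Real.cos θ) • X p.1 +
          ((Real.cos h - 1) * Real.sin θ) • p.2) -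
        (Real.sin h * Real.sin θ) •
          fun p => noiseScore P X (Real.cos θ) (Real.sin θ) (gaussRotation X θ p) := by
      funext p
      simp only [gaussRotation, Pi.sub_apply, Pi.smul_apply]
      module
    rw [e]
    refine (eLpNorm_sub_le (Measurable.aestronglyMeasurable (by fun_prop)) (hS.1.const_smul _)
      (by norm_num)).trans (add_le_add (eLpNorm_smul_add_smul_le hX2 ?_ ?_) ?_)
    · rw [abs_mul]
      exact (mul_le_of_le_one_right (abs_nonneg _) (Real.abs_cos_le_one θ)).trans hcos
    · rw [abs_mul]
      exact (mul_le_of_le_one_right (abs_nonneg _) (Real.abs_sin_le_one θ)).trans hcos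
    · rw [eLpNorm_const_smul, Real.enorm_eq_ofReal_abs, abs_mul, abs_of_pos hs]
      unfold scoreNorm
      gcongr
  · have e : (fun p => gaussRotation X (θ + h) p - (Real.cos h • gaussRotation X θ p -
        (Real.sin h * Real.sin θ) •
          noiseScore P X (Real.cos θ) (Real.sin θ) (gaussRotation X θ p))) =
        (-(Real.sin h * Real.sin θ)) • fun p => (X p.1 - (Real.tan θ)⁻¹ • p.2) -
          noiseScore P X (Real.cos θ) (Real.sin θ) (gaussRotation X θ p) := by
      funext p
      rw [gaussRotation_add hθ hθ', Pi.smul_apply]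
      module
    rw [e, eLpNorm_const_smul, Real.enorm_eq_ofReal_abs, abs_neg, abs_mul, abs_of_pos hs,
      ENNReal.ofReal_mul (abs_nonneg _), mul_assoc]
    refine mul_le_mul' (ENNReal.ofReal_le_ofReal habs)
      (le_trans ?_ (sin_mul_eLpNorm_rotation_residual_le hX2 hθ hθ'))
    gcongr ENNReal.ofReal _ * ?_
    rw [← ENNReal.pow_le_pow_left_iff two_ne_zero, eLpNorm_rotation_residual_sq hX hX2 hθ hθ']
    exact le_add_self

end

theorem mul_sin_le_cos_sub_cos {θ h : ℝ} (hθ : 0 ≤ Real.sin θ) (hh : 0 < h) (hh1 : h ≤ 1) :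
    h * Real.sin θ ≤ Real.cos (θ - h) - Real.cos θ + h ^ 2 := by
  rw [Real.cos_sub]
  have h1 := Real.sin_gt_sub_cube hh
  have h2 := Real.one_sub_sq_div_two_le_cos (x := h)
  have h3 := Real.cos_le_one h
  have h4 := Real.sin_le_one θ
  have h5 := Real.cos_le_one θ
  have h6 := mul_le_mul_of_nonneg_left h1.le hθ
  have h7 : Real.cos θ * (1 - Real.cos h) ≤ h ^ 2 / 2 :=
    (mul_le_of_le_one_left (by linarith) h5).trans (by linarith)
  have h8 : Real.sin θ * (h ^ 3 / 6) ≤ h ^ 3 / 6 := mul_le_of_le_one_left (by positivity) h4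
  have h9 : h ^ 3 ≤ h ^ 2 := pow_le_pow_of_le_one hh.le hh1 (by norm_num)
  nlinarith

theorem lintegral_exp_neg_Ioc {a b : ℝ} (hab : a ≤ b) :
    ∫⁻ t in Set.Ioc a b, ENNReal.ofReal (Real.exp (-t)) =
      ENNReal.ofReal (Real.exp (-a) - Real.exp (-b)) := by
  have hi : IntervalIntegrable (fun t => Real.exp (-t)) volume a b :=
    (by fun_prop : Continuous fun t => Real.exp (-t)).intervalIntegrable a b
  rw [← ofReal_integral_eq_lintegral_ofReal
    ((intervalIntegrable_iff_integrableOn_Ioc_of_le hab).1 hi)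
    (Filter.Eventually.of_forall fun t => (Real.exp_pos _).le),
    ← intervalIntegral.integral_of_le hab,
    intervalIntegral.integral_eq_sub_of_hasDerivAt (f := fun t => -Real.exp (-t)) _ hi]
  · congr 1; ring
  · intro t _
    simpa using! (hasDerivAt_id t).neg.exp.neg

theorem ofReal_mul_le_lintegral_exp_neg {a b : ℝ} (hab : a ≤ b) {K : ℝ≥0∞} {J : ℝ → ℝ≥0∞}
    (hK : ∀ t ∈ Set.Ioc a b, K ≤ J t) :
    ENNReal.ofReal (Real.exp (-a) - Real.exp (-b)) * K ≤
      ∫⁻ t in Set.Ioc a b, ENNReal.ofReal (Real.exp (-t)) * J t := by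
  rw [← lintegral_exp_neg_Ioc hab, ← lintegral_mul_const _ (by fun_prop)]
  exact setLIntegral_mono' measurableSet_Ioc fun t ht => by gcongr; exact hK t ht

section
variable {d : ℕ} {Ω : Type*} [MeasurableSpace Ω] {P : Measure Ω} [IsProbabilityMeasure P]
  {X : Ω → Euc d}

theorem hasCoupling_gaussRotation (hX : Measurable X) (hX2 : ∀ i, MemLp (fun ω => X ω i) 2 P)
    {η : ℝ} (hη : 0 ≤ η) :
    HasCoupling (P.map X) ((P.prod (_root_.stdGaussian d)).map (gaussRotation X η))
      (ENNReal.ofReal η * rotationBound P X) 0 := by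
  have h0 : P.map X = (P.prod (_root_.stdGaussian d)).map fun p : Ω × Euc d => X p.1 := by
    have := measurePreserving_fst (μ := P) (ν := _root_.stdGaussian d)
    conv_lhs => rw [← this.map_eq]
    rw [Measure.map_map hX measurable_fst]
    rfl
  rw [h0]
  refine (hasCoupling_map (by fun_prop) (measurable_gaussRotation hX η)).mono ?_ le_rfl
  have e : (fun p => gaussRotation X η p - X p.1) =
      fun p : Ω × Euc d => (Real.cos η - 1) • X p.1 + Real.sin η • p.2 := by
    funext p
    simp only [gaussRotation]
    module
  rw [e]
  refine eLpNorm_smul_add_smul_le hX2 ?_ ?_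
  · have := Real.abs_cos_sub_cos_le η 0
    simpa [abs_of_nonneg hη] using this
  · simpa [abs_of_nonneg hη] using Real.abs_sin_le_abs (x := η)

variable {J : ℝ → ℝ≥0∞}

theorem hasCoupling_gaussRotation_add (hX : Measurable X)
    (hX2 : ∀ i, MemLp (fun ω => X ω i) 2 P)
    (hJ : ∀ t, 0 < t → ∀ θ, 0 < θ → θ < Real.pi / 2 → Real.cos θ ≤ Real.exp (-t) →
      scoreNorm P X θ ≤ J t)
    {η h : ℝ} (hh : 0 < h) (hh1 : h ≤ 1) (hη : h ≤ η) (n : ℕ) (hn : η + n * h ≤ Real.pi / 2) :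
    HasCoupling (P.map X) ((P.prod (_root_.stdGaussian d)).map (gaussRotation X (η + n * h)))
      (ENNReal.ofReal η * rotationBound P X + n * (ENNReal.ofReal (h ^ 2) *
        (rotationBound P X + rotationBound P X / ENNReal.ofReal (Real.sin η))) +
        ∫⁻ t in Set.Ioc 0 (-Real.log (Real.cos (η + n * h - h))),
          ENNReal.ofReal (Real.exp (-t)) * J t)
      (n * (ENNReal.ofReal h * rotationBound P X) ^ 2) := by
  induction n with
  | zero =>
    simp only [Nat.cast_zero, zero_mul, add_zero]
    exact (hasCoupling_gaussRotation hX hX2 (hh.le.trans hη)).mono le_self_add le_rfl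
  | succ n ih =>
    have hlt : η + n * h < Real.pi / 2 := by push_cast at hn; linarith
    have hη0 : 0 < η := hh.trans_le hη
    set θ := η + n * h with hθdef
    have hηθ : η ≤ θ := by rw [hθdef]; nlinarith [(Nat.cast_nonneg n : (0 : ℝ) ≤ n)]
    have hθ : 0 < θ := hη0.trans_le hηθ
    have hpi := Real.pi_pos
    have e1 : η + ((n + 1 : ℕ) : ℝ) * h = θ + h := by rw [hθdef]; push_cast; ring
    rw [e1, add_sub_cancel_right]
    have hc : 0 < Real.cos θ := Real.cos_pos_of_mem_Ioo ⟨by linarith, hlt⟩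
    have hs : 0 < Real.sin θ := Real.sin_pos_of_pos_of_lt_pi hθ (by linarith)
    have hsη : 0 < Real.sin η := Real.sin_pos_of_pos_of_lt_pi hη0 (by linarith)
    have hsle : Real.sin η ≤ Real.sin θ :=
      Real.sin_le_sin_of_le_of_le_pi_div_two (by linarith) hlt.le hηθ
    have hcc : Real.cos θ ≤ Real.cos (θ - h) :=
      Real.cos_le_cos_of_nonneg_of_le_pi (by linarith) (by linarith) (by linarith)
    have hc' : 0 < Real.cos (θ - h) := hc.trans_le hcc
    set a := -Real.log (Real.cos (θ - h)) with ha
    set b := -Real.log (Real.cos θ) with hb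
    have ha0 : 0 ≤ a := neg_nonneg.2 (Real.log_nonpos hc'.le (Real.cos_le_one _))
    have hab : a ≤ b := neg_le_neg (Real.log_le_log hc hcc)
    have hK : scoreNorm P X θ ≤ rotationBound P X / ENNReal.ofReal (Real.sin η) := by
      rw [ENNReal.le_div_iff_mul_le (Or.inl (by simpa using hsη)) (Or.inl ENNReal.ofReal_ne_top),
        mul_comm]
      refine le_trans ?_ (sin_mul_scoreNorm_le hX hX2 hθ hlt)
      gcongr
    have hI : ENNReal.ofReal (Real.cos (θ - h) - Real.cos θ) * scoreNorm P X θ ≤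
        ∫⁻ t in Set.Ioc a b, ENNReal.ofReal (Real.exp (-t)) * J t := by
      have hea : Real.exp (-a) = Real.cos (θ - h) := by rw [ha, neg_neg, Real.exp_log hc']
      have heb : Real.exp (-b) = Real.cos θ := by rw [hb, neg_neg, Real.exp_log hc]
      rw [← hea, ← heb]
      refine ofReal_mul_le_lintegral_exp_neg hab fun t ht => ?_
      refine hJ t (ha0.trans_lt ht.1) θ hθ hlt ?_
      rw [← heb]
      exact Real.exp_le_exp.2 (neg_le_neg ht.2)
    refine (HasCoupling.rotation_add hX hX2 hθ hlt hh.le (ih hlt.le)).mono ?_ ?_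
    · have hstep : ENNReal.ofReal (h * Real.sin θ) * scoreNorm P X θ ≤
          (∫⁻ t in Set.Ioc a b, ENNReal.ofReal (Real.exp (-t)) * J t) +
            ENNReal.ofReal (h ^ 2) * (rotationBound P X / ENNReal.ofReal (Real.sin η)) := by
        calc _ ≤ ENNReal.ofReal (Real.cos (θ - h) - Real.cos θ + h ^ 2) * scoreNorm P X θ := by
              gcongr
              exact mul_sin_le_cos_sub_cos hs.le hh hh1
          _ = ENNReal.ofReal (Real.cos (θ - h) - Real.cos θ) * scoreNorm P X θ +
              ENNReal.ofReal (h ^ 2) * scoreNorm P X θ := by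
              rw [ENNReal.ofReal_add (by linarith) (by positivity), add_mul]
          _ ≤ _ := by gcongr
      have hU : (∫⁻ t in Set.Ioc 0 b, ENNReal.ofReal (Real.exp (-t)) * J t) =
          (∫⁻ t in Set.Ioc 0 a, ENNReal.ofReal (Real.exp (-t)) * J t) +
            ∫⁻ t in Set.Ioc a b, ENNReal.ofReal (Real.exp (-t)) * J t := by
        rw [← Set.Ioc_union_Ioc_eq_Ioc ha0 hab,
          lintegral_union measurableSet_Ioc (Set.Ioc_disjoint_Ioc_of_le le_rfl)]
      refine (add_le_add_right (add_le_add_right hstep _) _).trans (le_of_eq ?_)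
      rw [hU]
      push_cast
      ring
    · push_cast
      exact le_of_eq (by ring)

theorem wassersteinDist_stdGaussian_le_lintegral (hX : Measurable X)
    (hX2 : ∀ i, MemLp (fun ω => X ω i) 2 P)
    (hJ : ∀ t, 0 < t → ∀ θ, 0 < θ → θ < Real.pi / 2 → Real.cos θ ≤ Real.exp (-t) →
      scoreNorm P X θ ≤ J t) :
    wassersteinDist 2 (P.map X) (_root_.stdGaussian d) ≤
      ∫⁻ t in Set.Ioi 0, ENNReal.ofReal (Real.exp (-t)) * J t := by
  set C := rotationBound P X with hCdef
  set I := ∫⁻ t in Set.Ioi 0, ENNReal.ofReal (Real.exp (-t)) * J t with hI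
  have hC : C ≠ ∞ := rotationBound_ne_top hX2
  have hZ : (P.prod (_root_.stdGaussian d)).map (gaussRotation X (Real.pi / 2)) =
      _root_.stdGaussian d := by
    have e : gaussRotation X (Real.pi / 2) = Prod.snd := by
      funext p; simp [gaussRotation]
    rw [e]
    exact measurePreserving_snd.map_eq
  have hpi := Real.pi_gt_three
  have hpi4 := Real.pi_le_four
  have hfin : ∀ {η : ℝ}, 0 < η → η < 1 → wassersteinDist 2 (P.map X) (_root_.stdGaussian d) ≤
      ENNReal.ofReal η * C + I := by
    intro η hη hη1
    set D := C + C / ENNReal.ofReal (Real.sin η) with hD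
    have hsη : 0 < Real.sin η := Real.sin_pos_of_pos_of_lt_pi hη (by linarith)
    have hDtop : D ≠ ∞ := ENNReal.add_ne_top.2
      ⟨hC, ENNReal.div_ne_top hC (by simpa using hsη)⟩
    have hN : ∀ N : ℕ, 2 / η < N → wassersteinDist 2 (P.map X) (_root_.stdGaussian d) ≤
        ENNReal.ofReal η * C + ENNReal.ofReal (4 / N) * D + I +
          (ENNReal.ofReal (4 / N) * C ^ 2) ^ (1 / 2 : ℝ) := by
      intro N hN
      have hN0 : (0 : ℝ) < N := (by positivity : (0 : ℝ) < 2 / η).trans hN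
      set h := (Real.pi / 2 - η) / N with hh
      have hh0 : 0 < h := div_pos (by linarith) hN0
      have hhη : h ≤ η := by
        rw [div_lt_iff₀ hη] at hN
        rw [hh, div_le_iff₀ hN0]
        nlinarith
      have hend : η + N * h = Real.pi / 2 := by rw [hh]; field_simp; ring
      have hsq : (N : ℝ≥0∞) * ENNReal.ofReal (h ^ 2) ≤ ENNReal.ofReal (4 / N) := by
        rw [← ENNReal.ofReal_natCast, ← ENNReal.ofReal_mul hN0.le]
        refine ENNReal.ofReal_le_ofReal ?_
        rw [hh, div_pow, le_div_iff₀ hN0]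
        have : (N : ℝ) * ((Real.pi / 2 - η) ^ 2 / N ^ 2) * N = (Real.pi / 2 - η) ^ 2 := by
          field_simp
        rw [this]
        nlinarith
      have H := (hasCoupling_gaussRotation_add hX hX2 hJ hh0 (hhη.trans hη1.le) hhη N
        hend.le).wassersteinDist_le
      rw [hend, hZ] at H
      refine H.trans ?_
      rw [← hCdef, ← hD, ← mul_assoc, mul_pow, ← ENNReal.ofReal_pow hh0.le, ← mul_assoc]
      have hsub : (∫⁻ t in Set.Ioc 0 (-Real.log (Real.cos (Real.pi / 2 - h))),
          ENNReal.ofReal (Real.exp (-t)) * J t) ≤ I :=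
        lintegral_mono_set Set.Ioc_subset_Ioi_self
      gcongr
    have hlim0 : Filter.Tendsto (fun N : ℕ => ENNReal.ofReal (4 / N)) Filter.atTop (𝓝 0) := by
      simpa using ENNReal.tendsto_ofReal (tendsto_const_div_atTop_nhds_zero_nat (4 : ℝ))
    have l1 : Filter.Tendsto (fun N : ℕ => ENNReal.ofReal (4 / N) * D) Filter.atTop (𝓝 0) := by
      simpa using ENNReal.Tendsto.mul_const hlim0 (Or.inr hDtop)
    have l2 : Filter.Tendsto (fun N : ℕ => (ENNReal.ofReal (4 / N) * C ^ 2) ^ (1 / 2 : ℝ))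
        Filter.atTop (𝓝 0) := by
      have := (ENNReal.Tendsto.mul_const hlim0 (Or.inr (ENNReal.pow_ne_top hC (n := 2)))).ennrpow_const
        (1 / 2 : ℝ)
      simpa using this
    have l3 := ((tendsto_const_nhds (x := ENNReal.ofReal η * C)).add l1).add
      (tendsto_const_nhds (x := I)) |>.add l2
    rw [add_zero, add_zero] at l3
    refine ge_of_tendsto l3 ?_
    filter_upwards [tendsto_natCast_atTop_atTop.eventually_gt_atTop (2 / η)] with N hN'
    exact hN N hN'
  have hη0 : Filter.Tendsto (fun η : ℝ => ENNReal.ofReal η) (𝓝[>] 0) (𝓝 0) := by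
    simpa using (ENNReal.continuous_ofReal.tendsto 0).mono_left nhdsWithin_le_nhds
  have hl := (ENNReal.Tendsto.mul_const hη0 (Or.inr hC)).add_const I
  rw [zero_mul, zero_add] at hl
  refine ge_of_tendsto hl ?_
  filter_upwards [Ioo_mem_nhdsGT (zero_lt_one' ℝ)] with η hη
  exact hfin hη.1 hη.2

end

theorem stein_W2
    {d : ℕ} {Ω : Type*} [MeasurableSpace Ω] (P : Measure Ω) [IsProbabilityMeasure P]
    (ν : Measure (Euc d)) [IsProbabilityMeasure ν]
    (hmom : Integrable (fun x => ‖x‖ ^ 2) ν)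
    (X : ℝ → Ω → Euc d)
    (hXmeas : ∀ t, 0 ≤ t → Measurable (X t))
    (hXlaw : ∀ t, 0 ≤ t → P.map (X t) = ν)
    (hcond : ∀ ε : ℝ, 0 < ε → ∃ ξ : ℝ, 0 < ξ ∧ ∃ M : ℝ, 0 < M ∧ ∀ t ∈ Set.Icc ε ε⁻¹,
      (∫⁻ ω, ENNReal.ofReal (Real.exp ((1 + ξ) * ‖X t ω - X 0 ω‖ ^ 2 /
          (Real.exp (2 * t) - 1))) ∂P) ≤ ENNReal.ofReal M)
    (s : ℝ) (hs : 0 < s) :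
    wassersteinDist 2 ν (stdGaussian d) ≤
      ∫⁻ t in Set.Ioi (0 : ℝ),
        ENNReal.ofReal (Real.exp (-t)) *
          (∫⁻ ω,
            (ENNReal.ofReal (∑ i, ((P[fun ω' => (X t ω' i - X 0 ω' i) / s + X 0 ω' i |
                MeasurableSpace.comap (X 0) inferInstance]) ω) ^ 2)
            + ENNReal.ofReal ((Real.exp (2 * t) - 1)⁻¹ *
                ∑' α : Fin d → ℕ, if mdeg α = 2 then
                  ((2 : ℝ) / (mfact α : ℝ)) *
                    ((P[fun ω' => monoE α (X t ω' - X 0 ω') / (2 * s) - idFam α |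
                      MeasurableSpace.comap (X 0) inferInstance]) ω) ^ 2
                else 0)
            + ∑' k : ℕ, if 3 ≤ k then
                ENNReal.ofReal ((s ^ 2 * k * k.factorial * (Real.exp (2 * t) - 1) ^ (k - 1))⁻¹ *
                  ∑' α : Fin d → ℕ, if mdeg α = k then
                    ((k.factorial : ℝ) / (mfact α : ℝ)) *
                      ((P[fun ω' => monoE α (X t ω' - X 0 ω') |
                        MeasurableSpace.comap (X 0) inferInstance]) ω) ^ 2
                  else 0)
              else 0) ∂P) ^ ((1 : ℝ) / 2) := by
  have hX := hXmeas 0 le_rfl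
  have hX2 : ∀ i, MemLp (fun ω => X 0 ω i) 2 P := by
    have hid : MemLp (fun x : Euc d => x) 2 ν :=
      (memLp_two_iff_integrable_sq_norm (Measurable.aestronglyMeasurable (by fun_prop))).2 hmom
    rw [← hXlaw 0 le_rfl,
      memLp_map_measure_iff (Measurable.aestronglyMeasurable (by fun_prop)) hX.aemeasurable] at hid
    exact fun i => hid.eval_piLp i
  rw [← hXlaw 0 le_rfl]
  refine wassersteinDist_stdGaussian_le_lintegral
    (J := fun t => (∫⁻ ω, steinDiscrepancy P (X 0) (X t) s t ω ∂P) ^ (1 / 2 : ℝ)) hX hX2 ?_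
  intro t ht θ hθ hθ' hle
  obtain ⟨ξ, hξ, M, -, hM⟩ := hcond (min t t⁻¹) (by positivity)
  have hmem : t ∈ Set.Icc (min t t⁻¹) (min t t⁻¹)⁻¹ :=
    ⟨min_le_left _ _, by
      rw [le_inv_comm₀ ht (by positivity)]
      exact min_le_right _ _⟩
  have key := lintegral_norm_noiseScore_le hX (hXmeas t ht.le)
    ((hXlaw t ht.le).trans (hXlaw 0 le_rfl).symm) hX2 hs ht hξ
    ((hM t hmem).trans_lt ENNReal.ofReal_lt_top).ne
    (Real.cos_pos_of_mem_Ioo ⟨by linarith, hθ'⟩)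
    (Real.sin_pos_of_pos_of_lt_pi hθ (by linarith [Real.pi_pos]))
    (by rw [add_comm]; exact Real.sin_sq_add_cos_sq θ) hle
  rw [← eLpNorm_two_sq] at key
  have h2 := ENNReal.rpow_le_rpow key (by norm_num : (0 : ℝ) ≤ 1 / 2)
  rwa [← ENNReal.rpow_natCast, ← ENNReal.rpow_mul, show ((2 : ℕ) : ℝ) * (1 / 2) = 1 by norm_num,
    ENNReal.rpow_one] at h2

end
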